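/- Let (M,g) be an n-dimensional proper second-order symmetric spacetime, i.e. a connected Lorentzian manifold whose curvature tensor R satisfies ∇∇R = 0 but ∇R ≠ 0. Then (M,g) is locally isometric to a direct product spacetime (M₁ × M₂, g₁ ⊕ g₂), where (M₂,g₂) is a non-flat locally symmetric Riemannian manifold (possibly of dimension 0) and (M₁,g₁) is a generalized Cahen–Wallach space of order 2, i.e. M₁ = ℝ^{d+2} (d ≥ 1) with metric g₁ = -2du(dv + p_{ij}(u)x^i x^j du) + δ_{ij} dx^i dx^j (i,j = 2,…,d+1), where each function p_{ij} is affine, p_{ij}(u) = α_{ij}u + β_{ij} with α_{ij}, β_{ij} ∈ ℝ, and Σ_{i,j}(α_{ij})² ≠ 0. -/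

import Mathlib

/-!
Core framework: coordinate tensor calculus on `ℝⁿ` (partial derivatives, Christoffel
symbols, Riemann curvature, iterated covariant derivatives `∇ʳR`), and a notion of
pseudo-Riemannian manifold given by an atlas of metric charts whose transition
functions are smooth isometries.
-/

noncomputable section

open Matrix Set

/-- Partial derivative in the `i`-th coordinate direction. -/
def pd {n : ℕ} (i : Fin n) (f : (Fin n → ℝ) → ℝ) (x : Fin n → ℝ) : ℝ :=
  fderiv ℝ f x (Pi.single i 1)

/-- A metric in coordinates: a matrix-valued function on (an open subset of) `ℝⁿ`. -/
abbrev MetricMat (n : ℕ) := (Fin n → ℝ) → Matrix (Fin n) (Fin n) ℝ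

/-- Christoffel symbols `Γ^k_{ij}` of a coordinate metric. -/
def christoffel {n : ℕ} (g : MetricMat n) (x : Fin n → ℝ) (k i j : Fin n) : ℝ :=
  (1 / 2) * ∑ l, (g x)⁻¹ k l *
    (pd i (fun y => g y l j) x + pd j (fun y => g y l i) x - pd l (fun y => g y i j) x)

/-- Curvature tensor `R^l_{kij}` (1,3) of a coordinate metric. -/
def curvUp {n : ℕ} (g : MetricMat n) (x : Fin n → ℝ) (l k i j : Fin n) : ℝ :=
  pd i (fun y => christoffel g y l j k) x - pd j (fun y => christoffel g y l i k) x
    + ∑ m, christoffel g x l i m * christoffel g x m j k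
    - ∑ m, christoffel g x l j m * christoffel g x m i k

/-- Covariant tensor fields of valence `s` in coordinates. -/
abbrev TensorField (n s : ℕ) := (Fin n → ℝ) → (Fin s → Fin n) → ℝ

/-- The (0,4) Riemann curvature tensor `R_{lkij} = g_{lm} R^m_{kij}`. -/
def riemann {n : ℕ} (g : MetricMat n) : TensorField n 4 := fun x idx =>
  ∑ m, g x (idx 0) m * curvUp g x m (idx 1) (idx 2) (idx 3)

/-- The Ricci tensor `R_{ij} = R^m_{imj}`. -/
def ricci {n : ℕ} (g : MetricMat n) (x : Fin n → ℝ) (i j : Fin n) : ℝ :=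
  ∑ m, curvUp g x m i m j

/-- Covariant derivative of a covariant tensor field; the new (derivative) index is slot `0`. -/
def covDeriv {n s : ℕ} (g : MetricMat n) (T : TensorField n s) : TensorField n (s + 1) :=
  fun x idx =>
    pd (idx 0) (fun y => T y fun a => idx a.succ) x
      - ∑ a : Fin s, ∑ e, christoffel g x e (idx 0) (idx a.succ)
          * T x (Function.update (fun b : Fin s => idx b.succ) a e)

/-- Iterated covariant derivative `∇ʳ R` of the curvature tensor. -/
def nablaR {n : ℕ} (g : MetricMat n) : (r : ℕ) → TensorField n (4 + r)
  | 0 => riemann g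
  | r + 1 => covDeriv g (nablaR g r)

/-- `∇ʳ R = 0` on `U` (`r`-th symmetry in coordinates). -/
def RthSymmetricOn {n : ℕ} (g : MetricMat n) (U : Set (Fin n → ℝ)) (r : ℕ) : Prop :=
  ∀ x ∈ U, ∀ idx, nablaR g r x idx = 0

/-- Vanishing curvature (flatness) on `U`. -/
def FlatOn {n : ℕ} (g : MetricMat n) (U : Set (Fin n → ℝ)) : Prop :=
  ∀ x ∈ U, ∀ idx, riemann g x idx = 0

/-- A symmetric matrix is of Lorentzian signature `(-,+,…,+)` iff it is congruent to
`diag(-1,1,…,1)`. -/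
def IsLorentzMat {n : ℕ} (A : Matrix (Fin n) (Fin n) ℝ) : Prop :=
  ∃ P : Matrix (Fin n) (Fin n) ℝ, IsUnit P.det ∧
    Pᵀ * A * P = Matrix.diagonal fun i : Fin n => if (i : ℕ) = 0 then (-1 : ℝ) else 1

/-- `τ` is smooth on `S` and pulls the metric `g₂` back to the metric `g₁` there. -/
def IsPullbackIsometry {n m : ℕ} (g₁ : MetricMat n) (g₂ : MetricMat m)
    (τ : (Fin n → ℝ) → Fin m → ℝ) (S : Set (Fin n → ℝ)) : Prop :=
  (∀ a : Fin m, ContDiffOn ℝ (⊤ : ℕ∞) (fun y => τ y a) S) ∧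
  ∀ x ∈ S, ∀ i j : Fin n,
    g₁ x i j = ∑ a, ∑ b, g₂ (τ x) a b * pd i (fun y => τ y a) x * pd j (fun y => τ y b) x

/-- A metric chart on a topological space `M`: a homeomorphism of an open set of `M` onto
an open set of `ℝⁿ`, together with the coordinate expression of the metric tensor. -/
structure MetricChart (n : ℕ) (M : Type) [TopologicalSpace M] where
  dom : Set M
  open_dom : IsOpen dom
  φ : M → Fin n → ℝ
  ψ : (Fin n → ℝ) → M
  ran : Set (Fin n → ℝ)
  open_ran : IsOpen ran
  maps_to : ∀ p ∈ dom, φ p ∈ ran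
  maps_from : ∀ x ∈ ran, ψ x ∈ dom
  left_inv : ∀ p ∈ dom, ψ (φ p) = p
  right_inv : ∀ x ∈ ran, φ (ψ x) = x
  cont_phi : ContinuousOn φ dom
  cont_psi : ContinuousOn ψ ran
  g : MetricMat n
  smooth_g : ∀ a b : Fin n, ContDiffOn ℝ (⊤ : ℕ∞) (fun x => g x a b) ran
  symm_g : ∀ x ∈ ran, (g x).IsSymm
  nondeg_g : ∀ x ∈ ran, IsUnit (g x).det

/-- An `n`-dimensional pseudo-Riemannian manifold: a topological space covered by metric
charts whose transition functions are (smooth) isometries for the chart metrics. -/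
structure PRManifold (n : ℕ) where
  M : Type
  top : TopologicalSpace M
  chartAt : M → @MetricChart n M top
  mem_chart : ∀ p : M, p ∈ (chartAt p).dom
  compatible : ∀ p q : M,
    IsPullbackIsometry (chartAt p).g (chartAt q).g ((chartAt q).φ ∘ (chartAt p).ψ)
      ((chartAt p).φ '' ((chartAt p).dom ∩ (chartAt q).dom))

attribute [instance] PRManifold.top

namespace PRManifold

variable {n : ℕ}

/-- The metric is Lorentzian, of signature `(-,+,…,+)`. -/
def IsLorentzian (X : PRManifold n) : Prop :=
  ∀ p : X.M, ∀ x ∈ (X.chartAt p).ran, IsLorentzMat ((X.chartAt p).g x)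

/-- The metric is Riemannian (positive definite). -/
def IsRiemannian (X : PRManifold n) : Prop :=
  ∀ p : X.M, ∀ x ∈ (X.chartAt p).ran, ((X.chartAt p).g x).PosDef

/-- Connectedness of the underlying space. -/
def Conn (X : PRManifold n) : Prop := ConnectedSpace X.M

/-- Simple connectedness of the underlying space. -/
def SimplyConn (X : PRManifold n) : Prop := SimplyConnectedSpace X.M

/-- `∇ʳ R = 0` (in every chart). -/
def RthSymmetric (X : PRManifold n) (r : ℕ) : Prop :=
  ∀ p : X.M, RthSymmetricOn (X.chartAt p).g (X.chartAt p).ran r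

/-- `∇ʳ R = 0` but `∇^{r-1} R ≠ 0`. -/
def ProperRthSymmetric (X : PRManifold n) (r : ℕ) : Prop :=
  X.RthSymmetric r ∧ ¬ X.RthSymmetric (r - 1)

/-- The curvature tensor vanishes identically. -/
def Flat (X : PRManifold n) : Prop :=
  ∀ p : X.M, FlatOn (X.chartAt p).g (X.chartAt p).ran

/-- The Ricci tensor vanishes identically. -/
def RicciFlat (X : PRManifold n) : Prop :=
  ∀ p : X.M, ∀ x ∈ (X.chartAt p).ran, ∀ i j, ricci (X.chartAt p).g x i j = 0

end PRManifold

/-- A curve `c` (written in coordinates) is a geodesic of `g` on the parameter set `I`: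
its components are twice differentiable and satisfy the geodesic equations. -/
def IsGeodesicCurve {n : ℕ} (g : MetricMat n) (I : Set ℝ) (c : ℝ → Fin n → ℝ) : Prop :=
  ∀ t ∈ I, ∀ k : Fin n,
    DifferentiableAt ℝ (fun s => c s k) t ∧
    DifferentiableAt ℝ (deriv fun s => c s k) t ∧
    deriv (deriv fun s => c s k) t
      + ∑ i, ∑ j, christoffel g (c t) k i j * deriv (fun s => c s i) t
          * deriv (fun s => c s j) t = 0

namespace PRManifold

variable {n : ℕ}

/-- `γ` is a geodesic of `X` on the parameter set `I`: around each parameter it lies in a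
chart and its coordinate expression solves the geodesic equations there. -/
def IsGeodesic (X : PRManifold n) (I : Set ℝ) (γ : ℝ → X.M) : Prop :=
  ∀ t ∈ I, ∃ p : X.M, ∃ ε > (0 : ℝ),
    (∀ s ∈ I ∩ Set.Ioo (t - ε) (t + ε), γ s ∈ (X.chartAt p).dom) ∧
    IsGeodesicCurve (X.chartAt p).g (I ∩ Set.Ioo (t - ε) (t + ε))
      (fun s => (X.chartAt p).φ (γ s))

/-- Geodesic completeness: every (nontrivial) geodesic defined on an open interval
extends to a geodesic defined on all of `ℝ`. -/
def GeodesicallyComplete (X : PRManifold n) : Prop :=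
  ∀ (a b : ℝ) (γ : ℝ → X.M), (Set.Ioo a b).Nonempty → X.IsGeodesic (Set.Ioo a b) γ →
    ∃ γ' : ℝ → X.M, X.IsGeodesic Set.univ γ' ∧ ∀ t ∈ Set.Ioo a b, γ' t = γ t

end PRManifold

/-- First block of coordinates of a product. -/
def split1 {n₁ n₂ : ℕ} (x : Fin (n₁ + n₂) → ℝ) : Fin n₁ → ℝ := fun i => x (Fin.castAdd n₂ i)

/-- Second block of coordinates of a product. -/
def split2 {n₁ n₂ : ℕ} (x : Fin (n₁ + n₂) → ℝ) : Fin n₂ → ℝ := fun j => x (Fin.natAdd n₁ j)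

/-- The direct-product (block diagonal) metric `g₁ ⊕ g₂` in coordinates. -/
def prodMetricMat {n₁ n₂ : ℕ} (G₁ : MetricMat n₁) (G₂ : MetricMat n₂) :
    MetricMat (n₁ + n₂) := fun x =>
  (Matrix.fromBlocks (G₁ (split1 x)) 0 0 (G₂ (split2 x))).submatrix
    finSumFinEquiv.symm finSumFinEquiv.symm

/-- The (generalized Cahen–Wallach / plane-wave) metric
`g = -2du(dv + P_{ij}(u)xⁱxʲ du) + δ_{ij} dxⁱ dxʲ` on `ℝ^{e+2}`,
with coordinates `x 0 = u`, `x 1 = v` and spatial coordinates `x i.succ.succ`. -/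
def cwMetric (e : ℕ) (P : ℝ → Matrix (Fin e) (Fin e) ℝ) : MetricMat (e + 2) := fun x k l =>
  (if k = 0 ∧ l = 0 then (-2) * ∑ i, ∑ j, P (x 0) i j * x i.succ.succ * x j.succ.succ else 0)
  + (if (k = 0 ∧ l = 1) ∨ (k = 1 ∧ l = 0) then -1 else 0)
  + (if k = l ∧ 2 ≤ (k : ℕ) then 1 else 0)

/-- The Brinkmann metric `ds² = -2du(dv + H du + Wᵢ dxⁱ) + g_{ij} dxⁱ dxʲ` on `ℝ^{d+2}`,
with coordinates `x 0 = u`, `x 1 = v` and spatial coordinates `x i.succ.succ`. -/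
def brinkmannMat (d : ℕ) (H : (Fin (d + 2) → ℝ) → ℝ) (W : Fin d → (Fin (d + 2) → ℝ) → ℝ)
    (gs : (Fin (d + 2) → ℝ) → Matrix (Fin d) (Fin d) ℝ) : MetricMat (d + 2) := fun x k l =>
  (if k = 0 ∧ l = 0 then (-2) * H x else 0)
  + (if (k = 0 ∧ l = 1) ∨ (k = 1 ∧ l = 0) then -1 else 0)
  + (if k = 0 then ∑ i : Fin d, if l = i.succ.succ then -(W i x) else 0 else 0)
  + (if l = 0 then ∑ i : Fin d, if k = i.succ.succ then -(W i x) else 0 else 0)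
  + ∑ i : Fin d, ∑ j : Fin d, if k = i.succ.succ ∧ l = j.succ.succ then gs x i j else 0

/-- A function on `ℝ^{d+2}` is independent of the coordinate `v = x 1`. -/
def vIndep {d : ℕ} {α : Type*} (f : (Fin (d + 2) → ℝ) → α) : Prop :=
  ∀ x t, f (Function.update x (1 : Fin (d + 2)) t) = f x

/-- The point of `ℝ^{d+2}` with `u`, `v` and spatial coordinates `u`, `v`, `y`. -/
def emb (d : ℕ) (u v : ℝ) (y : Fin d → ℝ) : Fin (d + 2) → ℝ :=
  Fin.cons u (Fin.cons v y)
-- extension layer (appended to core for testing)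
namespace PRManifold

variable {n : ℕ}

/-- A self-map of `Y` is a (global) isometry: it is a homeomorphism and, read in the
charts, it pulls the metric back to the metric. -/
def IsAutoIsometry (Y : PRManifold n) (σ : Y.M → Y.M) : Prop :=
  Function.Bijective σ ∧ Continuous σ ∧
    ∀ q : Y.M, ∃ S, IsOpen S ∧ (Y.chartAt q).φ q ∈ S ∧ S ⊆ (Y.chartAt q).ran ∧
      (∀ x ∈ S, σ ((Y.chartAt q).ψ x) ∈ (Y.chartAt (σ q)).dom) ∧
      IsPullbackIsometry (Y.chartAt q).g (Y.chartAt (σ q)).g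
        (fun x => (Y.chartAt (σ q)).φ (σ ((Y.chartAt q).ψ x))) S

/-- `Y` is a (globally) symmetric space: the geodesic symmetry at every point extends to
a global isometry, i.e. every point is an isolated fixed point of a global isometry whose
differential there is `-id` (in chart coordinates). -/
def IsSymmetricSpace (Y : PRManifold n) : Prop :=
  ∀ q : Y.M, ∃ σ : Y.M → Y.M, Y.IsAutoIsometry σ ∧ σ q = q ∧
    ∀ a i : Fin n,
      pd i (fun x => (Y.chartAt (σ q)).φ (σ ((Y.chartAt q).ψ x)) a) ((Y.chartAt q).φ q)
        = -(if i = a then 1 else 0)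

/-- The metric of `X` is real-analytic: around every point there are coordinates in which
the metric components are real-analytic functions. -/
def AnalyticMetric (X : PRManifold n) : Prop :=
  ∀ p : X.M, ∃ S, IsOpen S ∧ (X.chartAt p).φ p ∈ S ∧ S ⊆ (X.chartAt p).ran ∧
    ∃ (τ : (Fin n → ℝ) → Fin n → ℝ) (G : MetricMat n),
      Set.InjOn τ S ∧ (∀ a b : Fin n, AnalyticOnNhd ℝ (fun y => G y a b) (τ '' S)) ∧
      IsPullbackIsometry (X.chartAt p).g G τ S

end PRManifold

/-- `Z` is globally isometric to the direct product `X × Y` (with the product metric):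
there is a bijection which, read in charts, is an isometry onto the product. -/
def GloballyIsometricToProd {n₀ n₁ n₂ : ℕ} (Z : PRManifold n₀)
    (X : PRManifold n₁) (Y : PRManifold n₂) : Prop :=
  ∃ F : Z.M → X.M × Y.M, Function.Bijective F ∧
    ∀ p : Z.M, ∃ S, IsOpen S ∧ (Z.chartAt p).φ p ∈ S ∧ S ⊆ (Z.chartAt p).ran ∧
      (∀ x ∈ S, (F ((Z.chartAt p).ψ x)).1 ∈ (X.chartAt (F p).1).dom
        ∧ (F ((Z.chartAt p).ψ x)).2 ∈ (Y.chartAt (F p).2).dom) ∧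
      IsPullbackIsometry (Z.chartAt p).g
        (prodMetricMat (X.chartAt (F p).1).g (Y.chartAt (F p).2).g)
        (fun x => Fin.append ((X.chartAt (F p).1).φ (F ((Z.chartAt p).ψ x)).1)
          ((Y.chartAt (F p).2).φ (F ((Z.chartAt p).ψ x)).2)) S

/-- `X` is globally isometric to the direct product of the coordinate spacetime
`(ℝ^{e+2}, Gcw)` and `Y` (with the product metric). -/
def GloballyIsometricToCWProd {n e m : ℕ} (X : PRManifold n) (Gcw : MetricMat (e + 2))
    (Y : PRManifold m) : Prop :=
  ∃ F : X.M → (Fin (e + 2) → ℝ) × Y.M, Function.Bijective F ∧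
    ∀ p : X.M, ∃ S, IsOpen S ∧ (X.chartAt p).φ p ∈ S ∧ S ⊆ (X.chartAt p).ran ∧
      (∀ x ∈ S, (F ((X.chartAt p).ψ x)).2 ∈ (Y.chartAt (F p).2).dom) ∧
      IsPullbackIsometry (X.chartAt p).g (prodMetricMat Gcw (Y.chartAt (F p).2).g)
        (fun x => Fin.append (F ((X.chartAt p).ψ x)).1
          ((Y.chartAt (F p).2).φ (F ((X.chartAt p).ψ x)).2)) S

/-- `X` is locally isometric to the direct product of the coordinate spacetime
`(ℝ^{e+2}, Gcw)` and `Y`: every point has a neighbourhood that maps isometrically into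
the product. -/
def LocallyIsometricToCWProd {n e m : ℕ} (X : PRManifold n) (Gcw : MetricMat (e + 2))
    (Y : PRManifold m) : Prop :=
  ∀ p : X.M, ∃ q : Y.M, ∃ S, IsOpen S ∧ (X.chartAt p).φ p ∈ S ∧ S ⊆ (X.chartAt p).ran ∧
    ∃ τ : (Fin n → ℝ) → Fin ((e + 2) + m) → ℝ,
      (∀ x ∈ S, split2 (n₁ := e + 2) (τ x) ∈ (Y.chartAt q).ran) ∧
      IsPullbackIsometry (X.chartAt p).g (prodMetricMat Gcw (Y.chartAt q).g) τ S

/-- An identification of `Σ i, Fin (m i)` with `Fin (∑ i, m i)`. -/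
def sigmaFinEquiv {k : ℕ} (m : Fin k → ℕ) : (Σ i : Fin k, Fin (m i)) ≃ Fin (∑ i, m i) :=
  (Fintype.equivFin _).trans (finCongr (by simp))

/-- The `i`-th block of coordinates in `ℝ^{∑ mdim}`. -/
def sigCoord {k : ℕ} {mdim : Fin k → ℕ} (x : Fin (∑ i, mdim i) → ℝ) (i : Fin k) :
    Fin (mdim i) → ℝ := fun a => x (sigmaFinEquiv mdim ⟨i, a⟩)

/-- The block-diagonal metric of a finite direct product, in coordinates. -/
def multiBlockMetric {k : ℕ} {mdim : Fin k → ℕ}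
    (G : (i : Fin k) → MetricMat (mdim i)) : MetricMat (∑ i, mdim i) := fun x a b =>
  let sa := (sigmaFinEquiv mdim).symm a
  let sb := (sigmaFinEquiv mdim).symm b
  if h : sa.1 = sb.1 then G sb.1 (sigCoord x sb.1) (h ▸ sa.2) sb.2 else 0

/-- `X` is globally isometric to the direct product of the coordinate spacetime
`(ℝ^d, Gcw)` with the finite family of manifolds `Y i` (with the product metric). -/
def GloballyIsometricToCWMultiProd {n d k : ℕ} {mdim : Fin k → ℕ}
    (X : PRManifold n) (Gcw : MetricMat d)
    (Y : (i : Fin k) → PRManifold (mdim i)) : Prop :=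
  ∃ F : X.M → (Fin d → ℝ) × ((i : Fin k) → (Y i).M), Function.Bijective F ∧
    ∀ p : X.M, ∃ S, IsOpen S ∧ (X.chartAt p).φ p ∈ S ∧ S ⊆ (X.chartAt p).ran ∧
      (∀ x ∈ S, ∀ i, (F ((X.chartAt p).ψ x)).2 i ∈ ((Y i).chartAt ((F p).2 i)).dom) ∧
      IsPullbackIsometry (X.chartAt p).g
        (prodMetricMat Gcw (multiBlockMetric fun i => ((Y i).chartAt ((F p).2 i)).g))
        (fun x => Fin.append (F ((X.chartAt p).ψ x)).1
          (fun j => let s := (sigmaFinEquiv mdim).symm j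
            ((Y s.1).chartAt ((F p).2 s.1)).φ ((F ((X.chartAt p).ψ x)).2 s.1) s.2)) S

/-- `X` is locally isometric to the direct product of the coordinate spacetime
`(ℝ^d, Gcw)` with the finite family of manifolds `Y i`. -/
def LocallyIsometricToCWMultiProd {n d k : ℕ} {mdim : Fin k → ℕ}
    (X : PRManifold n) (Gcw : MetricMat d)
    (Y : (i : Fin k) → PRManifold (mdim i)) : Prop :=
  ∀ p : X.M, ∃ q : (i : Fin k) → (Y i).M, ∃ S, IsOpen S ∧ (X.chartAt p).φ p ∈ S ∧
    S ⊆ (X.chartAt p).ran ∧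
    ∃ τ : (Fin n → ℝ) → Fin (d + ∑ i, mdim i) → ℝ,
      (∀ x ∈ S, ∀ i : Fin k,
        sigCoord (split2 (n₁ := d) (τ x)) i ∈ ((Y i).chartAt (q i)).ran) ∧
      IsPullbackIsometry (X.chartAt p).g
        (prodMetricMat Gcw (multiBlockMetric fun i => ((Y i).chartAt (q i)).g)) τ S

/-- `X'` (with projection `π`) is a universal covering of `X`, with the pulled-back
metric: `π` is a topological covering map, `X'` is simply connected and `π` is a local
isometry. -/
def IsUniversalCoverOf {n : ℕ} (X' X : PRManifold n) (π : X'.M → X.M) : Prop :=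
  IsCoveringMap π ∧ X'.SimplyConn ∧
    ∀ p : X'.M, ∃ S, IsOpen S ∧ (X'.chartAt p).φ p ∈ S ∧ S ⊆ (X'.chartAt p).ran ∧
      (∀ x ∈ S, π ((X'.chartAt p).ψ x) ∈ (X.chartAt (π p)).dom) ∧
      IsPullbackIsometry (X'.chartAt p).g (X.chartAt (π p)).g
        (fun x => (X.chartAt (π p)).φ (π ((X'.chartAt p).ψ x))) S

namespace SecondOrderSymmetric

section

variable {n s : ℕ}

/-- The multilinear form with components `t`. -/
def ev (t : (Fin s → Fin n) → ℝ) : MultilinearMap ℝ (fun _ : Fin s => Fin n → ℝ) ℝ :=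
  ∑ idx, t idx • (MultilinearMap.mkPiAlgebra ℝ (Fin s) ℝ).compLinearMap
    (fun a => LinearMap.proj (idx a))

theorem ev_apply (t : (Fin s → Fin n) → ℝ) (v : Fin s → Fin n → ℝ) :
    ev t v = ∑ idx, t idx * ∏ a, v a (idx a) := by
  simp [ev]

theorem ev_single (t : (Fin s → Fin n) → ℝ) (idx : Fin s → Fin n) :
    ev t (fun a => Pi.single (idx a) 1) = t idx := by
  rw [ev_apply, Finset.sum_eq_single idx]
  · simp
  · intro b _ hb
    obtain ⟨a, ha⟩ := Function.ne_iff.mp hb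
    rw [Finset.prod_eq_zero (Finset.mem_univ a), mul_zero]
    simp [ha]
  · simp

/-- Componentwise directional derivative of a tensor field. -/
def dT (T : TensorField n s) (x e : Fin n → ℝ) : (Fin s → Fin n) → ℝ :=
  fun idx => fderiv ℝ (fun y => T y idx) x e

theorem prod_update_eq (v : Fin s → Fin n → ℝ) (a : Fin s) (w : Fin n → ℝ) (idx : Fin s → Fin n) :
    ∏ b, Function.update v a w b (idx b) = w (idx a) * ∏ b ∈ Finset.univ.erase a, v b (idx b) := by
  rw [← Finset.mul_prod_erase _ _ (Finset.mem_univ a)]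
  congr 1
  · simp
  · refine Finset.prod_congr rfl fun b hb => ?_
    rw [Function.update_of_ne (Finset.ne_of_mem_erase hb)]

theorem hasDerivAt_ev {T : TensorField n s} {c : ℝ → Fin n → ℝ} {c' : Fin n → ℝ}
    {v : Fin s → ℝ → Fin n → ℝ} {v' : Fin s → Fin n → ℝ} {t : ℝ}
    (hT : ∀ idx, DifferentiableAt ℝ (fun y => T y idx) (c t))
    (hc : HasDerivAt c c' t) (hv : ∀ a, HasDerivAt (v a) (v' a) t) :
    HasDerivAt (fun τ => ev (T (c τ)) (fun a => v a τ))
      (ev (dT T (c t) c') (fun a => v a t)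
        + ∑ a, ev (T (c t)) (Function.update (fun b => v b t) a (v' a))) t := by
  have key : ∀ idx : Fin s → Fin n, HasDerivAt (fun τ => T (c τ) idx * ∏ a, v a τ (idx a))
      (dT T (c t) c' idx * ∏ a, v a t (idx a)
        + T (c t) idx * ∑ a, (∏ b ∈ Finset.univ.erase a, v b t (idx b)) • v' a (idx a)) t := by
    intro idx
    have h1 := (hT idx).hasFDerivAt.comp_hasDerivAt t hc
    have h2 := HasDerivAt.fun_finsetProd (u := Finset.univ)
      (f := fun a τ => v a τ (idx a)) (f' := fun a => v' a (idx a)) (x := t)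
      (fun a _ => (hasDerivAt_pi.mp (hv a)) (idx a))
    exact h1.mul h2
  have := HasDerivAt.fun_sum (u := Finset.univ) (fun idx _ => key idx)
  simp only [ev_apply]
  refine this.congr_deriv ?_
  rw [Finset.sum_comm, ← Finset.sum_add_distrib]
  refine Finset.sum_congr rfl fun idx _ => ?_
  simp only [prod_update_eq, Finset.mul_sum, smul_eq_mul]
  congr 1
  exact Finset.sum_congr rfl fun a _ => by ring

/-- The Christoffel symbols as a vector-valued bilinear map. -/
def Gm (g : MetricMat n) (x : Fin n → ℝ) : (Fin n → ℝ) →L[ℝ] (Fin n → ℝ) →L[ℝ] (Fin n → ℝ) :=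
  ∑ i, ∑ j, ∑ k, christoffel g x k i j •
    (ContinuousLinearMap.proj (R := ℝ) (φ := fun _ : Fin n => ℝ) i).smulRight
      ((ContinuousLinearMap.proj (R := ℝ) (φ := fun _ : Fin n => ℝ) j).smulRight
        (Pi.single k (1 : ℝ) : Fin n → ℝ))

theorem Gm_apply (g : MetricMat n) (x u v : Fin n → ℝ) (k : Fin n) :
    Gm g x u v k = ∑ i, ∑ j, christoffel g x k i j * (u i * v j) := by
  simp only [Gm, _root_.sum_apply, Finset.sum_apply]
  refine Finset.sum_congr rfl fun i _ => Finset.sum_congr rfl fun j _ => ?_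
  rw [Finset.sum_eq_single k]
  · simp
  · intro b _ hb; simp [hb.symm]
  · simp

theorem sum_ev_update (T : (Fin s → Fin n) → ℝ) (M : Fin n → Fin n → ℝ) (v : Fin s → Fin n → ℝ)
    (a : Fin s) :
    ∑ idx : Fin s → Fin n, (∑ k, M k (idx a) * T (Function.update idx a k)) * ∏ b, v b (idx b)
      = ev T (Function.update v a (fun k => ∑ j, M k j * v a j)) := by
  rw [ev_apply]
  simp only [prod_update_eq, Finset.sum_mul, Finset.mul_sum]
  rw [← Fintype.sum_prod_type', ← Fintype.sum_prod_type']
  let σ : ((Fin s → Fin n) × Fin n) ≃ ((Fin s → Fin n) × Fin n) :=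
    { toFun := fun p => (Function.update p.1 a p.2, p.1 a)
      invFun := fun p => (Function.update p.1 a p.2, p.1 a)
      left_inv := fun p => by simp
      right_inv := fun p => by simp }
  refine Fintype.sum_equiv σ _ _ fun p => ?_
  obtain ⟨idx, k⟩ := p
  simp only [σ, Equiv.coe_fn_mk, Function.update_self]
  rw [← Finset.mul_prod_erase _ _ (Finset.mem_univ a)]
  have : ∏ b ∈ Finset.univ.erase a, v b (Function.update idx a k b)
      = ∏ b ∈ Finset.univ.erase a, v b (idx b) :=
    Finset.prod_congr rfl fun b hb => by
      rw [Function.update_of_ne (Finset.ne_of_mem_erase hb)]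
  rw [this]
  ring

theorem fderiv_apply_eq_sum (f : (Fin n → ℝ) → ℝ) (x e : Fin n → ℝ) :
    fderiv ℝ f x e = ∑ i, e i * pd i f x := by
  conv_lhs => rw [pi_eq_sum_univ' e]
  simp [pd, map_sum]

theorem ev_covDeriv (g : MetricMat n) (T : TensorField n s) (x e : Fin n → ℝ)
    (v : Fin s → Fin n → ℝ) :
    ev (covDeriv g T x) (Fin.cons e v)
      = ev (dT T x e) v - ∑ a, ev (T x) (Function.update v a (Gm g x e (v a))) := by
  have hG : ∀ a, Gm g x e (v a) = fun k => ∑ j, (∑ i, christoffel g x k i j * e i) * v a j := by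
    intro a
    ext k
    rw [Gm_apply, Finset.sum_comm]
    simp only [Finset.sum_mul, mul_assoc]
  simp only [hG]
  simp only [← sum_ev_update]
  rw [ev_apply, ev_apply, ← (Fin.consEquiv (fun _ : Fin (s+1) => Fin n)).sum_comp,
    Fintype.sum_prod_type, Finset.sum_comm]
  rw [Finset.sum_comm (s := (Finset.univ : Finset (Fin s))), ← Finset.sum_sub_distrib]
  refine Finset.sum_congr rfl fun idx _ => ?_
  simp only [Fin.consEquiv, Equiv.coe_fn_mk, Fin.prod_univ_succ, Fin.cons_zero, Fin.cons_succ,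
    covDeriv, dT]
  rw [fderiv_apply_eq_sum, ← Finset.sum_mul, ← sub_mul]
  have h2 : ∀ P : ℝ, ∀ F : Fin n → ℝ, ∑ i, F i * (e i * P) = (∑ i, e i * F i) * P := by
    intro P F
    rw [Finset.sum_mul]
    exact Finset.sum_congr rfl fun i _ => by ring
  rw [h2]
  congr 1
  simp only [mul_sub, Finset.sum_sub_distrib]
  congr 1
  simp only [Finset.mul_sum, Finset.sum_mul]
  rw [Finset.sum_comm]
  refine Finset.sum_congr rfl fun a _ => ?_
  rw [Finset.sum_comm]
  refine Finset.sum_congr rfl fun k _ => Finset.sum_congr rfl fun i _ => ?_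
  ring

end

section

variable {n s : ℕ}

/-- A smooth nondegenerate coordinate metric on an open set. -/
structure IsMetricOn (g : MetricMat n) (U : Set (Fin n → ℝ)) : Prop where
  isOpen : IsOpen U
  smooth : ∀ a b : Fin n, ContDiffOn ℝ (⊤ : ℕ∞) (fun x => g x a b) U
  symm : ∀ x ∈ U, (g x).IsSymm
  nondeg : ∀ x ∈ U, IsUnit (g x).det

theorem contDiffOn_pd {f : (Fin n → ℝ) → ℝ} {U : Set (Fin n → ℝ)} (hU : IsOpen U)
    (hf : ContDiffOn ℝ (⊤ : ℕ∞) f U) (i : Fin n) : ContDiffOn ℝ (⊤ : ℕ∞) (pd i f) U :=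
  (hf.fderiv_of_isOpen (m := (⊤ : ℕ∞)) hU (by simp)).clm_apply contDiffOn_const

theorem contDiffOn_det {k : ℕ} {A : (Fin n → ℝ) → Matrix (Fin k) (Fin k) ℝ} {U : Set (Fin n → ℝ)}
    (hA : ∀ a b, ContDiffOn ℝ (⊤ : ℕ∞) (fun x => A x a b) U) :
    ContDiffOn ℝ (⊤ : ℕ∞) (fun x => (A x).det) U := by
  simp only [Matrix.det_apply]
  exact ContDiffOn.sum fun σ _ => (contDiffOn_prod fun i _ => hA _ _).const_smul _

theorem IsMetricOn.contDiffOn_inv {g : MetricMat n} {U : Set (Fin n → ℝ)} (hg : IsMetricOn g U)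
    (a b : Fin n) : ContDiffOn ℝ (⊤ : ℕ∞) (fun x => (g x)⁻¹ a b) U := by
  simp only [Matrix.inv_def, Matrix.smul_apply, Ring.inverse_eq_inv', smul_eq_mul,
    Matrix.adjugate_apply]
  refine (ContDiffOn.inv (contDiffOn_det hg.smooth) fun x hx => (hg.nondeg x hx).ne_zero).mul
    (contDiffOn_det fun c e => ?_)
  simp only [Matrix.updateRow_apply]
  split_ifs
  · exact contDiffOn_const
  · exact hg.smooth _ _

theorem IsMetricOn.contDiffOn_christoffel {g : MetricMat n} {U : Set (Fin n → ℝ)}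
    (hg : IsMetricOn g U) (k i j : Fin n) :
    ContDiffOn ℝ (⊤ : ℕ∞) (fun x => christoffel g x k i j) U := by
  unfold christoffel
  refine contDiffOn_const.mul (ContDiffOn.sum fun l _ => (hg.contDiffOn_inv _ _).mul ?_)
  exact ((contDiffOn_pd hg.isOpen (hg.smooth _ _) _).add
    (contDiffOn_pd hg.isOpen (hg.smooth _ _) _)).sub (contDiffOn_pd hg.isOpen (hg.smooth _ _) _)

theorem IsMetricOn.contDiffOn_Gm {g : MetricMat n} {U : Set (Fin n → ℝ)}
    (hg : IsMetricOn g U) : ContDiffOn ℝ (⊤ : ℕ∞) (Gm g) U := by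
  unfold Gm
  exact ContDiffOn.sum fun i _ => ContDiffOn.sum fun j _ => ContDiffOn.sum fun k _ =>
    ((ContinuousLinearMap.id ℝ ℝ).smulRight _).contDiff.comp_contDiffOn
      (hg.contDiffOn_christoffel k i j)

/-- Smoothness of the components of a tensor field. -/
def SmoothTF (T : TensorField n s) (U : Set (Fin n → ℝ)) : Prop :=
  ∀ idx, ContDiffOn ℝ (⊤ : ℕ∞) (fun x => T x idx) U

theorem IsMetricOn.smoothTF_riemann {g : MetricMat n} {U : Set (Fin n → ℝ)}
    (hg : IsMetricOn g U) : SmoothTF (riemann g) U := by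
  intro idx
  unfold riemann curvUp
  refine ContDiffOn.sum fun m _ => (hg.smooth _ _).mul ?_
  have h := hg.contDiffOn_christoffel
  exact (((contDiffOn_pd hg.isOpen (h _ _ _) _).sub (contDiffOn_pd hg.isOpen (h _ _ _) _)).add
    (ContDiffOn.sum fun l _ => (h _ _ _).mul (h _ _ _))).sub
    (ContDiffOn.sum fun l _ => (h _ _ _).mul (h _ _ _))

theorem IsMetricOn.smoothTF_covDeriv {g : MetricMat n} {U : Set (Fin n → ℝ)}
    (hg : IsMetricOn g U) {T : TensorField n s} (hT : SmoothTF T U) :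
    SmoothTF (covDeriv g T) U := by
  intro idx
  unfold covDeriv
  exact (contDiffOn_pd hg.isOpen (hT _) _).sub (ContDiffOn.sum fun a _ => ContDiffOn.sum fun e _ =>
    (hg.contDiffOn_christoffel _ _ _).mul (hT _))

theorem SmoothTF.differentiableAt {T : TensorField n s} {U : Set (Fin n → ℝ)} (hT : SmoothTF T U)
    (hU : IsOpen U) {x : Fin n → ℝ} (hx : x ∈ U) (idx : Fin s → Fin n) :
    DifferentiableAt ℝ (fun y => T y idx) x :=
  ((hT idx).contDiffAt (hU.mem_nhds hx)).differentiableAt (by simp)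

/-- The metric as a tensor field. -/
def gT (g : MetricMat n) : TensorField n 2 := fun x idx => g x (idx 0) (idx 1)

theorem IsMetricOn.smoothTF_gT {g : MetricMat n} {U : Set (Fin n → ℝ)}
    (hg : IsMetricOn g U) : SmoothTF (gT g) U := fun _ => hg.smooth _ _

/-- The metric as a bilinear form. -/
def gB (g : MetricMat n) (x : Fin n → ℝ) : (Fin n → ℝ) →ₗ[ℝ] (Fin n → ℝ) →ₗ[ℝ] ℝ :=
  Matrix.toLinearMap₂' ℝ (g x)

theorem gB_apply (g : MetricMat n) (x u v : Fin n → ℝ) :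
    gB g x u v = ∑ i, ∑ j, g x i j * (u i * v j) := by
  simp only [gB, Matrix.toLinearMap₂'_apply, smul_eq_mul]
  exact Finset.sum_congr rfl fun i _ => Finset.sum_congr rfl fun j _ => by ring

theorem gB_single (g : MetricMat n) (x : Fin n → ℝ) (i j : Fin n) :
    gB g x (Pi.single i 1) (Pi.single j 1) = g x i j := by
  rw [gB_apply, Finset.sum_eq_single i, Finset.sum_eq_single j]
  · simp
  · intro b _ hb; simp [hb]
  · simp
  · intro b _ hb; simp [hb]
  · simp

theorem sum_fin_two_fun {M : Type*} [AddCommMonoid M] (f : (Fin 2 → Fin n) → M) :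
    ∑ idx, f idx = ∑ i, ∑ j, f ![i, j] := by
  rw [← (finTwoArrowEquiv (Fin n)).symm.sum_comp, Fintype.sum_prod_type]
  rfl

theorem ev_gT (g : MetricMat n) (x : Fin n → ℝ) (v : Fin 2 → Fin n → ℝ) :
    ev (gT g x) v = gB g x (v 0) (v 1) := by
  rw [ev_apply, sum_fin_two_fun, gB_apply]
  simp [gT, Fin.prod_univ_two]

theorem gB_symm {g : MetricMat n} {x : Fin n → ℝ} (h : (g x).IsSymm) (u v : Fin n → ℝ) :
    gB g x u v = gB g x v u := by
  rw [gB_apply, gB_apply, Finset.sum_comm]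
  refine Finset.sum_congr rfl fun i _ => Finset.sum_congr rfl fun j _ => ?_
  rw [h.apply]; ring

theorem gB_nondeg {g : MetricMat n} {x : Fin n → ℝ} (h : IsUnit (g x).det) {v : Fin n → ℝ}
    (hv : ∀ w, gB g x w v = 0) : v = 0 := by
  have : g x *ᵥ v = 0 := by
    ext i
    have := hv (Pi.single i 1)
    rw [gB_apply, Finset.sum_eq_single i] at this
    · simpa [Matrix.mulVec, dotProduct] using this
    · intro b _ hb; simp [hb]
    · simp
  have h2 := congrArg (fun w => (g x)⁻¹ *ᵥ w) this
  simpa [Matrix.mulVec_mulVec, Matrix.nonsing_inv_mul _ h] using h2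

theorem Gm_single (g : MetricMat n) (x : Fin n → ℝ) (i j k : Fin n) :
    Gm g x (Pi.single i 1) (Pi.single j 1) k = christoffel g x k i j := by
  rw [Gm_apply, Finset.sum_eq_single i, Finset.sum_eq_single j]
  · simp
  · intro b _ hb; simp [hb]
  · simp
  · intro b _ hb; simp [hb]
  · simp

theorem christoffel_symm {g : MetricMat n} {U : Set (Fin n → ℝ)} (hg : IsMetricOn g U)
    {x : Fin n → ℝ} (hx : x ∈ U) (k i j : Fin n) :
    christoffel g x k i j = christoffel g x k j i := by
  have h : ∀ l a b, pd l (fun y => g y a b) x = pd l (fun y => g y b a) x := by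
    intro l a b
    unfold pd
    rw [Filter.EventuallyEq.fderiv_eq]
    filter_upwards [hg.isOpen.mem_nhds hx] with y hy
    exact ((hg.symm y hy).apply a b).symm
  unfold christoffel
  congr 1
  refine Finset.sum_congr rfl fun l _ => ?_
  rw [h l i j]
  ring

theorem Gm_symm {g : MetricMat n} {U : Set (Fin n → ℝ)} (hg : IsMetricOn g U)
    {x : Fin n → ℝ} (hx : x ∈ U) (u v : Fin n → ℝ) : Gm g x u v = Gm g x v u := by
  ext k
  rw [Gm_apply, Gm_apply, Finset.sum_comm]
  refine Finset.sum_congr rfl fun i _ => Finset.sum_congr rfl fun j _ => ?_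
  rw [christoffel_symm hg hx]; ring

/-- Directional derivative of the metric. -/
def dg (g : MetricMat n) (x e u v : Fin n → ℝ) : ℝ := ev (dT (gT g) x e) ![u, v]

theorem dg_apply (g : MetricMat n) (x e u v : Fin n → ℝ) :
    dg g x e u v = ∑ i, ∑ j, ∑ k, pd i (fun y => g y j k) x * (e i * (u j * v k)) := by
  rw [dg, ev_apply, sum_fin_two_fun]
  simp only [dT, gT, fderiv_apply_eq_sum, Fin.prod_univ_two, Finset.sum_mul]
  rw [Finset.sum_comm]
  rw [Finset.sum_comm]
  conv_rhs => rw [Finset.sum_comm]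
  refine Finset.sum_congr rfl fun j _ => ?_
  rw [Finset.sum_comm]
  refine Finset.sum_congr rfl fun k _ => ?_
  refine Finset.sum_congr rfl fun i _ => ?_
  simp; ring

theorem koszul {g : MetricMat n} {U : Set (Fin n → ℝ)} (hg : IsMetricOn g U)
    {x : Fin n → ℝ} (hx : x ∈ U) (u v w : Fin n → ℝ) :
    gB g x w (Gm g x u v) = (1 / 2) * (dg g x u w v + dg g x v w u - dg g x w u v) := by
  have h : ∀ l i j, ∑ k, g x l k * christoffel g x k i j = (1 / 2) *
      (pd i (fun y => g y l j) x + pd j (fun y => g y l i) x - pd l (fun y => g y i j) x) := by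
    intro l i j
    simp only [christoffel, Finset.mul_sum]
    rw [Finset.sum_comm]
    have h1 : ∀ m, ∑ k, g x l k * ((g x)⁻¹ k m) = if l = m then 1 else 0 := by
      intro m
      have := congrFun (congrFun (Matrix.mul_nonsing_inv _ (hg.nondeg x hx)) l) m
      rwa [Matrix.mul_apply, Matrix.one_apply] at this
    have h2 : ∀ m : Fin n, ∀ B : ℝ, ∑ k, g x l k * (1 / 2 * ((g x)⁻¹ k m * B))
        = (if l = m then 1 else 0) * (1 / 2 * B) := by
      intro m B
      rw [← h1, Finset.sum_mul]
      exact Finset.sum_congr rfl fun k _ => by ring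
    simp only [h2]
    simp
  have h3 : gB g x w (Gm g x u v)
      = ∑ l, ∑ i, ∑ j, (∑ k, g x l k * christoffel g x k i j) * (w l * (u i * v j)) := by
    rw [gB_apply]
    refine Finset.sum_congr rfl fun l _ => ?_
    simp only [Gm_apply, Finset.mul_sum, Finset.sum_mul]
    rw [Finset.sum_comm]
    refine Finset.sum_congr rfl fun i _ => ?_
    rw [Finset.sum_comm]
    refine Finset.sum_congr rfl fun j _ => ?_
    refine Finset.sum_congr rfl fun k _ => ?_
    ring
  rw [h3]
  simp only [h]
  rw [dg_apply, dg_apply, dg_apply]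
  have e1 : ∑ i, ∑ j, ∑ k, pd i (fun y => g y j k) x * (u i * (w j * v k))
      = ∑ l, ∑ i, ∑ j, pd i (fun y => g y l j) x * (u i * (w l * v j)) := Finset.sum_comm
  have e2 : ∑ i, ∑ j, ∑ k, pd i (fun y => g y j k) x * (v i * (w j * u k))
      = ∑ l, ∑ i, ∑ j, pd j (fun y => g y l i) x * (v j * (w l * u i)) := by
    rw [Finset.sum_comm]
    exact Finset.sum_congr rfl fun i _ => Finset.sum_comm
  rw [e1, e2]
  simp only [← Finset.sum_add_distrib, ← Finset.sum_sub_distrib, Finset.mul_sum]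
  refine Finset.sum_congr rfl fun l _ => Finset.sum_congr rfl fun i _ =>
    Finset.sum_congr rfl fun j _ => ?_
  ring

theorem dg_symm {g : MetricMat n} {U : Set (Fin n → ℝ)} (hg : IsMetricOn g U)
    {x : Fin n → ℝ} (hx : x ∈ U) (e u v : Fin n → ℝ) : dg g x e u v = dg g x e v u := by
  have h : ∀ l a b, pd l (fun y => g y a b) x = pd l (fun y => g y b a) x := by
    intro l a b
    unfold pd
    rw [Filter.EventuallyEq.fderiv_eq]
    filter_upwards [hg.isOpen.mem_nhds hx] with y hy
    exact ((hg.symm y hy).apply a b).symm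
  rw [dg_apply, dg_apply]
  refine Finset.sum_congr rfl fun i _ => ?_
  rw [Finset.sum_comm]
  refine Finset.sum_congr rfl fun j _ => Finset.sum_congr rfl fun k _ => ?_
  rw [h i k j]; ring

theorem dg_eq {g : MetricMat n} {U : Set (Fin n → ℝ)} (hg : IsMetricOn g U)
    {x : Fin n → ℝ} (hx : x ∈ U) (e u v : Fin n → ℝ) :
    dg g x e u v = gB g x (Gm g x e u) v + gB g x u (Gm g x e v) := by
  rw [gB_symm (hg.symm x hx) _ v, koszul hg hx, koszul hg hx, dg_symm hg hx e v u,
    dg_symm hg hx u v e, dg_symm hg hx v e u]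
  ring

theorem update_fin_two_zero {α : Type*} (a b c : α) : Function.update ![a, b] 0 c = ![c, b] := by
  ext i; fin_cases i <;> rfl

theorem update_fin_two_one {α : Type*} (a b c : α) : Function.update ![a, b] 1 c = ![a, c] := by
  ext i; fin_cases i <;> rfl

theorem covDeriv_gT {g : MetricMat n} {U : Set (Fin n → ℝ)} (hg : IsMetricOn g U)
    {x : Fin n → ℝ} (hx : x ∈ U) : ev (covDeriv g (gT g) x) = 0 := by
  refine MultilinearMap.ext fun v => ?_
  rw [← Fin.cons_self_tail v, ev_covDeriv, Fin.sum_univ_two]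
  have h : Fin.tail v = ![v 1, v 2] := by ext i; fin_cases i <;> rfl
  rw [h, update_fin_two_zero, update_fin_two_one, ev_gT, ev_gT, ← dg, dg_eq hg hx]
  simp

end

section

variable {n m s : ℕ}

theorem hasDerivAt_ev_update {T : TensorField n s} {c : ℝ → Fin n → ℝ} {c' : Fin n → ℝ}
    {v : Fin s → Fin n → ℝ} {i : Fin s} {W : ℝ → Fin n → ℝ} {W' : Fin n → ℝ} {t : ℝ}
    (hT : ∀ idx, DifferentiableAt ℝ (fun y => T y idx) (c t))
    (hc : HasDerivAt c c' t) (hW : HasDerivAt W W' t) :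
    HasDerivAt (fun τ => ev (T (c τ)) (Function.update v i (W τ)))
      (ev (dT T (c t) c') (Function.update v i (W t))
        + ev (T (c t)) (Function.update v i W')) t := by
  have := hasDerivAt_ev (v := fun a τ => Function.update v i (W τ) a)
    (v' := fun a => Function.update (0 : Fin s → Fin n → ℝ) i W' a) hT hc (fun a => by
      by_cases h : a = i
      · subst h; simpa using hW
      · simpa [Function.update_of_ne h] using hasDerivAt_const t (v a))
  refine this.congr_deriv ?_
  congr 1
  rw [Finset.sum_eq_single i]
  · simp
  · intro b _ hb
    refine (ev (T (c t))).map_coord_zero b ?_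
    simp [Function.update_of_ne hb]
  · simp

theorem hasDerivAt_ev_const {T : TensorField n s} {c : ℝ → Fin n → ℝ} {c' : Fin n → ℝ}
    {v : Fin s → Fin n → ℝ} {t : ℝ}
    (hT : ∀ idx, DifferentiableAt ℝ (fun y => T y idx) (c t))
    (hc : HasDerivAt c c' t) :
    HasDerivAt (fun τ => ev (T (c τ)) v) (ev (dT T (c t) c') v) t := by
  have := hasDerivAt_ev (v := fun a _ => v a) (v' := 0) hT hc (fun a => hasDerivAt_const t (v a))
  refine this.congr_deriv ?_
  rw [Finset.sum_eq_zero, add_zero]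
  intro a _
  exact (ev (T (c t))).map_update_zero _ a

theorem hasDerivAt_ev_transport {g : MetricMat n} {T : TensorField n s} {c : ℝ → Fin n → ℝ}
    {c' : Fin n → ℝ} {v : Fin s → ℝ → Fin n → ℝ} {t : ℝ}
    (hT : ∀ idx, DifferentiableAt ℝ (fun y => T y idx) (c t))
    (hc : HasDerivAt c c' t) (hv : ∀ a, HasDerivAt (v a) (-Gm g (c t) c' (v a t)) t) :
    HasDerivAt (fun τ => ev (T (c τ)) (fun a => v a τ))
      (ev (covDeriv g T (c t)) (Fin.cons c' fun a => v a t)) t := by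
  refine (hasDerivAt_ev hT hc hv).congr_deriv ?_
  rw [ev_covDeriv, sub_eq_add_neg, ← Finset.sum_neg_distrib]
  congr 1
  exact Finset.sum_congr rfl fun a _ => by rw [MultilinearMap.map_update_neg]

theorem hasDerivAt_line (x a : Fin n → ℝ) : HasDerivAt (fun t : ℝ => x + t • a) a 0 := by
  simpa using ((hasDerivAt_id (0 : ℝ)).smul_const a).const_add x

theorem hasDerivAt_comp_line {E : Type*} [NormedAddCommGroup E] [NormedSpace ℝ E]
    {f : (Fin n → ℝ) → E} {x : Fin n → ℝ} (hf : DifferentiableAt ℝ f x) (a : Fin n → ℝ) :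
    HasDerivAt (fun t : ℝ => f (x + t • a)) (fderiv ℝ f x a) 0 :=
  hf.hasFDerivAt.hasLineDerivAt a

/-- The curvature operator `R(a, b)`. -/
def Rm (g : MetricMat n) (x a b : Fin n → ℝ) : (Fin n → ℝ) →L[ℝ] (Fin n → ℝ) :=
  fderiv ℝ (Gm g) x a b - fderiv ℝ (Gm g) x b a
    + (Gm g x a).comp (Gm g x b) - (Gm g x b).comp (Gm g x a)

theorem Rm_apply (g : MetricMat n) (x a b c : Fin n → ℝ) :
    Rm g x a b c = fderiv ℝ (Gm g) x a b c - fderiv ℝ (Gm g) x b a c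
      + Gm g x a (Gm g x b c) - Gm g x b (Gm g x a c) := rfl

theorem Rm_antisymm (g : MetricMat n) (x a b : Fin n → ℝ) : Rm g x a b = -Rm g x b a := by
  simp only [Rm]; abel

theorem IsMetricOn.differentiableAt_Gm {g : MetricMat n} {U : Set (Fin n → ℝ)}
    (hg : IsMetricOn g U) {x : Fin n → ℝ} (hx : x ∈ U) : DifferentiableAt ℝ (Gm g) x :=
  ((hg.contDiffOn_Gm.contDiffAt (hg.isOpen.mem_nhds hx))).differentiableAt (by simp)

theorem fderiv_fderiv_symm {E : Type*} [NormedAddCommGroup E] [NormedSpace ℝ E]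
    {f : (Fin n → ℝ) → E} {U : Set (Fin n → ℝ)} (hU : IsOpen U)
    (hf : ContDiffOn ℝ (⊤ : ℕ∞) f U) {x : Fin n → ℝ} (hx : x ∈ U) (a b : Fin n → ℝ) :
    fderiv ℝ (fderiv ℝ f) x a b = fderiv ℝ (fderiv ℝ f) x b a := by
  have h : ContDiffAt ℝ (⊤ : ℕ∞) f x := hf.contDiffAt (hU.mem_nhds hx)
  exact (h.isSymmSndFDerivAt (by
    rw [minSmoothness_of_isRCLikeNormedField]; exact WithTop.coe_le_coe.2 (le_top : (2 : ℕ∞) ≤ ⊤))).eq a b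

theorem differentiableAt_fderiv {E : Type*} [NormedAddCommGroup E] [NormedSpace ℝ E]
    {f : (Fin n → ℝ) → E} {U : Set (Fin n → ℝ)} (hU : IsOpen U)
    (hf : ContDiffOn ℝ (⊤ : ℕ∞) f U) {x : Fin n → ℝ} (hx : x ∈ U) :
    DifferentiableAt ℝ (fderiv ℝ f) x :=
  ((hf.fderiv_of_isOpen (m := (⊤ : ℕ∞)) hU (by simp)).contDiffAt
    (hU.mem_nhds hx)).differentiableAt (by simp)

theorem SmoothTF.dT {T : TensorField n s} {U : Set (Fin n → ℝ)} (hU : IsOpen U)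
    (hT : SmoothTF T U) (b : Fin n → ℝ) : SmoothTF (fun y => dT T y b) U := fun idx =>
  ((hT idx).fderiv_of_isOpen (m := (⊤ : ℕ∞)) hU (by simp)).clm_apply contDiffOn_const

theorem dT_dT_symm {T : TensorField n s} {U : Set (Fin n → ℝ)} (hU : IsOpen U)
    (hT : SmoothTF T U) {x : Fin n → ℝ} (hx : x ∈ U) (a b : Fin n → ℝ) :
    dT (fun y => dT T y b) x a = dT (fun y => dT T y a) x b := by
  have key : ∀ idx, ∀ a b : Fin n → ℝ, fderiv ℝ (fun y => fderiv ℝ (fun y => T y idx) y b) x a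
      = fderiv ℝ (fderiv ℝ fun y => T y idx) x a b := by
    intro idx a b
    have h := (hasDerivAt_comp_line (differentiableAt_fderiv hU (hT idx) hx) a).clm_apply
      (hasDerivAt_const (0 : ℝ) b)
    have h2 := hasDerivAt_comp_line ((hT.dT hU b).differentiableAt hU hx idx) a
    simpa [SecondOrderSymmetric.dT] using h2.unique h
  ext idx
  simp only [SecondOrderSymmetric.dT]
  rw [key, key, fderiv_fderiv_symm hU (hT idx) hx]

theorem ev_covDeriv_covDeriv {g : MetricMat n} {U : Set (Fin n → ℝ)} (hg : IsMetricOn g U)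
    {T : TensorField n s} (hT : SmoothTF T U) {x : Fin n → ℝ} (hx : x ∈ U) (a b : Fin n → ℝ)
    (v : Fin s → Fin n → ℝ) :
    ev (covDeriv g (covDeriv g T) x) (Fin.cons a (Fin.cons b v))
      = ev (dT (fun y => dT T y b) x a) v
        - ∑ i, (ev (dT T x a) (Function.update v i (Gm g x b (v i)))
          + ev (T x) (Function.update v i (fderiv ℝ (Gm g) x a b (v i))))
        - ev (covDeriv g T x) (Fin.cons (Gm g x a b) v)
        - ∑ i, ev (dT T x b) (Function.update v i (Gm g x a (v i)))
        + ∑ i, ∑ j, ev (T x) (Function.update (Function.update v i (Gm g x a (v i))) j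
            (Gm g x b (Function.update v i (Gm g x a (v i)) j))) := by
  have hc : ∀ᶠ t in nhds (0 : ℝ), x + t • a ∈ U :=
    (hasDerivAt_line x a).continuousAt.eventually_mem (by simpa using hg.isOpen.mem_nhds hx)
  have h1 := hasDerivAt_ev_const (v := Fin.cons b v) (t := 0)
    (by simpa using (hg.smoothTF_covDeriv hT).differentiableAt hg.isOpen hx)
    (hasDerivAt_line x a)
  have h2 := hasDerivAt_ev_const (T := fun y => dT T y b) (v := v) (t := 0)
    (by simpa using (hT.dT hg.isOpen b).differentiableAt hg.isOpen hx)
    (hasDerivAt_line x a)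
  have h3 : ∀ i ∈ Finset.univ, HasDerivAt
      (fun t : ℝ => ev (T (x + t • a)) (Function.update v i (Gm g (x + t • a) b (v i))))
      (ev (dT T x a) (Function.update v i (Gm g x b (v i)))
          + ev (T x) (Function.update v i (fderiv ℝ (Gm g) x a b (v i)))) 0 := by
    intro i _
    have hW : HasDerivAt (fun t : ℝ => Gm g (x + t • a) b (v i))
        (fderiv ℝ (Gm g) x a b (v i)) 0 := by
      have h0 := hasDerivAt_comp_line
        (E := (Fin n → ℝ) →L[ℝ] (Fin n → ℝ) →L[ℝ] (Fin n → ℝ)) (hg.differentiableAt_Gm hx) a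
      simpa using (h0.clm_apply (hasDerivAt_const (0 : ℝ) b)).clm_apply
        (hasDerivAt_const (0 : ℝ) (v i))
    have h0 := hasDerivAt_ev_update (T := T) (v := v) (i := i) (t := 0)
      (by simpa using hT.differentiableAt hg.isOpen hx) (hasDerivAt_line x a) hW
    simpa using h0
  have h4 := h2.sub (HasDerivAt.fun_sum h3)
  have h5 := h1.unique (h4.congr_of_eventuallyEq (by
    filter_upwards [hc] with t ht
    simp [ev_covDeriv]))
  simp only [zero_smul, add_zero] at h5
  rw [ev_covDeriv, h5, Fin.sum_univ_succ]
  simp only [Fin.cons_zero, Fin.cons_succ, Fin.update_cons_zero, ← Fin.cons_update]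
  have h6 : ∀ i, ev (covDeriv g T x) (Fin.cons b (Function.update v i (Gm g x a (v i))))
    = _ := fun i => ev_covDeriv g T x b _
  simp only [h6, Finset.sum_sub_distrib]
  ring

theorem ricci_identity {g : MetricMat n} {U : Set (Fin n → ℝ)} (hg : IsMetricOn g U)
    {T : TensorField n s} (hT : SmoothTF T U) {x : Fin n → ℝ} (hx : x ∈ U) (a b : Fin n → ℝ)
    (v : Fin s → Fin n → ℝ) :
    ev (covDeriv g (covDeriv g T) x) (Fin.cons a (Fin.cons b v))
      - ev (covDeriv g (covDeriv g T) x) (Fin.cons b (Fin.cons a v))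
      = -∑ i, ev (T x) (Function.update v i (Rm g x a b (v i))) := by
  rw [ev_covDeriv_covDeriv hg hT hx, ev_covDeriv_covDeriv hg hT hx,
    dT_dT_symm hg.isOpen hT hx b a, Gm_symm hg hx b a]
  have key : ∀ i j, ev (T x) (Function.update (Function.update v i (Gm g x a (v i))) j
            (Gm g x b (Function.update v i (Gm g x a (v i)) j)))
      - ev (T x) (Function.update (Function.update v j (Gm g x b (v j))) i
            (Gm g x a (Function.update v j (Gm g x b (v j)) i)))
      = if j = i then ev (T x) (Function.update v i (Gm g x b (Gm g x a (v i))))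
        - ev (T x) (Function.update v i (Gm g x a (Gm g x b (v i)))) else 0 := by
    intro i j
    split_ifs with h
    · subst h; simp
    · rw [Function.update_of_ne h, Function.update_of_ne (Ne.symm h),
        Function.update_comm h, sub_self]
  have h2 : (∑ i, ∑ j, ev (T x) (Function.update (Function.update v i (Gm g x a (v i))) j
            (Gm g x b (Function.update v i (Gm g x a (v i)) j))))
      - (∑ i, ∑ j, ev (T x) (Function.update (Function.update v i (Gm g x b (v i))) j
            (Gm g x a (Function.update v i (Gm g x b (v i)) j))))
      = ∑ i, (ev (T x) (Function.update v i (Gm g x b (Gm g x a (v i))))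
        - ev (T x) (Function.update v i (Gm g x a (Gm g x b (v i))))) := by
    rw [Finset.sum_comm (f := fun i j => ev (T x) (Function.update
      (Function.update v i (Gm g x b (v i))) j
            (Gm g x a (Function.update v i (Gm g x b (v i)) j)))), ← Finset.sum_sub_distrib]
    refine Finset.sum_congr rfl fun i _ => ?_
    rw [← Finset.sum_sub_distrib]
    simp only [key]
    simp
  simp only [Rm_apply, MultilinearMap.map_update_sub, MultilinearMap.map_update_add]
  simp only [Finset.sum_add_distrib, Finset.sum_sub_distrib] at h2 ⊢
  linear_combination h2

end

section

variable {n m s : ℕ}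

theorem covDeriv_eq_zero {g : MetricMat n} {U : Set (Fin n → ℝ)} (hU : IsOpen U)
    {T : TensorField n s} (hT : ∀ x ∈ U, ∀ idx, T x idx = 0) {x : Fin n → ℝ} (hx : x ∈ U)
    (idx : Fin (s + 1) → Fin n) : covDeriv g T x idx = 0 := by
  have h : ∀ i I, pd i (fun y => T y I) x = 0 := by
    intro i I
    have : (fun y => T y I) =ᶠ[nhds x] fun _ => (0 : ℝ) := by
      filter_upwards [hU.mem_nhds hx] with y hy using hT y hy I
    rw [pd, this.fderiv_eq]; simp
  simp [covDeriv, h, hT x hx]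

theorem ev_eq_zero_iff {t : (Fin s → Fin n) → ℝ} : ev t = 0 ↔ ∀ idx, t idx = 0 := by
  constructor
  · intro h idx
    rw [← ev_single t idx, h]; rfl
  · intro h
    refine MultilinearMap.ext fun v => ?_
    simp [ev_apply, h]

theorem fderiv_Gm_single {g : MetricMat n} {U : Set (Fin n → ℝ)} (hg : IsMetricOn g U)
    {x : Fin n → ℝ} (hx : x ∈ U) (i j k l : Fin n) :
    fderiv ℝ (Gm g) x (Pi.single i 1) (Pi.single j 1) (Pi.single k 1) l
      = pd i (fun y => christoffel g y l j k) x := by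
  have h0 := hasDerivAt_comp_line (E := (Fin n → ℝ) →L[ℝ] (Fin n → ℝ) →L[ℝ] (Fin n → ℝ))
    (hg.differentiableAt_Gm hx) (Pi.single i 1)
  have h1 := hasDerivAt_pi.mp ((h0.clm_apply (hasDerivAt_const (0 : ℝ)
    (Pi.single j 1 : Fin n → ℝ))).clm_apply
    (hasDerivAt_const (0 : ℝ) (Pi.single k 1 : Fin n → ℝ))) l
  have h2 := hasDerivAt_comp_line (((hg.contDiffOn_christoffel l j k).contDiffAt
    (hg.isOpen.mem_nhds hx)).differentiableAt (by simp)) (Pi.single i 1)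
  simp only [Gm_single] at h1
  rw [pd, h2.unique h1]
  simp

theorem Rm_single {g : MetricMat n} {U : Set (Fin n → ℝ)} (hg : IsMetricOn g U)
    {x : Fin n → ℝ} (hx : x ∈ U) (i j k l : Fin n) :
    Rm g x (Pi.single i 1) (Pi.single j 1) (Pi.single k 1) l = curvUp g x l k i j := by
  have h : ∀ (a b c l : Fin n), Gm g x (Pi.single a 1) (Gm g x (Pi.single b 1) (Pi.single c 1)) l
      = ∑ m, christoffel g x l a m * christoffel g x m b c := by
    intro a b c l
    rw [Gm_apply, Finset.sum_eq_single a]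
    · simp [Gm_single]
    · intro b _ hb; simp [hb]
    · simp
  simp only [Rm_apply, Pi.sub_apply, Pi.add_apply, fderiv_Gm_single hg hx, h, curvUp]

theorem ev_riemann {g : MetricMat n} {U : Set (Fin n → ℝ)} (hg : IsMetricOn g U)
    {x : Fin n → ℝ} (hx : x ∈ U) (v : Fin 4 → Fin n → ℝ) :
    ev (riemann g x) v = gB g x (v 0) (Rm g x (v 2) (v 3) (v 1)) := by
  let M : MultilinearMap ℝ (fun _ : Fin 4 => Fin n → ℝ) ℝ := MultilinearMap.mk'
    (fun v => gB g x (v 0) (Rm g x (v 2) (v 3) (v 1)))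
    (by
      intro v i a b
      fin_cases i <;> simp [Function.update, Rm_apply] <;> abel)
    (by
      intro v i c a
      fin_cases i <;> simp [Function.update, Rm_apply] <;> ring)
  suffices h : ev (riemann g x) = M by rw [h]; rfl
  refine Module.Basis.ext_multilinear (fun _ => Pi.basisFun ℝ (Fin n)) fun idx => ?_
  simp only [Pi.basisFun_apply]
  rw [ev_single]
  simp only [M, MultilinearMap.mk'_apply, gB_apply]
  rw [Finset.sum_eq_single (idx 0)]
  · simp [Rm_single hg hx, riemann]
  · intro b _ hb; simp [hb]
  · simp

theorem gB_Rm_skew {g : MetricMat n} {U : Set (Fin n → ℝ)} (hg : IsMetricOn g U)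
    {x : Fin n → ℝ} (hx : x ∈ U) (a b w c : Fin n → ℝ) :
    gB g x (Rm g x a b w) c + gB g x w (Rm g x a b c) = 0 := by
  have h := ricci_identity hg hg.smoothTF_gT hx a b ![w, c]
  have h0 : ∀ y ∈ U, ∀ idx, covDeriv g (gT g) y idx = 0 := fun y hy idx => by
    rw [← ev_single (covDeriv g (gT g) y), covDeriv_gT hg hy]; rfl
  rw [ev_eq_zero_iff.mpr (covDeriv_eq_zero hg.isOpen h0 hx), Fin.sum_univ_two,
    update_fin_two_zero, update_fin_two_one, ev_gT, ev_gT] at h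
  simp at h
  linarith

theorem fderiv_Gm_symm {g : MetricMat n} {U : Set (Fin n → ℝ)} (hg : IsMetricOn g U)
    {x : Fin n → ℝ} (hx : x ∈ U) (a b c : Fin n → ℝ) :
    fderiv ℝ (Gm g) x a b c = fderiv ℝ (Gm g) x a c b := by
  have h0 := hasDerivAt_comp_line (E := (Fin n → ℝ) →L[ℝ] (Fin n → ℝ) →L[ℝ] (Fin n → ℝ))
    (hg.differentiableAt_Gm hx) a
  have h1 := fun b c : Fin n → ℝ => (h0.clm_apply (hasDerivAt_const (0 : ℝ) b)).clm_apply
    (hasDerivAt_const (0 : ℝ) c)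
  have hc : ∀ᶠ t in nhds (0 : ℝ), x + t • a ∈ U :=
    (hasDerivAt_line x a).continuousAt.eventually_mem (by simpa using hg.isOpen.mem_nhds hx)
  have h2 := (h1 b c).unique ((h1 c b).congr_of_eventuallyEq (by
    filter_upwards [hc] with t ht using Gm_symm hg ht b c))
  simpa using h2

theorem Rm_bianchi {g : MetricMat n} {U : Set (Fin n → ℝ)} (hg : IsMetricOn g U)
    {x : Fin n → ℝ} (hx : x ∈ U) (a b c : Fin n → ℝ) :
    Rm g x a b c + Rm g x b c a + Rm g x c a b = 0 := by
  simp only [Rm_apply]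
  rw [fderiv_Gm_symm hg hx a c b, fderiv_Gm_symm hg hx b a c, fderiv_Gm_symm hg hx c b a,
    Gm_symm hg hx c b, Gm_symm hg hx b a, Gm_symm hg hx c a]
  abel

theorem covDeriv_perm_identity {g : MetricMat n} {U : Set (Fin n → ℝ)} (hg : IsMetricOn g U)
    {T : TensorField n s} (hT : SmoothTF T U) {ι : Type*} [Fintype ι] (k : ι → ℝ)
    (σ : ι → Equiv.Perm (Fin s)) (h : ∀ y ∈ U, ∀ v, ∑ i, k i * ev (T y) (v ∘ σ i) = 0)
    {x : Fin n → ℝ} (hx : x ∈ U) (e : Fin n → ℝ) (v : Fin s → Fin n → ℝ) :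
    ∑ i, k i * ev (covDeriv g T x) (Fin.cons e (v ∘ σ i)) = 0 := by
  have hc : ∀ᶠ t in nhds (0 : ℝ), x + t • e ∈ U :=
    (hasDerivAt_line x e).continuousAt.eventually_mem (by simpa using hg.isOpen.mem_nhds hx)
  have h1 : ∑ i, k i * ev (dT T x e) (v ∘ σ i) = 0 := by
    have hd : ∀ i ∈ Finset.univ, HasDerivAt (fun t : ℝ => k i * ev (T (x + t • e)) (v ∘ σ i))
        (k i * ev (dT T x e) (v ∘ σ i)) 0 := fun i _ => by
      have := hasDerivAt_ev_const (v := v ∘ σ i) (t := 0)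
        (by simpa using hT.differentiableAt hg.isOpen hx) (hasDerivAt_line x e)
      simpa using this.const_mul (k i)
    exact (HasDerivAt.fun_sum hd).unique ((hasDerivAt_const (0 : ℝ) (0 : ℝ)).congr_of_eventuallyEq
      (by filter_upwards [hc] with t ht using h _ ht v))
  have h2 : ∀ i, ∑ a, ev (T x) (Function.update (v ∘ σ i) a (Gm g x e ((v ∘ σ i) a)))
      = ∑ a, ev (T x) (Function.update v a (Gm g x e (v a)) ∘ σ i) := by
    intro i
    rw [← Equiv.sum_comp (σ i) (fun a => ev (T x) (Function.update v a (Gm g x e (v a)) ∘ σ i))]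
    refine Finset.sum_congr rfl fun a _ => ?_
    rw [Function.update_comp_eq_of_injective _ (σ i).injective]
    rfl
  simp only [ev_covDeriv, h2, mul_sub, Finset.sum_sub_distrib, h1, zero_sub, neg_eq_zero,
    Finset.mul_sum]
  rw [Finset.sum_comm]
  exact Finset.sum_eq_zero fun a _ => h x hx _

theorem hasDerivAt_fderiv_line {E : Type*} [NormedAddCommGroup E] [NormedSpace ℝ E]
    {f : (Fin n → ℝ) → E} {U : Set (Fin n → ℝ)} (hU : IsOpen U)
    (hf : ContDiffOn ℝ (⊤ : ℕ∞) f U) {x : Fin n → ℝ} (hx : x ∈ U) (e a : Fin n → ℝ) :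
    HasDerivAt (fun t : ℝ => fderiv ℝ f (x + t • e) a) (fderiv ℝ (fderiv ℝ f) x e a) 0 := by
  simpa using (hasDerivAt_comp_line (differentiableAt_fderiv hU hf hx) e).clm_apply
    (hasDerivAt_const (0 : ℝ) a)

theorem fderiv_fderiv_apply {E : Type*} [NormedAddCommGroup E] [NormedSpace ℝ E]
    {f : (Fin n → ℝ) → E} {U : Set (Fin n → ℝ)} (hU : IsOpen U)
    (hf : ContDiffOn ℝ (⊤ : ℕ∞) f U) {x : Fin n → ℝ} (hx : x ∈ U) (e a : Fin n → ℝ) :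
    fderiv ℝ (fun y => fderiv ℝ f y a) x e = fderiv ℝ (fderiv ℝ f) x e a := by
  have h2 := ((hf.fderiv_of_isOpen (m := (⊤ : ℕ∞)) hU (by simp)).clm_apply
    (contDiffOn_const (c := a))).contDiffAt (hU.mem_nhds hx)
  exact (hasDerivAt_comp_line (h2.differentiableAt (by simp)) e).unique
    (hasDerivAt_fderiv_line hU hf hx e a)

/-- Second derivative of the Christoffel symbols. -/
def D2G (g : MetricMat n) (x e a : Fin n → ℝ) :
    (Fin n → ℝ) →L[ℝ] (Fin n → ℝ) →L[ℝ] (Fin n → ℝ) :=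
  fderiv ℝ (fun y => fderiv ℝ (Gm g) y a) x e

theorem D2G_symm {g : MetricMat n} {U : Set (Fin n → ℝ)} (hg : IsMetricOn g U)
    {x : Fin n → ℝ} (hx : x ∈ U) (e a : Fin n → ℝ) : D2G g x e a = D2G g x a e := by
  unfold D2G
  rw [fderiv_fderiv_apply hg.isOpen hg.contDiffOn_Gm hx,
    fderiv_fderiv_apply hg.isOpen hg.contDiffOn_Gm hx,
    fderiv_fderiv_symm hg.isOpen hg.contDiffOn_Gm hx]

theorem hasDerivAt_Rm_line {g : MetricMat n} {U : Set (Fin n → ℝ)} (hg : IsMetricOn g U)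
    {x : Fin n → ℝ} (hx : x ∈ U) (e a b c : Fin n → ℝ) :
    HasDerivAt (fun t : ℝ => Rm g (x + t • e) a b c)
      (D2G g x e a b c - D2G g x e b a c
        + (fderiv ℝ (Gm g) x e a (Gm g x b c) + Gm g x a (fderiv ℝ (Gm g) x e b c))
        - (fderiv ℝ (Gm g) x e b (Gm g x a c) + Gm g x b (fderiv ℝ (Gm g) x e a c))) 0 := by
  have h0 := hasDerivAt_comp_line (E := (Fin n → ℝ) →L[ℝ] (Fin n → ℝ) →L[ℝ] (Fin n → ℝ))
    (hg.differentiableAt_Gm hx) e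
  have hG : ∀ u v : Fin n → ℝ, HasDerivAt (fun t : ℝ => Gm g (x + t • e) u v)
      (fderiv ℝ (Gm g) x e u v) 0 := fun u v => by
    simpa using (h0.clm_apply (hasDerivAt_const (0 : ℝ) u)).clm_apply (hasDerivAt_const (0 : ℝ) v)
  have hGG : ∀ u v w : Fin n → ℝ, HasDerivAt
      (fun t : ℝ => Gm g (x + t • e) u (Gm g (x + t • e) v w))
      (fderiv ℝ (Gm g) x e u (Gm g x v w) + Gm g x u (fderiv ℝ (Gm g) x e v w)) 0 := fun u v w => by
    simpa using (h0.clm_apply (hasDerivAt_const (0 : ℝ) u)).clm_apply (hG v w)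
  have hD : ∀ u v w : Fin n → ℝ, HasDerivAt (fun t : ℝ => fderiv ℝ (Gm g) (x + t • e) u v w)
      (D2G g x e u v w) 0 := fun u v w => by
    have h1 := hasDerivAt_fderiv_line (E := (Fin n → ℝ) →L[ℝ] (Fin n → ℝ) →L[ℝ] (Fin n → ℝ))
      hg.isOpen hg.contDiffOn_Gm hx e u
    rw [← fderiv_fderiv_apply hg.isOpen hg.contDiffOn_Gm hx] at h1
    simpa [D2G] using (h1.clm_apply (hasDerivAt_const (0 : ℝ) v)).clm_apply (hasDerivAt_const (0 : ℝ) w)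
  exact (((hD a b c).sub (hD b a c)).add (hGG a b c)).sub (hGG b a c)

end

section

variable {n m s : ℕ}

/-- The covariant derivative of the curvature operator, in the direction `e`. -/
def dRm (g : MetricMat n) (x e a b c : Fin n → ℝ) : Fin n → ℝ :=
  D2G g x e a b c - D2G g x e b a c
    + (fderiv ℝ (Gm g) x e a (Gm g x b c) + Gm g x a (fderiv ℝ (Gm g) x e b c))
    - (fderiv ℝ (Gm g) x e b (Gm g x a c) + Gm g x b (fderiv ℝ (Gm g) x e a c))
    + Gm g x e (Rm g x a b c) - Rm g x (Gm g x e a) b c - Rm g x a (Gm g x e b) c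
    - Rm g x a b (Gm g x e c)

theorem hasDerivAt_gB_line {g : MetricMat n} {U : Set (Fin n → ℝ)} (hg : IsMetricOn g U)
    {x : Fin n → ℝ} (hx : x ∈ U) (e w : Fin n → ℝ) {W : ℝ → Fin n → ℝ} {W' : Fin n → ℝ}
    (hW : HasDerivAt W W' 0) :
    HasDerivAt (fun t : ℝ => gB g (x + t • e) w (W t))
      (gB g x (Gm g x e w) (W 0) + gB g x w (Gm g x e (W 0) + W')) 0 := by
  have := hasDerivAt_ev_update (T := gT g) (v := ![w, 0]) (i := 1) (t := 0)
    (by simpa using hg.smoothTF_gT.differentiableAt hg.isOpen hx) (hasDerivAt_line x e) hW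
  simp only [update_fin_two_one, ev_gT, zero_smul, add_zero] at this
  refine this.congr_deriv ?_
  rw [← dg, dg_eq hg hx, map_add, Matrix.cons_val_zero, Matrix.cons_val_one, add_assoc]
  rfl

theorem ev_nablaR_one {g : MetricMat n} {U : Set (Fin n → ℝ)} (hg : IsMetricOn g U)
    {x : Fin n → ℝ} (hx : x ∈ U) (e w c a b : Fin n → ℝ) :
    ev (covDeriv g (riemann g) x) ![e, w, c, a, b] = gB g x w (dRm g x e a b c) := by
  have hc : ∀ᶠ t in nhds (0 : ℝ), x + t • e ∈ U :=
    (hasDerivAt_line x e).continuousAt.eventually_mem (by simpa using hg.isOpen.mem_nhds hx)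
  have h1 := hasDerivAt_ev_const (v := ![w, c, a, b]) (t := 0)
    (by simpa using hg.smoothTF_riemann.differentiableAt hg.isOpen hx) (hasDerivAt_line x e)
  have h2 := hasDerivAt_gB_line hg hx e w (hasDerivAt_Rm_line hg hx e a b c)
  have h3 := h1.unique (h2.congr_of_eventuallyEq (by
    filter_upwards [hc] with t ht
    rw [ev_riemann hg ht]; rfl))
  have h4 : (![e, w, c, a, b] : Fin 5 → Fin n → ℝ) = Fin.cons e ![w, c, a, b] := rfl
  simp only [zero_smul, add_zero] at h3
  rw [h4, ev_covDeriv, h3, Fin.sum_univ_four]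
  simp only [ev_riemann hg hx, dRm]
  simp [Function.update]
  ring

theorem dRm_bianchi {g : MetricMat n} {U : Set (Fin n → ℝ)} (hg : IsMetricOn g U)
    {x : Fin n → ℝ} (hx : x ∈ U) (e a b c : Fin n → ℝ) :
    dRm g x e a b c + dRm g x a b e c + dRm g x b e a c = 0 := by
  have h : ∀ u v w : Fin n → ℝ, Rm g x u v w = -Rm g x v u w := fun u v w => by
    rw [Rm_antisymm]; rfl
  unfold dRm
  rw [h a (Gm g x e b), h b (Gm g x a e), h e (Gm g x b a), Gm_symm hg hx b a, Gm_symm hg hx b e,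
    Gm_symm hg hx a e, D2G_symm hg hx a e, D2G_symm hg hx b e, D2G_symm hg hx b a]
  simp only [Rm_apply, map_add, map_sub]
  abel

theorem dRm_antisymm (g : MetricMat n) (x e a b c : Fin n → ℝ) :
    dRm g x e a b c = -dRm g x e b a c := by
  have h : ∀ u v w : Fin n → ℝ, Rm g x u v w = -Rm g x v u w := fun u v w => by
    rw [Rm_antisymm]; rfl
  unfold dRm
  rw [h a b c, h b (Gm g x e a), h a b (Gm g x e c), h (Gm g x e b) a, map_neg]
  abel

/-- The curvature tensor as a function of four vectors. -/
def Rie (g : MetricMat n) (x w c a b : Fin n → ℝ) : ℝ := ev (riemann g x) ![w, c, a, b]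

/-- The covariant derivative of the curvature tensor as a function of five vectors. -/
def Nie (g : MetricMat n) (x e w c a b : Fin n → ℝ) : ℝ :=
  ev (covDeriv g (riemann g) x) ![e, w, c, a, b]

section
variable {g : MetricMat n} {U : Set (Fin n → ℝ)} {x : Fin n → ℝ}

theorem Rie_eq (hg : IsMetricOn g U) (hx : x ∈ U) (w c a b : Fin n → ℝ) :
    Rie g x w c a b = gB g x w (Rm g x a b c) := ev_riemann hg hx _

theorem Nie_eq (hg : IsMetricOn g U) (hx : x ∈ U) (e w c a b : Fin n → ℝ) :
    Nie g x e w c a b = gB g x w (dRm g x e a b c) := ev_nablaR_one hg hx _ _ _ _ _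

theorem Rie_antisymm_left (hg : IsMetricOn g U) (hx : x ∈ U) (w c a b : Fin n → ℝ) :
    Rie g x w c a b = -Rie g x c w a b := by
  rw [Rie_eq hg hx, Rie_eq hg hx, gB_symm (hg.symm x hx) c]
  linarith [gB_Rm_skew hg hx a b w c]

theorem Rie_bianchi (hg : IsMetricOn g U) (hx : x ∈ U) (w c a b : Fin n → ℝ) :
    Rie g x w c a b + Rie g x w a b c + Rie g x w b c a = 0 := by
  rw [Rie_eq hg hx, Rie_eq hg hx, Rie_eq hg hx, ← map_add, ← map_add]
  have := Rm_bianchi hg hx a b c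
  rw [this, map_zero]

theorem Nie_antisymm_left (hg : IsMetricOn g U) (hx : x ∈ U) (e w c a b : Fin n → ℝ) :
    Nie g x e w c a b = -Nie g x e c w a b := by
  have hp : ∀ v : Fin 4 → Fin n → ℝ, v ∘ Equiv.swap 0 1 = ![v 1, v 0, v 2, v 3] := fun v => by
    ext i; fin_cases i <;> rfl
  have hv : ∀ v : Fin 4 → Fin n → ℝ, v = ![v 0, v 1, v 2, v 3] := fun v => by
    ext i; fin_cases i <;> rfl
  have := covDeriv_perm_identity hg hg.smoothTF_riemann (ι := Fin 2) (fun _ => 1)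
    ![1, Equiv.swap 0 1] (fun y hy v => by
      have h1 := Rie_antisymm_left hg hy (v 0) (v 1) (v 2) (v 3)
      simp only [Fin.sum_univ_two, Matrix.cons_val_zero, Matrix.cons_val_one, hp,
        Equiv.Perm.coe_one, Function.comp_id]
      rw [Rie, ← hv] at h1
      rw [h1, Rie]; ring) hx e ![w, c, a, b]
  simp only [Fin.sum_univ_two, Matrix.cons_val_zero, Matrix.cons_val_one, hp,
        Equiv.Perm.coe_one, Function.comp_id] at this
  change 1 * Nie g x e w c a b + 1 * Nie g x e c w a b = 0 at this
  linarith

theorem Nie_bianchi (hg : IsMetricOn g U) (hx : x ∈ U) (e w c a b : Fin n → ℝ) :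
    Nie g x e w c a b + Nie g x e w a b c + Nie g x e w b c a = 0 := by
  let σ : Equiv.Perm (Fin 4) := ⟨![0, 2, 3, 1], ![0, 3, 1, 2], by decide, by decide⟩
  have hp : ∀ v : Fin 4 → Fin n → ℝ, v ∘ σ = ![v 0, v 2, v 3, v 1] := fun v => by
    ext i; fin_cases i <;> rfl
  have hp' : ∀ v : Fin 4 → Fin n → ℝ, v ∘ σ.symm = ![v 0, v 3, v 1, v 2] := fun v => by
    ext i; fin_cases i <;> rfl
  have hv : ∀ v : Fin 4 → Fin n → ℝ, v = ![v 0, v 1, v 2, v 3] := fun v => by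
    ext i; fin_cases i <;> rfl
  have := covDeriv_perm_identity hg hg.smoothTF_riemann (ι := Fin 3) (fun _ => 1)
    ![1, σ, σ.symm] (fun y hy v => by
      have h1 := Rie_bianchi hg hy (v 0) (v 1) (v 2) (v 3)
      simp only [Fin.sum_univ_three, Matrix.cons_val_zero, Matrix.cons_val_one, Matrix.cons_val, hp,
        hp', Equiv.Perm.coe_one, Function.comp_id]
      rw [Rie, ← hv] at h1
      rw [Rie, Rie] at h1; linarith) hx e ![w, c, a, b]
  simp only [Fin.sum_univ_three, Matrix.cons_val_zero, Matrix.cons_val_one, Matrix.cons_val, hp,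
        hp', Equiv.Perm.coe_one, Function.comp_id] at this
  change 1 * Nie g x e w c a b + 1 * Nie g x e w a b c + 1 * Nie g x e w b c a = 0 at this
  linarith

theorem Rie_derivation (hg : IsMetricOn g U)
    (h2 : ∀ x ∈ U, ∀ idx, covDeriv g (covDeriv g (riemann g)) x idx = 0) (hx : x ∈ U)
    (y z w c a b : Fin n → ℝ) :
    Rie g x (Rm g x y z w) c a b + Rie g x w (Rm g x y z c) a b
      + Rie g x w c (Rm g x y z a) b + Rie g x w c a (Rm g x y z b) = 0 := by
  have h := ricci_identity hg hg.smoothTF_riemann hx y z ![w, c, a, b]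
  rw [ev_eq_zero_iff.mpr (h2 x hx), Fin.sum_univ_four] at h
  have e0 : ∀ p q r t u : Fin n → ℝ, Function.update ![p, q, r, t] 0 u = ![u, q, r, t] :=
    fun p q r t u => by ext i; fin_cases i <;> rfl
  have e1 : ∀ p q r t u : Fin n → ℝ, Function.update ![p, q, r, t] 1 u = ![p, u, r, t] :=
    fun p q r t u => by ext i; fin_cases i <;> rfl
  have e2 : ∀ p q r t u : Fin n → ℝ, Function.update ![p, q, r, t] 2 u = ![p, q, u, t] :=
    fun p q r t u => by ext i; fin_cases i <;> rfl
  have e3 : ∀ p q r t u : Fin n → ℝ, Function.update ![p, q, r, t] 3 u = ![p, q, r, u] :=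
    fun p q r t u => by ext i; fin_cases i <;> rfl
  rw [e0, e1, e2, e3] at h
  simp only [_root_.zero_apply] at h
  unfold Rie
  simp only [Matrix.cons_val] at h
  linarith

theorem Nie_derivation (hg : IsMetricOn g U)
    (h2 : ∀ x ∈ U, ∀ idx, covDeriv g (covDeriv g (riemann g)) x idx = 0) (hx : x ∈ U)
    (y z e w c a b : Fin n → ℝ) :
    Nie g x (Rm g x y z e) w c a b + Nie g x e (Rm g x y z w) c a b
      + Nie g x e w (Rm g x y z c) a b
      + Nie g x e w c (Rm g x y z a) b + Nie g x e w c a (Rm g x y z b) = 0 := by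
  have h := ricci_identity hg (hg.smoothTF_covDeriv hg.smoothTF_riemann) hx y z ![e, w, c, a, b]
  rw [ev_eq_zero_iff.mpr (covDeriv_eq_zero hg.isOpen h2 hx), Fin.sum_univ_five] at h
  have e0 : ∀ o p q r t u : Fin n → ℝ, Function.update ![o, p, q, r, t] 0 u = ![u, p, q, r, t] :=
    fun o p q r t u => by ext i; fin_cases i <;> rfl
  have e1 : ∀ o p q r t u : Fin n → ℝ, Function.update ![o, p, q, r, t] 1 u = ![o, u, q, r, t] :=
    fun o p q r t u => by ext i; fin_cases i <;> rfl
  have e2 : ∀ o p q r t u : Fin n → ℝ, Function.update ![o, p, q, r, t] 2 u = ![o, p, u, r, t] :=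
    fun o p q r t u => by ext i; fin_cases i <;> rfl
  have e3 : ∀ o p q r t u : Fin n → ℝ, Function.update ![o, p, q, r, t] 3 u = ![o, p, q, u, t] :=
    fun o p q r t u => by ext i; fin_cases i <;> rfl
  have e4 : ∀ o p q r t u : Fin n → ℝ, Function.update ![o, p, q, r, t] 4 u = ![o, p, q, r, u] :=
    fun o p q r t u => by ext i; fin_cases i <;> rfl
  rw [e0, e1, e2, e3, e4] at h
  simp only [_root_.zero_apply] at h
  unfold Nie
  simp only [Matrix.cons_val] at h
  linarith

end

end

section

variable {n m s : ℕ}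

/-- A smooth isometric immersion compatible with the Levi-Civita connections. -/
structure IsAffineOn (g : MetricMat n) (g' : MetricMat m) (τ : (Fin n → ℝ) → Fin m → ℝ)
    (U : Set (Fin n → ℝ)) (U' : Set (Fin m → ℝ)) : Prop where
  source : IsMetricOn g U
  target : IsMetricOn g' U'
  smooth : ContDiffOn ℝ (⊤ : ℕ∞) τ U
  mapsTo : MapsTo τ U U'
  isom : ∀ x ∈ U, ∀ u v, gB g x u v = gB g' (τ x) (fderiv ℝ τ x u) (fderiv ℝ τ x v)
  affine : ∀ x ∈ U, ∀ u v, fderiv ℝ τ x (Gm g x u v)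
    = fderiv ℝ (fderiv ℝ τ) x u v + Gm g' (τ x) (fderiv ℝ τ x u) (fderiv ℝ τ x v)

section
variable {g : MetricMat n} {g' : MetricMat m} {τ : (Fin n → ℝ) → Fin m → ℝ}
  {U : Set (Fin n → ℝ)} {U' : Set (Fin m → ℝ)} {x : Fin n → ℝ}

theorem differentiableAt_of_contDiffOn {E : Type*} [NormedAddCommGroup E] [NormedSpace ℝ E]
    {f : (Fin n → ℝ) → E} (hU : IsOpen U) (hf : ContDiffOn ℝ (⊤ : ℕ∞) f U) (hx : x ∈ U) :
    DifferentiableAt ℝ f x :=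
  (hf.contDiffAt (hU.mem_nhds hx)).differentiableAt (by simp)

theorem eventually_line_mem (hU : IsOpen U) (hx : x ∈ U) (e : Fin n → ℝ) :
    ∀ᶠ t in nhds (0 : ℝ), x + t • e ∈ U :=
  (hasDerivAt_line x e).continuousAt.eventually_mem (by simpa using hU.mem_nhds hx)

theorem dT_pullback (hg : IsMetricOn g U) (hg' : IsMetricOn g' U')
    (hτ : ContDiffOn ℝ (⊤ : ℕ∞) τ U) (hm : MapsTo τ U U')
    {S : TensorField n s} {S' : TensorField m s} (hS : SmoothTF S U) (hS' : SmoothTF S' U')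
    (h : ∀ y ∈ U, ∀ v, ev (S y) v = ev (S' (τ y)) (fun a => fderiv ℝ τ y (v a))) (hx : x ∈ U)
    (e : Fin n → ℝ) (v : Fin s → Fin n → ℝ) :
    ev (dT S x e) v = ev (dT S' (τ x) (fderiv ℝ τ x e)) (fun a => fderiv ℝ τ x (v a))
      + ∑ a, ev (S' (τ x)) (Function.update (fun b => fderiv ℝ τ x (v b)) a
        (fderiv ℝ (fderiv ℝ τ) x e (v a))) := by
  have h1 := hasDerivAt_ev_const (v := v) (t := 0)
    (by simpa using hS.differentiableAt hg.isOpen hx) (hasDerivAt_line x e)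
  have h2 := hasDerivAt_ev (T := S') (c := fun t : ℝ => τ (x + t • e))
    (v := fun a t => fderiv ℝ τ (x + t • e) (v a)) (t := 0)
    (by simpa using hS'.differentiableAt hg'.isOpen (hm hx))
    (hasDerivAt_comp_line (differentiableAt_of_contDiffOn hg.isOpen hτ hx) e)
    (fun a => hasDerivAt_fderiv_line hg.isOpen hτ hx e (v a))
  have h3 := h1.unique (h2.congr_of_eventuallyEq (by
    filter_upwards [eventually_line_mem hg.isOpen hx e] with t ht using h _ ht v))
  simpa using h3

theorem IsAffineOn.ev_covDeriv_pullback (hτ : IsAffineOn g g' τ U U')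
    {S : TensorField n s} {S' : TensorField m s} (hS : SmoothTF S U) (hS' : SmoothTF S' U')
    (h : ∀ y ∈ U, ∀ v, ev (S y) v = ev (S' (τ y)) (fun a => fderiv ℝ τ y (v a))) (hx : x ∈ U)
    (v : Fin (s + 1) → Fin n → ℝ) :
    ev (covDeriv g S x) v = ev (covDeriv g' S' (τ x)) (fun a => fderiv ℝ τ x (v a)) := by
  have hv : (fun a => fderiv ℝ τ x (v a))
      = Fin.cons (fderiv ℝ τ x (v 0)) (fun a => fderiv ℝ τ x (Fin.tail v a)) := by
    ext a; refine Fin.cases ?_ (fun i => ?_) a <;> rfl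
  rw [hv, ← Fin.cons_self_tail v, ev_covDeriv, ev_covDeriv,
    dT_pullback hτ.source hτ.target hτ.smooth hτ.mapsTo hS hS' h hx, Fin.cons_zero]
  have hu : ∀ a, ev (S x) (Function.update (Fin.tail v) a (Gm g x (v 0) (Fin.tail v a)))
      = ev (S' (τ x)) (Function.update (fun b => fderiv ℝ τ x (Fin.tail v b)) a
        (fderiv ℝ (fderiv ℝ τ) x (v 0) (Fin.tail v a)))
      + ev (S' (τ x)) (Function.update (fun b => fderiv ℝ τ x (Fin.tail v b)) a
        (Gm g' (τ x) (fderiv ℝ τ x (v 0)) (fderiv ℝ τ x (Fin.tail v a)))) := by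
    intro a
    rw [h x hx, ← MultilinearMap.map_update_add, ← hτ.affine x hx]
    congr 1
    ext b
    by_cases hb : b = a
    · subst hb; simp
    · simp [Function.update_of_ne hb]
  simp only [hu, Finset.sum_add_distrib, Fin.tail_cons]
  ring

theorem IsAffineOn.Rm_map (hτ : IsAffineOn g g' τ U U') (hx : x ∈ U) (a b c : Fin n → ℝ) :
    fderiv ℝ τ x (Rm g x a b c)
      = Rm g' (τ x) (fderiv ℝ τ x a) (fderiv ℝ τ x b) (fderiv ℝ τ x c) := by
  have hU := hτ.source.isOpen
  have hD : ∀ a b c : Fin n → ℝ, fderiv ℝ τ x (fderiv ℝ (Gm g) x a b c)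
      = fderiv ℝ (fderiv ℝ (fun y => fderiv ℝ τ y c)) x a b
        + fderiv ℝ (Gm g') (τ x) (fderiv ℝ τ x a) (fderiv ℝ τ x b) (fderiv ℝ τ x c)
        + Gm g' (τ x) (fderiv ℝ (fderiv ℝ τ) x a b) (fderiv ℝ τ x c)
        + Gm g' (τ x) (fderiv ℝ τ x b) (fderiv ℝ (fderiv ℝ τ) x a c)
        - fderiv ℝ (fderiv ℝ τ) x a (Gm g x b c) := by
    intro a b c
    have hτc : ContDiffOn ℝ (⊤ : ℕ∞) (fun y => fderiv ℝ τ y c) U :=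
      (hτ.smooth.fderiv_of_isOpen (m := (⊤ : ℕ∞)) hU (by simp)).clm_apply contDiffOn_const
    have d1 := hasDerivAt_comp_line (differentiableAt_fderiv hU hτ.smooth hx) a
    have dG : HasDerivAt (fun t : ℝ => Gm g (x + t • a) b c) (fderiv ℝ (Gm g) x a b c) 0 := by
      have h0 := hasDerivAt_comp_line (E := (Fin n → ℝ) →L[ℝ] (Fin n → ℝ) →L[ℝ] (Fin n → ℝ))
        (hτ.source.differentiableAt_Gm hx) a
      simpa using (h0.clm_apply (hasDerivAt_const (0 : ℝ) b)).clm_apply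
        (hasDerivAt_const (0 : ℝ) c)
    have dG' : HasDerivAt (fun t : ℝ => Gm g' (τ (x + t • a)) (fderiv ℝ τ (x + t • a) b)
        (fderiv ℝ τ (x + t • a) c))
        (fderiv ℝ (Gm g') (τ x) (fderiv ℝ τ x a) (fderiv ℝ τ x b) (fderiv ℝ τ x c)
          + Gm g' (τ x) (fderiv ℝ (fderiv ℝ τ) x a b) (fderiv ℝ τ x c)
          + Gm g' (τ x) (fderiv ℝ τ x b) (fderiv ℝ (fderiv ℝ τ) x a c)) 0 := by
      have h0 := hasDerivAt_comp_line (differentiableAt_of_contDiffOn hU hτ.smooth hx) a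
      have h1 : HasDerivAt (fun t : ℝ => Gm g' (τ (x + t • a)))
          (fderiv ℝ (Gm g') (τ x) (fderiv ℝ τ x a)) 0 := by
        have hd := (hτ.target.differentiableAt_Gm (hτ.mapsTo hx)).hasFDerivAt
        have hd' : HasFDerivAt (Gm g') (fderiv ℝ (Gm g') (τ x)) (τ (x + (0 : ℝ) • a)) := by
          simpa using hd
        exact HasFDerivAt.comp_hasDerivAt (F := Fin m → ℝ)
          (E := (Fin m → ℝ) →L[ℝ] (Fin m → ℝ) →L[ℝ] (Fin m → ℝ)) (0 : ℝ) hd' h0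
      simpa using (h1.clm_apply (hasDerivAt_fderiv_line hU hτ.smooth hx a b)).clm_apply
        (hasDerivAt_fderiv_line hU hτ.smooth hx a c)
    have lhs := d1.clm_apply dG
    have rhs := (hasDerivAt_fderiv_line hU hτc hx a b).add dG'
    have key := lhs.unique (rhs.congr_of_eventuallyEq (by
      filter_upwards [eventually_line_mem hU hx a] with t ht
      have h1 := hτ.affine _ ht b c
      rw [h1]
      rw [Pi.add_apply, ← fderiv_fderiv_apply hU hτ.smooth ht]))
    simp only [zero_smul, add_zero] at key
    rw [← sub_eq_iff_eq_add'.mpr key.symm]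
    abel
  have hG : ∀ a b c : Fin n → ℝ, fderiv ℝ τ x (Gm g x a (Gm g x b c))
      = fderiv ℝ (fderiv ℝ τ) x a (Gm g x b c)
        + Gm g' (τ x) (fderiv ℝ τ x a) (fderiv ℝ (fderiv ℝ τ) x b c)
        + Gm g' (τ x) (fderiv ℝ τ x a) (Gm g' (τ x) (fderiv ℝ τ x b) (fderiv ℝ τ x c)) := by
    intro a b c
    rw [hτ.affine x hx, hτ.affine x hx b c, map_add, add_assoc]
  have hs : fderiv ℝ (fderiv ℝ (fun y => fderiv ℝ τ y c)) x a b
      = fderiv ℝ (fderiv ℝ (fun y => fderiv ℝ τ y c)) x b a :=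
    fderiv_fderiv_symm hU
      ((hτ.smooth.fderiv_of_isOpen (m := (⊤ : ℕ∞)) hU (by simp)).clm_apply contDiffOn_const) hx a b
  rw [Rm_apply, Rm_apply, map_sub, map_add, map_sub, hD, hD, hG, hG, hs,
    fderiv_fderiv_symm hU hτ.smooth hx a b]
  abel

theorem IsAffineOn.Rie_eq (hτ : IsAffineOn g g' τ U U') (hx : x ∈ U) (w c a b : Fin n → ℝ) :
    Rie g x w c a b = Rie g' (τ x) (fderiv ℝ τ x w) (fderiv ℝ τ x c) (fderiv ℝ τ x a)
      (fderiv ℝ τ x b) := by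
  rw [SecondOrderSymmetric.Rie_eq hτ.source hx, SecondOrderSymmetric.Rie_eq hτ.target (hτ.mapsTo hx),
    hτ.isom x hx, hτ.Rm_map hx]

theorem IsAffineOn.Nie_eq (hτ : IsAffineOn g g' τ U U') (hx : x ∈ U) (e w c a b : Fin n → ℝ) :
    Nie g x e w c a b = Nie g' (τ x) (fderiv ℝ τ x e) (fderiv ℝ τ x w) (fderiv ℝ τ x c)
      (fderiv ℝ τ x a) (fderiv ℝ τ x b) := by
  have h := hτ.ev_covDeriv_pullback hτ.source.smoothTF_riemann hτ.target.smoothTF_riemann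
    (fun y hy v => by
      rw [ev_riemann hτ.source hy, ev_riemann hτ.target (hτ.mapsTo hy), hτ.isom y hy,
        hτ.Rm_map hy]) hx ![e, w, c, a, b]
  rw [Nie, h, Nie]
  congr 1
  ext i; fin_cases i <;> rfl

theorem gB_affine_of_isom (hg : IsMetricOn g U) (hg' : IsMetricOn g' U')
    (hτ : ContDiffOn ℝ (⊤ : ℕ∞) τ U) (hm : MapsTo τ U U')
    (hi : ∀ x ∈ U, ∀ u v, gB g x u v = gB g' (τ x) (fderiv ℝ τ x u) (fderiv ℝ τ x v))
    (hx : x ∈ U) (u v w : Fin n → ℝ) :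
    gB g' (τ x) (fderiv ℝ τ x w) (fderiv ℝ τ x (Gm g x u v))
      = gB g' (τ x) (fderiv ℝ τ x w) (fderiv ℝ (fderiv ℝ τ) x u v
        + Gm g' (τ x) (fderiv ℝ τ x u) (fderiv ℝ τ x v)) := by
  have hd : ∀ e u v : Fin n → ℝ, dg g x e u v
      = dg g' (τ x) (fderiv ℝ τ x e) (fderiv ℝ τ x u) (fderiv ℝ τ x v)
        + gB g' (τ x) (fderiv ℝ (fderiv ℝ τ) x e u) (fderiv ℝ τ x v)
        + gB g' (τ x) (fderiv ℝ τ x u) (fderiv ℝ (fderiv ℝ τ) x e v) := by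
    intro e u v
    have := dT_pullback hg hg' hτ hm hg.smoothTF_gT hg'.smoothTF_gT
      (fun y hy v => by rw [ev_gT, ev_gT, hi y hy]) hx e ![u, v]
    have hv : (fun a => fderiv ℝ τ x ((![u, v] : Fin 2 → Fin n → ℝ) a))
        = ![fderiv ℝ τ x u, fderiv ℝ τ x v] := by ext i; fin_cases i <;> rfl
    rw [hv, Fin.sum_univ_two, update_fin_two_zero, update_fin_two_one, ev_gT, ev_gT, ← dg,
      ← dg] at this
    simpa [add_assoc] using this
  rw [← hi x hx, koszul hg hx, hd, hd, hd, map_add, koszul hg' (hm hx),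
    fderiv_fderiv_symm hg.isOpen hτ hx v u, fderiv_fderiv_symm hg.isOpen hτ hx w u,
    fderiv_fderiv_symm hg.isOpen hτ hx w v,
    gB_symm (hg'.symm _ (hm hx)) (fderiv ℝ (fderiv ℝ τ) x v w) (fderiv ℝ τ x u)]
  rw [gB_symm (hg'.symm _ (hm hx)) (fderiv ℝ (fderiv ℝ τ) x u w) (fderiv ℝ τ x v)]
  ring

theorem isAffineOn_of_isom {g' : MetricMat n} {τ : (Fin n → ℝ) → Fin n → ℝ}
    {U' : Set (Fin n → ℝ)} (hg : IsMetricOn g U) (hg' : IsMetricOn g' U')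
    (hτ : ContDiffOn ℝ (⊤ : ℕ∞) τ U) (hm : MapsTo τ U U')
    (hi : ∀ x ∈ U, ∀ u v, gB g x u v = gB g' (τ x) (fderiv ℝ τ x u) (fderiv ℝ τ x v)) :
    IsAffineOn g g' τ U U' := by
  refine ⟨hg, hg', hτ, hm, hi, fun x hx u v => ?_⟩
  have hinj : Function.Injective (fderiv ℝ τ x).toLinearMap := by
    rw [injective_iff_map_eq_zero]
    intro z hz
    have hz : fderiv ℝ τ x z = 0 := hz
    refine gB_nondeg (hg.nondeg x hx) fun w => ?_
    rw [hi x hx, hz, map_zero]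
  have hsurj := LinearMap.injective_iff_surjective.mp hinj
  rw [← sub_eq_zero]
  refine gB_nondeg (hg'.nondeg _ (hm hx)) fun w => ?_
  obtain ⟨w, rfl⟩ := hsurj w
  change gB g' (τ x) (fderiv ℝ τ x w) _ = 0
  rw [map_sub, gB_affine_of_isom hg hg' hτ hm hi hx, sub_self]

end

end

section

section Nemytskii

set_option linter.unusedSectionVars false

variable {E F W Y : Type} [NormedAddCommGroup E] [NormedSpace ℝ E]
  [NormedAddCommGroup F] [NormedSpace ℝ F]

/-- Pointwise application of a curve of operators to a curve of vectors. -/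
def applyCurve (E F : Type) [NormedAddCommGroup E] [NormedSpace ℝ E]
    [NormedAddCommGroup F] [NormedSpace ℝ F] :
    C(unitInterval, E →L[ℝ] F) →L[ℝ] C(unitInterval, E) →L[ℝ] C(unitInterval, F) :=
  LinearMap.mkContinuous₂
    (LinearMap.mk₂ ℝ (fun (A : C(unitInterval, E →L[ℝ] F)) (z : C(unitInterval, E)) =>
        (⟨fun t => A t (z t), A.continuous.clm_apply z.continuous⟩ : C(unitInterval, F)))
      (fun _ _ _ => by ext; simp) (fun _ _ _ => by ext; simp)
      (fun _ _ _ => by ext; simp) (fun _ _ _ => by ext; simp)) 1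
    (fun A z => by
      rw [one_mul, ContinuousMap.norm_le _ (by positivity)]
      intro t
      exact ((A t).le_opNorm _).trans (mul_le_mul (A.norm_coe_le_norm t) (z.norm_coe_le_norm t)
        (norm_nonneg _) (norm_nonneg A)))

@[simp] theorem applyCurve_apply (A : C(unitInterval, E →L[ℝ] F)) (z : C(unitInterval, E))
    (t : unitInterval) : applyCurve E F A z t = A t (z t) := rfl

/-- The superposition operator of a continuous map. -/
def superpose (f : E → F) (hf : Continuous f) (z : C(unitInterval, E)) : C(unitInterval, F) :=
  (⟨f, hf⟩ : C(E, F)).comp z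

theorem superpose_apply (f : E → F) (hf : Continuous f) (z : C(unitInterval, E))
    (t : unitInterval) : superpose f hf z t = f (z t) := rfl

theorem continuous_superpose (f : E → F) (hf : Continuous f) : Continuous (superpose f hf) :=
  ContinuousMap.continuous_postcomp _

theorem hasFDerivAt_superpose (f : E → F) (hf : ContDiff ℝ 1 f) (z : C(unitInterval, E)) :
    HasFDerivAt (superpose f hf.continuous)
      (applyCurve E F (superpose (fderiv ℝ f) (hf.continuous_fderiv one_ne_zero) z)) z := by
  rw [hasFDerivAt_iff_isLittleO_nhds_zero, Asymptotics.isLittleO_iff]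
  intro ε hε
  have hcont := hf.continuous_fderiv one_ne_zero
  obtain ⟨δ, hδ, hδ'⟩ : ∃ δ > 0, ∀ t : unitInterval, ∀ w, dist w (z t) < δ →
      dist (fderiv ℝ f w) (fderiv ℝ f (z t)) < ε := by
    obtain ⟨δ, hδ, h⟩ := Metric.mem_uniformity_dist.mp
      ((isCompact_range z.continuous).uniformContinuousAt_of_continuousAt (fderiv ℝ f)
        (fun _ _ => hcont.continuousAt) (Metric.dist_mem_uniformity hε))
    refine ⟨δ, hδ, fun t w hw => ?_⟩
    rw [dist_comm]
    rw [dist_comm] at hw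
    exact h hw (mem_range_self t)
  filter_upwards [Metric.ball_mem_nhds (0 : C(unitInterval, E)) hδ] with h hh
  rw [ContinuousMap.norm_le _ (by positivity)]
  intro t
  have hht : ‖h t‖ < δ := (h.norm_coe_le_norm t).trans_lt (by simpa using hh)
  have key := (convex_ball (z t) δ).norm_image_sub_le_of_norm_hasFDerivWithin_le'
    (f := f) (f' := fderiv ℝ f) (φ := fderiv ℝ f (z t)) (C := ε) (x := z t) (y := z t + h t)
    (fun x _ => ((hf.differentiable one_ne_zero) x).hasFDerivAt.hasFDerivWithinAt)
    (fun x hx => by simpa [dist_eq_norm] using (hδ' t x hx).le)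
    (Metric.mem_ball_self hδ) (by simpa using hht)
  rw [add_sub_cancel_left] at key
  simp only [ContinuousMap.sub_apply, superpose_apply, ContinuousMap.add_apply, applyCurve_apply]
  exact key.trans (by gcongr; exact h.norm_coe_le_norm t)

theorem contDiff_clm_apply_left {A B : Type*} [NormedAddCommGroup A] [NormedSpace ℝ A]
    [NormedAddCommGroup B] [NormedSpace ℝ B] (k : ℕ) (L : A →L[ℝ] B) :
    ContDiff ℝ k (fun a => L a) := L.contDiff

theorem contDiff_superpose_nat (k : ℕ) : ∀ (F : Type) [NormedAddCommGroup F] [NormedSpace ℝ F]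
    (f : E → F) (hf : ContDiff ℝ (⊤ : ℕ∞) f), ContDiff ℝ k (superpose f hf.continuous) := by
  induction k with
  | zero =>
    intro F _ _ f hf
    exact contDiff_zero.mpr (continuous_superpose f hf.continuous)
  | succ k ih =>
    intro F _ _ f hf
    have h1 : ContDiff ℝ 1 f := hf.of_le (by exact_mod_cast le_top)
    have h2 : ContDiff ℝ (⊤ : ℕ∞) (fderiv ℝ f) := hf.fderiv_right (by simp)
    push_cast
    rw [contDiff_succ_iff_hasFDerivAt]
    have h3 := contDiff_clm_apply_left (A := C(unitInterval, E →L[ℝ] F))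
      (B := C(unitInterval, E) →L[ℝ] C(unitInterval, F)) k (applyCurve E F)
    exact ⟨fun z => applyCurve E F (superpose (fderiv ℝ f) h2.continuous z),
      h3.comp (ih (E →L[ℝ] F) _ h2), fun z => hasFDerivAt_superpose f h1 z⟩

theorem contDiff_superpose (f : E → F) (hf : ContDiff ℝ (⊤ : ℕ∞) f) :
    ContDiff ℝ (⊤ : ℕ∞) (superpose f hf.continuous) :=
  contDiff_infty.mpr fun k => contDiff_superpose_nat k F f hf

end Nemytskii

section Integral

set_option linter.unusedSectionVars false

variable {W : Type} [NormedAddCommGroup W] [NormedSpace ℝ W] [CompleteSpace W]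

/-- The primitive of a curve on the unit interval, extended to the line. -/
def primitive (h : C(unitInterval, W)) (t : ℝ) : W :=
  ∫ s in (0 : ℝ)..t, IccExtend zero_le_one h s

theorem hasDerivAt_primitive (h : C(unitInterval, W)) (t : ℝ) :
    HasDerivAt (primitive h) (IccExtend zero_le_one h t) t :=
  (h.continuous.Icc_extend' (h := zero_le_one)).integral_hasStrictDerivAt 0 t |>.hasDerivAt

theorem norm_primitive_le (h : C(unitInterval, W)) (t : unitInterval) :
    ‖primitive h t‖ ≤ ‖h‖ := by
  have := intervalIntegral.norm_integral_le_of_norm_le_const (a := (0 : ℝ)) (b := t)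
    (f := IccExtend zero_le_one h) (C := ‖h‖) (fun s _ => h.norm_coe_le_norm _)
  refine this.trans ?_
  rw [sub_zero, abs_of_nonneg t.2.1]
  exact mul_le_of_le_one_right (norm_nonneg _) t.2.2

theorem continuous_IccExtend (h : C(unitInterval, W)) :
    Continuous (IccExtend (zero_le_one (α := ℝ)) h) :=
  h.continuous.Icc_extend'

/-- Integration from `0` as an operator on curves. -/
def primitiveCLM (W : Type) [NormedAddCommGroup W] [NormedSpace ℝ W] [CompleteSpace W] :
    C(unitInterval, W) →L[ℝ] C(unitInterval, W) :=
  LinearMap.mkContinuous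
    { toFun := fun h => ⟨fun t => primitive h t,
        (continuous_iff_continuousAt.mpr fun t =>
          (hasDerivAt_primitive h t).continuousAt).comp continuous_subtype_val⟩
      map_add' := fun h k => by
        ext t
        exact intervalIntegral.integral_add ((continuous_IccExtend h).intervalIntegrable _ _)
          ((continuous_IccExtend k).intervalIntegrable _ _)
      map_smul' := fun c h => by
        ext t
        exact intervalIntegral.integral_smul c _ } 1
    (fun h => by
      rw [one_mul, ContinuousMap.norm_le _ (norm_nonneg _)]
      exact norm_primitive_le h)

end Integral

end

section

section Flow

set_option linter.unusedSectionVars false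

variable {W Y : Type} [NormedAddCommGroup W] [NormedSpace ℝ W] [CompleteSpace W]
  [NormedAddCommGroup Y] [NormedSpace ℝ Y] [CompleteSpace Y]

/-- Adjoin a constant parameter to a curve. -/
def paramCurve (Y W : Type) [NormedAddCommGroup W] [NormedSpace ℝ W]
    [NormedAddCommGroup Y] [NormedSpace ℝ Y] :
    Y × C(unitInterval, W) →L[ℝ] C(unitInterval, Y × W) :=
  LinearMap.mkContinuous
    { toFun := fun p => ⟨fun t => (p.1, p.2 t), by fun_prop⟩
      map_add' := fun _ _ => rfl
      map_smul' := fun _ _ => rfl } 1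
    (fun p => by
      rw [one_mul, ContinuousMap.norm_le _ (norm_nonneg _)]
      intro t
      exact max_le_max le_rfl (p.2.norm_coe_le_norm t))

@[simp] theorem paramCurve_apply (p : Y × C(unitInterval, W)) (t : unitInterval) :
    paramCurve Y W p t = (p.1, p.2 t) := rfl

/-- Evaluation of curves at a point. -/
def evalCurve (W : Type) [NormedAddCommGroup W] [NormedSpace ℝ W] (t : unitInterval) :
    C(unitInterval, W) →L[ℝ] W :=
  LinearMap.mkContinuous
    { toFun := fun h => h t
      map_add' := fun _ _ => rfl
      map_smul' := fun _ _ => rfl } 1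
    (fun h => by rw [one_mul]; exact h.norm_coe_le_norm t)

/-- The right-hand side of the integral equation. -/
def integralOp (f : Y × W → W) (hf : ContDiff ℝ (⊤ : ℕ∞) f) (p : Y × C(unitInterval, W)) :
    C(unitInterval, W) :=
  primitiveCLM W (superpose f hf.continuous (paramCurve Y W p))

theorem contDiff_integralOp (f : Y × W → W) (hf : ContDiff ℝ (⊤ : ℕ∞) f) :
    ContDiff ℝ (⊤ : ℕ∞) (integralOp f hf) :=
  ContDiff.comp (g := fun h => primitiveCLM W h) (primitiveCLM W).contDiff
    ((contDiff_superpose f hf).comp (paramCurve Y W).contDiff)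

/-- The linearisation of `integralOp`. -/
def integralOpDeriv (f : Y × W → W) (hf : ContDiff ℝ (⊤ : ℕ∞) f) (p : Y × C(unitInterval, W)) :
    Y × C(unitInterval, W) →L[ℝ] C(unitInterval, W) :=
  (primitiveCLM W).comp ((applyCurve (Y × W) W
    (superpose (fderiv ℝ f) (hf.continuous_fderiv (by simp)) (paramCurve Y W p))).comp
      (paramCurve Y W))

theorem hasFDerivAt_integralOp (f : Y × W → W) (hf : ContDiff ℝ (⊤ : ℕ∞) f)
    (p : Y × C(unitInterval, W)) : HasFDerivAt (integralOp f hf) (integralOpDeriv f hf p) p :=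
  (primitiveCLM W).hasFDerivAt.comp p
    ((hasFDerivAt_superpose f (hf.of_le (by exact_mod_cast le_top)) _).comp p
      (paramCurve Y W).hasFDerivAt)

/-- A shear of a product space. -/
def shear {A B : Type} [NormedAddCommGroup A] [NormedSpace ℝ A] [NormedAddCommGroup B]
    [NormedSpace ℝ B] (L : A →L[ℝ] B) : (A × B) ≃L[ℝ] A × B :=
  ContinuousLinearEquiv.equivOfInverse
    ((ContinuousLinearMap.fst ℝ A B).prod
      (ContinuousLinearMap.snd ℝ A B - L.comp (ContinuousLinearMap.fst ℝ A B)))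
    ((ContinuousLinearMap.fst ℝ A B).prod
      (ContinuousLinearMap.snd ℝ A B + L.comp (ContinuousLinearMap.fst ℝ A B)))
    (fun p => by simp) (fun p => by simp)

theorem exists_inverse_curve {A B : Type} [NormedAddCommGroup A] [NormedSpace ℝ A]
    [NormedAddCommGroup B] [NormedSpace ℝ B] [CompleteSpace A] [CompleteSpace B]
    (f : A × B → B) (hf : ContDiff ℝ (⊤ : ℕ∞) f) (b : B) (h0 : f (0, b) = b)
    (hd : ∀ k, fderiv ℝ f (0, b) (0, k) = 0) {N : Set B} (hN : N ∈ nhds b) :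
    ∃ r > 0, ∃ z : A → B, ContDiffOn ℝ (⊤ : ℕ∞) z (Metric.ball 0 r) ∧
      ∀ y ∈ Metric.ball (0 : A) r, f (y, z y) = z y ∧ z y ∈ N := by
  let Ψ : A × B → A × B := fun p => (p.1, p.2 - f p)
  have hΨ : ContDiff ℝ (⊤ : ℕ∞) Ψ := contDiff_fst.prodMk (contDiff_snd.sub hf)
  have hdiff : Differentiable ℝ f := hf.differentiable (by simp)
  let L : A →L[ℝ] B := (fderiv ℝ f (0, b)).comp (ContinuousLinearMap.inl ℝ A B)
  have hΨ' : HasFDerivAt Ψ ((shear L : (A × B) ≃L[ℝ] A × B) : A × B →L[ℝ] A × B) (0, b) := by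
    refine (hasFDerivAt_fst.prodMk (hasFDerivAt_snd.sub (hdiff (0, b)).hasFDerivAt)).congr_fderiv ?_
    refine ContinuousLinearMap.ext fun p => ?_
    have : fderiv ℝ f (0, b) p = fderiv ℝ f (0, b) (p.1, 0) := by
      have h1 : p = (p.1, 0) + (0, p.2) := by simp
      conv_lhs => rw [h1, map_add, hd, add_zero]
    simp [shear, L, this]
  have hΨa : ContDiffAt ℝ (⊤ : ℕ∞) Ψ (0, b) := hΨ.contDiffAt
  let H := hΨa.toOpenPartialHomeomorph Ψ hΨ' (by simp)
  have hHc : (H : A × B → A × B) = Ψ := hΨa.toOpenPartialHomeomorph_coe hΨ' (by simp)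
  have hsrc : (0, b) ∈ H.source := hΨa.mem_toOpenPartialHomeomorph_source hΨ' (by simp)
  have hb0 : H (0, b) = ((0 : A), (0 : B)) := by rw [hHc]; simp [Ψ, h0]
  have htgt : ((0 : A), (0 : B)) ∈ H.target := hb0 ▸ H.map_source hsrc
  have hsym0 : H.symm (0, 0) = (0, b) := by rw [← hb0, H.left_inv hsrc]
  have hcs : ContinuousAt H.symm ((0 : A), (0 : B)) := H.continuousAt_symm htgt
  have hinv : ∀ᶠ q in nhds ((0 : A), (0 : B)),
      fderiv ℝ Ψ (H.symm q) ∈ range ((↑) : ((A × B) ≃L[ℝ] A × B) → A × B →L[ℝ] A × B) := by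
    have hc : ContinuousAt (fun q => fderiv ℝ Ψ (H.symm q)) ((0 : A), (0 : B)) :=
      ContinuousAt.comp (g := fderiv ℝ Ψ) (hΨ.continuous_fderiv (by simp)).continuousAt hcs
    refine hc.eventually_mem ?_
    rw [hsym0, hΨ'.fderiv]
    exact ContinuousLinearEquiv.nhds _
  have hNe : ∀ᶠ q in nhds ((0 : A), (0 : B)), (H.symm q).2 ∈ N := by
    have hc : ContinuousAt (fun q => (H.symm q).2) ((0 : A), (0 : B)) := hcs.snd
    refine hc.eventually_mem ?_
    rwa [hsym0]
  have hall := (hinv.and hNe).and (H.open_target.mem_nhds htgt)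
  have hy : Filter.Tendsto (fun y : A => (y, (0 : B))) (nhds 0) (nhds (0, 0)) :=
    (continuous_id.prodMk continuous_const).tendsto' _ _ rfl
  obtain ⟨r, hr, hr'⟩ := Metric.eventually_nhds_iff_ball.mp (hy.eventually hall)
  refine ⟨r, hr, fun y => (H.symm (y, 0)).2, fun y hyr => ?_, fun y hyr => ?_⟩
  · obtain ⟨⟨⟨e, he⟩, -⟩, hT⟩ := hr' y hyr
    have hsm : ContDiffAt ℝ (⊤ : ℕ∞) H.symm (y, 0) := by
      refine H.contDiffAt_symm hT (f₀' := e) ?_ ?_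
      · rw [hHc, he]
        exact ((hΨ.differentiable (by simp)) _).hasFDerivAt
      · rw [hHc]; exact hΨ.contDiffAt
    exact (hsm.comp y (contDiffAt_id.prodMk contDiffAt_const)).snd.contDiffWithinAt
  · obtain ⟨⟨-, hn⟩, hT⟩ := hr' y hyr
    refine ⟨?_, hn⟩
    have h1 : Ψ (H.symm (y, 0)) = (y, 0) := by rw [← hHc]; exact H.right_inv hT
    have h2 : (H.symm (y, 0)).1 = y := congrArg Prod.fst h1
    have h3 : (H.symm (y, 0)).2 - f (H.symm (y, 0)) = 0 := congrArg Prod.snd h1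
    have h4 : (y, (H.symm (y, 0)).2) = H.symm (y, 0) := Prod.ext h2.symm rfl
    rw [h4]
    exact (sub_eq_zero.mp h3).symm

/-- Smooth dependence on parameters: solutions of `z' = f (y, z)` on the unit interval, near
a parameter where `f` vanishes identically. -/
theorem exists_param_flow (f : Y × W → W) (hf : ContDiff ℝ (⊤ : ℕ∞) f) (h0 : ∀ w, f (0, w) = 0)
    (w₀ : W) {N : Set W} (hN : N ∈ nhds w₀) :
    ∃ r > 0, ∃ z : Y → ℝ → W, ∃ δ : Y → Y → ℝ → W,
      ContDiffOn ℝ (⊤ : ℕ∞) (fun y => z y 1) (Metric.ball 0 r) ∧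
      ∀ y ∈ Metric.ball (0 : Y) r, z y 0 = w₀ ∧
        (∀ t ∈ Icc (0 : ℝ) 1, z y t ∈ N ∧ HasDerivAt (z y) (f (y, z y t)) t) ∧
        ∀ w, fderiv ℝ (fun y => z y 1) y w = δ y w 1 ∧ δ y w 0 = 0 ∧
          ∀ t ∈ Icc (0 : ℝ) 1, HasDerivAt (δ y w) (fderiv ℝ f (y, z y t) (w, δ y w t)) t := by
  let c₀ : C(unitInterval, W) := ContinuousMap.const _ w₀
  let G : Y × C(unitInterval, W) → C(unitInterval, W) := fun p => c₀ + integralOp f hf p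
  have hG : ContDiff ℝ (⊤ : ℕ∞) G := contDiff_const.add (contDiff_integralOp f hf)
  have hG' : ∀ p, HasFDerivAt G (integralOpDeriv f hf p) p := fun p =>
    (hasFDerivAt_integralOp f hf p).const_add c₀
  have hprim0 : ∀ h : C(unitInterval, W), primitive h 0 = 0 := fun h =>
    intervalIntegral.integral_same
  obtain ⟨ε, hε, hεN⟩ := Metric.mem_nhds_iff.mp hN
  obtain ⟨r, hr, ζ, hζ, hζ'⟩ := exists_inverse_curve G hG c₀
    (by
      ext t
      have : superpose f hf.continuous (paramCurve Y W (0, c₀)) = 0 := by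
        ext s; simp [superpose_apply, h0]
      simp [G, integralOp, this])
    (by
      intro k
      rw [(hG' _).fderiv]
      have h1 : ∀ w k : W, fderiv ℝ f (0, w) (0, k) = 0 := by
        intro w k
        have h2 : HasFDerivAt (fun w : W => f (0, w))
            ((fderiv ℝ f (0, w)).comp (ContinuousLinearMap.inr ℝ Y W)) w :=
          ((hf.differentiable (by simp)) (0, w)).hasFDerivAt.comp w (hasFDerivAt_prodMk_right 0 w)
        have h3 : HasFDerivAt (fun w : W => f (0, w)) (0 : W →L[ℝ] W) w := by
          simp only [h0]; exact hasFDerivAt_const _ _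
        simpa using congrArg (fun L => L k) (h2.unique h3)
      have : applyCurve (Y × W) W (superpose (fderiv ℝ f) (hf.continuous_fderiv (by simp))
          (paramCurve Y W (0, c₀))) (paramCurve Y W (0, k)) = 0 := by
        ext s; simp [superpose_apply, h1]
      simp [integralOpDeriv, this])
    (Metric.ball_mem_nhds c₀ hε)
  have hext : ∀ y ∈ Metric.ball (0 : Y) r, ∀ t : unitInterval,
      w₀ + primitive (superpose f hf.continuous (paramCurve Y W (y, ζ y))) t = ζ y t := by
    intro y hy t
    conv_rhs => rw [← (hζ' y hy).1]
    rfl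
  have hζd : ∀ y ∈ Metric.ball (0 : Y) r, HasFDerivAt ζ (fderiv ℝ ζ y) y := fun y hy =>
    ((hζ.contDiffAt (Metric.isOpen_ball.mem_nhds hy)).differentiableAt (by simp)).hasFDerivAt
  have hζlin : ∀ y ∈ Metric.ball (0 : Y) r, ∀ w,
      integralOpDeriv f hf (y, ζ y) (w, fderiv ℝ ζ y w) = fderiv ℝ ζ y w := by
    intro y hy w
    have h1 : HasFDerivAt (fun y => G (y, ζ y)) ((integralOpDeriv f hf (y, ζ y)).comp
        ((ContinuousLinearMap.id ℝ Y).prod (fderiv ℝ ζ y))) y :=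
      (hG' (y, ζ y)).comp y ((hasFDerivAt_id y).prodMk (hζd y hy))
    have h2 : (fun y => G (y, ζ y)) =ᶠ[nhds y] ζ := by
      filter_upwards [Metric.isOpen_ball.mem_nhds hy] with y' hy' using (hζ' y' hy').1
    simpa using congrArg (fun L => L w) (h1.unique ((hζd y hy).congr_of_eventuallyEq h2))
  let δ : Y → Y → ℝ → W := fun y w => primitive (applyCurve (Y × W) W
    (superpose (fderiv ℝ f) (hf.continuous_fderiv (by simp)) (paramCurve Y W (y, ζ y)))
    (paramCurve Y W (w, fderiv ℝ ζ y w)))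
  have hδ : ∀ y ∈ Metric.ball (0 : Y) r, ∀ w, ∀ t : unitInterval,
      δ y w t = fderiv ℝ ζ y w t := by
    intro y hy w t
    conv_rhs => rw [← hζlin y hy w]
    rfl
  have hz1 : ∀ y ∈ Metric.ball (0 : Y) r,
      w₀ + primitive (superpose f hf.continuous (paramCurve Y W (y, ζ y))) 1
        = evalCurve W 1 (ζ y) := fun y hy => hext y hy 1
  refine ⟨r, hr, fun y t => w₀ + primitive (superpose f hf.continuous (paramCurve Y W (y, ζ y))) t,
    δ, ?_, fun y hy => ⟨by simp [hprim0], fun t ht => ⟨?_, ?_⟩, fun w => ⟨?_, hprim0 _, ?_⟩⟩⟩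
  · exact ((evalCurve W 1).contDiff.comp_contDiffOn hζ).congr hz1
  · have h1 := hext y hy ⟨t, ht⟩
    change w₀ + primitive _ t = _ at h1
    change w₀ + primitive _ t ∈ N
    rw [h1]
    refine hεN ?_
    have := (hζ' y hy).2
    rw [Metric.mem_ball, dist_eq_norm] at this ⊢
    exact ((ζ y - c₀).norm_coe_le_norm ⟨t, ht⟩).trans_lt this
  · refine ((hasDerivAt_primitive _ t).const_add w₀).congr_deriv ?_
    rw [IccExtend_of_mem _ _ ht, superpose_apply, paramCurve_apply, ← hext y hy]
  · rw [show δ y w 1 = fderiv ℝ ζ y w 1 from hδ y hy w 1]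
    have h2 : (fun y => w₀ + primitive (superpose f hf.continuous (paramCurve Y W (y, ζ y))) 1)
        =ᶠ[nhds y] fun y => evalCurve W 1 (ζ y) := by
      filter_upwards [Metric.isOpen_ball.mem_nhds hy] with y' hy' using hz1 y' hy'
    have h3 := (((evalCurve W 1).hasFDerivAt.comp y (hζd y hy)).congr_of_eventuallyEq h2).fderiv
    exact (congrArg (fun L => L w) h3).trans rfl
  · intro t ht
    refine (hasDerivAt_primitive _ t).congr_deriv ?_
    rw [IccExtend_of_mem _ _ ht, applyCurve_apply, superpose_apply, paramCurve_apply,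
      paramCurve_apply]
    have h1 := hext y hy ⟨t, ht⟩
    have h2 := hδ y hy w ⟨t, ht⟩
    change w₀ + primitive _ t = _ at h1
    change δ y w t = _ at h2
    change _ = fderiv ℝ f (y, w₀ + primitive _ t) (w, δ y w t)
    rw [h1, h2]

end Flow

end

section

section FrameFlow

/-- A smooth map on an open set agrees near each point with a globally smooth map. -/
theorem exists_contDiff_eventuallyEq {E F : Type*} [NormedAddCommGroup E] [NormedSpace ℝ E]
    [FiniteDimensional ℝ E] [NormedAddCommGroup F] [NormedSpace ℝ F] {f : E → F} {U : Set E}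
    (hU : IsOpen U) (hf : ContDiffOn ℝ (⊤ : ℕ∞) f U) {x : E} (hx : x ∈ U) :
    ∃ f' : E → F, ContDiff ℝ (⊤ : ℕ∞) f' ∧ f' =ᶠ[nhds x] f := by
  obtain ⟨ε, hε, hεU⟩ := Metric.isOpen_iff.mp hU x hx
  let b : ContDiffBump x := ⟨ε / 4, ε / 2, by positivity, by linarith⟩
  refine ⟨fun y => b y • f y, contDiff_iff_contDiffAt.mpr fun y => ?_, ?_⟩
  · by_cases hy : y ∈ Metric.ball x ε
    · exact b.contDiffAt.smul (hf.contDiffAt (hU.mem_nhds (hεU hy)))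
    · have hy' : y ∈ (Metric.closedBall x (ε / 2))ᶜ := by
        simp only [Metric.mem_ball, mem_compl_iff, Metric.mem_closedBall] at hy ⊢
        linarith
      refine (contDiffAt_const (c := (0 : F))).congr_of_eventuallyEq ?_
      filter_upwards [Metric.isClosed_closedBall.isOpen_compl.mem_nhds hy'] with z hz
      rw [b.zero_of_le_dist, zero_smul]
      simp only [mem_compl_iff, Metric.mem_closedBall] at hz
      exact (not_le.mp hz).le
  · filter_upwards [b.eventuallyEq_one] with y hy
    simp [hy]

variable {E : Type} [NormedAddCommGroup E] [NormedSpace ℝ E]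

/-- The vector field of the geodesic and parallel frame equations. The curve has velocity
`P y`, where `P` is the parallel frame and `y` a parameter. -/
def frameField (Γ : E → E →L[ℝ] E →L[ℝ] E) (p : E × E × (E →L[ℝ] E)) : E × (E →L[ℝ] E) :=
  (p.2.2 p.1, -((Γ p.2.1 (p.2.2 p.1)).comp p.2.2))

theorem contDiff_frameField {Γ : E → E →L[ℝ] E →L[ℝ] E} (hΓ : ContDiff ℝ (⊤ : ℕ∞) Γ) :
    ContDiff ℝ (⊤ : ℕ∞) (frameField Γ) := by
  have h1 : ContDiff ℝ (⊤ : ℕ∞) fun p : E × E × (E →L[ℝ] E) => p.2.2 p.1 :=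
    (contDiff_snd.comp contDiff_snd).clm_apply contDiff_fst
  exact h1.prodMk (((hΓ.comp (contDiff_fst.comp contDiff_snd)).clm_apply h1).clm_comp
    (contDiff_snd.comp contDiff_snd)).neg

theorem fderiv_frameField {Γ : E → E →L[ℝ] E →L[ℝ] E} (hΓ : ContDiff ℝ (⊤ : ℕ∞) Γ)
    (y c : E) (P : E →L[ℝ] E) (w J : E) (Q : E →L[ℝ] E) :
    fderiv ℝ (frameField Γ) (y, c, P) (w, J, Q) =
      (P w + Q y, -((fderiv ℝ Γ c J (P y)).comp P + (Γ c (P w + Q y)).comp P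
        + (Γ c (P y)).comp Q)) := by
  have hy : HasDerivAt (fun t : ℝ => y + t • w) w 0 := by
    simpa using ((hasDerivAt_id (0 : ℝ)).smul_const w).const_add y
  have hc : HasDerivAt (fun t : ℝ => c + t • J) J 0 := by
    simpa using ((hasDerivAt_id (0 : ℝ)).smul_const J).const_add c
  have hP : HasDerivAt (fun t : ℝ => P + t • Q) Q 0 := by
    simpa using ((hasDerivAt_id (0 : ℝ)).smul_const Q).const_add P
  have hline : HasDerivAt (fun t : ℝ => (y + t • w, c + t • J, P + t • Q)) (w, J, Q) 0 :=
    hy.prodMk (hc.prodMk hP)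
  have h1 : HasDerivAt (fun t : ℝ => frameField Γ (y + t • w, c + t • J, P + t • Q))
      (fderiv ℝ (frameField Γ) (y, c, P) (w, J, Q)) 0 := by
    have h := ((contDiff_frameField hΓ).differentiable (by simp) (y, c, P)).hasFDerivAt
    exact h.comp_hasDerivAt_of_eq (0 : ℝ) hline (by simp)
  have h2 : HasDerivAt (fun t : ℝ => (P + t • Q) (y + t • w)) (P w + Q y) 0 := by
    refine (hP.clm_apply hy).congr_deriv ?_
    simp [add_comm]
  have h3 : HasDerivAt (fun t : ℝ => Γ (c + t • J)) (fderiv ℝ Γ c J) 0 := by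
    exact HasFDerivAt.comp_hasDerivAt_of_eq (F := E) (E := E →L[ℝ] E →L[ℝ] E) (0 : ℝ)
      (hΓ.differentiable (by simp) c).hasFDerivAt hc (by simp)
  have h4 := ((h3.clm_apply h2).clm_comp hP).neg
  refine h1.unique ((h2.prodMk h4).congr_deriv ?_)
  simp

theorem exists_frame_flow [FiniteDimensional ℝ E] {Γ : E → E →L[ℝ] E →L[ℝ] E} {U : Set E}
    (hU : IsOpen U) (hΓ : ContDiffOn ℝ (⊤ : ℕ∞) Γ U) {x : E} (hx : x ∈ U) (F : E →L[ℝ] E) :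
    ∃ r > 0, ∃ (c : E → ℝ → E) (P : E → ℝ → E →L[ℝ] E) (J : E → E → ℝ → E)
      (Q : E → E → ℝ → E →L[ℝ] E),
      ContDiffOn ℝ (⊤ : ℕ∞) (fun y => c y 1) (Metric.ball 0 r) ∧
      ∀ y ∈ Metric.ball (0 : E) r, c y 0 = x ∧ P y 0 = F ∧
        (∀ t ∈ Icc (0 : ℝ) 1, c y t ∈ U ∧ HasDerivAt (c y) (P y t y) t ∧
          HasDerivAt (P y) (-((Γ (c y t) (P y t y)).comp (P y t))) t) ∧
        ∀ w, fderiv ℝ (fun y => c y 1) y w = J y w 1 ∧ J y w 0 = 0 ∧ Q y w 0 = 0 ∧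
          ∀ t ∈ Icc (0 : ℝ) 1, HasDerivAt (J y w) (P y t w + Q y w t y) t ∧
            HasDerivAt (Q y w) (-((fderiv ℝ Γ (c y t) (J y w t) (P y t y)).comp (P y t)
              + (Γ (c y t) (P y t w + Q y w t y)).comp (P y t)
              + (Γ (c y t) (P y t y)).comp (Q y w t))) t := by
  have : CompleteSpace E := FiniteDimensional.complete ℝ E
  obtain ⟨Γ', hΓ', hag⟩ := exists_contDiff_eventuallyEq hU hΓ hx
  obtain ⟨N, hN, hNo, hxN⟩ := eventually_nhds_iff.mp (hag.and (hU.mem_nhds hx))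
  have hval : ∀ y ∈ N, Γ' y = Γ y := fun y hy => (hN y hy).1
  have hder : ∀ y ∈ N, fderiv ℝ Γ' y = fderiv ℝ Γ y := fun y hy =>
    Filter.EventuallyEq.fderiv_eq (by filter_upwards [hNo.mem_nhds hy] with z hz using hval z hz)
  obtain ⟨r, hr, z, δ, hsm, hz⟩ := exists_param_flow (W := E × (E →L[ℝ] E)) (Y := E) (frameField Γ')
    (contDiff_frameField hΓ') (fun w => by simp [frameField]) (x, F)
    (N := N ×ˢ univ) (prod_mem_nhds (hNo.mem_nhds hxN) Filter.univ_mem)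
  refine ⟨r, hr, fun y t => (z y t).1, fun y t => (z y t).2, fun y w t => (δ y w t).1,
    fun y w t => (δ y w t).2, contDiff_fst.comp_contDiffOn hsm, fun y hy => ?_⟩
  obtain ⟨h0, hcur, hδ⟩ := hz y hy
  refine ⟨by simp [h0], by simp [h0], fun t ht => ?_, fun w => ?_⟩
  · obtain ⟨hm, hd⟩ := hcur t ht
    have hm' : (z y t).1 ∈ N := hm.1
    rw [← hval _ hm']
    exact ⟨(hN _ hm').2, hd.fst, hd.snd⟩
  · obtain ⟨hf, hδ0, hδ'⟩ := hδ w
    refine ⟨?_, by simp [hδ0], by simp [hδ0], fun t ht => ?_⟩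
    · change fderiv ℝ (fun y => (z y 1).1) y w = (δ y w 1).1
      rw [← hf]
      have hd : DifferentiableAt ℝ (fun y => z y 1) y :=
        (hsm.contDiffAt (Metric.isOpen_ball.mem_nhds hy)).differentiableAt (by simp)
      have h1 : HasFDerivAt (fun y => (z y 1).1)
        ((ContinuousLinearMap.fst ℝ E (E →L[ℝ] E)).comp (fderiv ℝ (fun y => z y 1) y)) y :=
        hd.hasFDerivAt.fst
      rw [h1.fderiv]
      rfl
    · have hm' : (z y t).1 ∈ N := (hcur t ht).1.1
      have h1 := hδ' t ht
      rw [show (y, z y t) = (y, (z y t).1, (z y t).2) from rfl,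
        show (w, δ y w t) = (w, (δ y w t).1, (δ y w t).2) from rfl,
        fderiv_frameField hΓ', hval _ hm', hder _ hm'] at h1
      exact ⟨h1.fst, h1.snd⟩

end FrameFlow

end

section

variable {n m s : ℕ}

section Jacobi

variable {G : (Fin n → ℝ) →ₗ[ℝ] (Fin n → ℝ) →ₗ[ℝ] ℝ}

theorem exists_represent (hs : ∀ u v, G u v = G v u) (hG : ∀ v, (∀ w, G w v = 0) → v = 0)
    (l : (Fin n → ℝ) →ₗ[ℝ] ℝ) : ∃ e, ∀ v, G v e = l v := by
  have hinj : Function.Injective G := (injective_iff_map_eq_zero G).mpr fun u hu =>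
    hG u fun w => by rw [hs, hu]; rfl
  have hsurj := (LinearMap.injective_iff_surjective_of_finrank_eq_finrank
    (Subspace.dual_finrank_eq (K := ℝ) (V := Fin n → ℝ)).symm).mp hinj
  obtain ⟨e, he⟩ := hsurj l
  exact ⟨e, fun v => by rw [hs, he]⟩

theorem exists_dual_basis (hs : ∀ u v, G u v = G v u) (hG : ∀ v, (∀ w, G w v = 0) → v = 0) :
    ∃ b : Fin n → Fin n → ℝ, ∀ i v, G (b i) v = v i := by
  choose b hb using fun i : Fin n => exists_represent hs hG (LinearMap.proj i)
  exact ⟨b, fun i v => by rw [hs, hb]; rfl⟩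

/-- The Jacobi equation along the ray with direction `y`, in a parallel frame in which the
metric `G` and the covariant derivative `T` of the curvature are constant, and the curvature
is `R + t T (y)`. The initial data are `0` and `w`. -/
def IsJacobi (G : (Fin n → ℝ) →ₗ[ℝ] (Fin n → ℝ) →ₗ[ℝ] ℝ)
    (R : (Fin n → ℝ) → (Fin n → ℝ) → (Fin n → ℝ) → (Fin n → ℝ) → ℝ)
    (T : (Fin n → ℝ) → (Fin n → ℝ) → (Fin n → ℝ) → (Fin n → ℝ) → (Fin n → ℝ) → ℝ)
    (y w : Fin n → ℝ) (E : ℝ → Fin n → ℝ) : Prop :=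
  E 0 = 0 ∧ ∃ L : ℝ → Fin n → ℝ, L 0 = w ∧ ∀ t ∈ Icc (0 : ℝ) 1, HasDerivAt E (L t) t ∧
    ∃ l, HasDerivAt L l t ∧ ∀ a, G a l = R a y y (E t) + t * T y a y y (E t)

variable {R : (Fin n → ℝ) → (Fin n → ℝ) → (Fin n → ℝ) → (Fin n → ℝ) → ℝ}
  {T : (Fin n → ℝ) → (Fin n → ℝ) → (Fin n → ℝ) → (Fin n → ℝ) → (Fin n → ℝ) → ℝ}

theorem exists_bound_isLinearMap {f : (Fin n → ℝ) → ℝ} (hf : IsLinearMap ℝ f) :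
    ∃ C, 0 ≤ C ∧ ∀ v, |f v| ≤ C * ‖v‖ := by
  let L : (Fin n → ℝ) →L[ℝ] ℝ := LinearMap.toContinuousLinearMap (IsLinearMap.mk' f hf)
  exact ⟨‖L‖, norm_nonneg _, fun v => L.le_opNorm v⟩

theorem IsJacobi.eq (hs : ∀ u v, G u v = G v u) (hG : ∀ v, (∀ w, G w v = 0) → v = 0)
    {y w : Fin n → ℝ} (hR : ∀ a, IsLinearMap ℝ (R a y y)) (hT : ∀ a, IsLinearMap ℝ (T y a y y))
    {E E' : ℝ → Fin n → ℝ} (h : IsJacobi G R T y w E) (h' : IsJacobi G R T y w E') :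
    E 1 = E' 1 := by
  obtain ⟨h0, L, hL0, hd⟩ := h
  obtain ⟨h0', L', hL0', hd'⟩ := h'
  choose! hE l hl hGl using hd
  choose! hE' l' hl' hGl' using hd'
  obtain ⟨b, hb⟩ := exists_dual_basis hs hG
  choose C hC0 hC using fun i => exists_bound_isLinearMap (hR (b i))
  choose D hD0 hD using fun i => exists_bound_isLinearMap (hT (b i))
  let K := 1 + ∑ i, (C i + D i)
  have hCD : ∀ i ∈ Finset.univ, 0 ≤ C i + D i := fun i _ => add_nonneg (hC0 i) (hD0 i)
  have hsum : 0 ≤ ∑ i, (C i + D i) := Finset.sum_nonneg hCD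
  have key := eq_zero_of_abs_deriv_le_mul_abs_self_of_eq_zero_right
    (f := fun t => (E t - E' t, L t - L' t)) (f' := fun t => (L t - L' t, l t - l' t))
    (K := K) (a := 0) (b := 1)
    (fun t ht => (((hE t ht).sub (hE' t ht)).prodMk
      ((hl t ht).sub (hl' t ht))).continuousAt.continuousWithinAt)
    (fun t ht => (((hE t (Ico_subset_Icc_self ht)).sub (hE' t (Ico_subset_Icc_self ht))).prodMk
      ((hl t (Ico_subset_Icc_self ht)).sub
        (hl' t (Ico_subset_Icc_self ht)))).hasDerivWithinAt)
    (by simp [h0, h0', hL0, hL0']) ?_ 1 (right_mem_Icc.mpr zero_le_one)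
  · exact sub_eq_zero.mp (Prod.ext_iff.mp key).1
  · intro t ht
    have htc := Ico_subset_Icc_self ht
    set e := E t - E' t with he
    set k := L t - L' t with hk
    have he_le : ‖e‖ ≤ ‖(e, k)‖ := norm_fst_le (e, k)
    have hk_le : ‖k‖ ≤ ‖(e, k)‖ := norm_snd_le (e, k)
    have hn := norm_nonneg (e, k)
    rw [Prod.norm_def]
    refine max_le ?_ ?_
    · change ‖k‖ ≤ _
      nlinarith
    · change ‖l t - l' t‖ ≤ _
      refine (pi_norm_le_iff_of_nonneg (by positivity)).mpr fun i => ?_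
      have h1 : (l t - l' t) i = R (b i) y y e + t * T y (b i) y y e := by
        rw [Pi.sub_apply, ← hb i (l t), ← hb i (l' t), hGl t htc, hGl' t htc, he, (hR (b i)).map_sub,
          (hT (b i)).map_sub]
        ring
      rw [h1, Real.norm_eq_abs]
      have h2 : |t * T y (b i) y y e| ≤ D i * ‖e‖ := by
        rw [abs_mul, abs_of_nonneg ht.1]
        have := hD i e
        have := abs_nonneg (T y (b i) y y e)
        nlinarith [ht.2]
      have h3 := Finset.single_le_sum hCD (Finset.mem_univ i)
      calc _ ≤ C i * ‖e‖ + D i * ‖e‖ := (abs_add_le _ _).trans (add_le_add (hC i e) h2)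
        _ = (C i + D i) * ‖e‖ := by ring
        _ ≤ K * ‖(e, k)‖ := mul_le_mul (by linarith) he_le (norm_nonneg _) (by positivity)

theorem isJacobi_zero (hG0 : ∀ a, R a 0 0 = 0) (hT0 : ∀ a, T 0 a 0 0 = 0) (w : Fin n → ℝ) :
    IsJacobi G R T 0 w (fun t => t • w) :=
  ⟨by simp, fun _ => w, rfl, fun t _ => ⟨by simpa using (hasDerivAt_id t).smul_const w,
    0, hasDerivAt_const _ _, fun a => by simp [hG0, hT0]⟩⟩

end Jacobi

section Transport

variable {g : MetricMat n} {U : Set (Fin n → ℝ)}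

theorem hasDerivAt_gB_transport (hg : IsMetricOn g U) {c u v : ℝ → Fin n → ℝ}
    {c' u' v' : Fin n → ℝ} {t : ℝ} (hct : c t ∈ U) (hc : HasDerivAt c c' t)
    (hu : HasDerivAt u (-Gm g (c t) c' (u t) + u') t)
    (hv : HasDerivAt v (-Gm g (c t) c' (v t) + v') t) :
    HasDerivAt (fun τ => gB g (c τ) (u τ) (v τ))
      (gB g (c t) u' (v t) + gB g (c t) (u t) v') t := by
  have h := hasDerivAt_ev (T := gT g) (c := c) (v := ![u, v])
    (v' := ![-Gm g (c t) c' (u t) + u', -Gm g (c t) c' (v t) + v'])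
    (fun idx => hg.smoothTF_gT.differentiableAt hg.isOpen hct idx) hc
    (fun a => by fin_cases a <;> assumption)
  have e1 : ∀ τ, (fun a => (![u, v] : Fin 2 → ℝ → Fin n → ℝ) a τ) = ![u τ, v τ] := fun τ => by
    ext i; fin_cases i <;> rfl
  simp only [e1, ev_gT, Fin.sum_univ_two, update_fin_two_zero, update_fin_two_one] at h
  refine h.congr_deriv ?_
  rw [← dg, dg_eq hg hct]
  simp
  ring

theorem hasDerivAt_Nie_transport (hg : IsMetricOn g U)
    (h2 : ∀ x ∈ U, ∀ idx, covDeriv g (covDeriv g (riemann g)) x idx = 0)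
    {c e w k a b : ℝ → Fin n → ℝ} {c' : Fin n → ℝ} {t : ℝ} (hct : c t ∈ U)
    (hc : HasDerivAt c c' t) (he : HasDerivAt e (-Gm g (c t) c' (e t)) t)
    (hw : HasDerivAt w (-Gm g (c t) c' (w t)) t) (hk : HasDerivAt k (-Gm g (c t) c' (k t)) t)
    (ha : HasDerivAt a (-Gm g (c t) c' (a t)) t) (hb : HasDerivAt b (-Gm g (c t) c' (b t)) t) :
    HasDerivAt (fun τ => Nie g (c τ) (e τ) (w τ) (k τ) (a τ) (b τ)) 0 t := by
  have h := hasDerivAt_ev_transport (g := g) (T := covDeriv g (riemann g)) (c := c)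
    (v := ![e, w, k, a, b]) (fun idx => (hg.smoothTF_covDeriv
      hg.smoothTF_riemann).differentiableAt hg.isOpen hct idx) hc
    (fun i => by fin_cases i <;> assumption)
  have e1 : ∀ τ, (fun i => (![e, w, k, a, b] : Fin 5 → ℝ → Fin n → ℝ) i τ)
      = ![e τ, w τ, k τ, a τ, b τ] := fun τ => by
    ext i; fin_cases i <;> rfl
  simp only [e1] at h
  refine h.congr_deriv ?_
  rw [ev_eq_zero_iff.mpr (h2 _ hct)]
  rfl

theorem hasDerivAt_Rie_transport (hg : IsMetricOn g U)
    {c w k a b : ℝ → Fin n → ℝ} {c' : Fin n → ℝ} {t : ℝ} (hct : c t ∈ U)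
    (hc : HasDerivAt c c' t)
    (hw : HasDerivAt w (-Gm g (c t) c' (w t)) t) (hk : HasDerivAt k (-Gm g (c t) c' (k t)) t)
    (ha : HasDerivAt a (-Gm g (c t) c' (a t)) t) (hb : HasDerivAt b (-Gm g (c t) c' (b t)) t) :
    HasDerivAt (fun τ => Rie g (c τ) (w τ) (k τ) (a τ) (b τ))
      (Nie g (c t) c' (w t) (k t) (a t) (b t)) t := by
  have h := hasDerivAt_ev_transport (g := g) (T := riemann g) (c := c)
    (v := ![w, k, a, b]) (fun idx => hg.smoothTF_riemann.differentiableAt hg.isOpen hct idx) hc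
    (fun i => by fin_cases i <;> assumption)
  have e1 : ∀ τ, (fun i => (![w, k, a, b] : Fin 4 → ℝ → Fin n → ℝ) i τ)
      = ![w τ, k τ, a τ, b τ] := fun τ => by
    ext i; fin_cases i <;> rfl
  simp only [e1] at h
  exact h

theorem eq_of_hasDerivAt_zero {f : ℝ → ℝ} (h : ∀ t ∈ Icc (0 : ℝ) 1, HasDerivAt f 0 t) :
    ∀ t ∈ Icc (0 : ℝ) 1, f t = f 0 :=
  constant_of_has_deriv_right_zero (fun t ht => (h t ht).continuousAt.continuousWithinAt)
    fun t ht => (h t (Ico_subset_Icc_self ht)).hasDerivWithinAt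

end Transport

end

section

variable {n m s : ℕ}

section Linear

variable {g : MetricMat n}

theorem isLinearMap_update (M : MultilinearMap ℝ (fun _ : Fin s => Fin n → ℝ) ℝ)
    (f : (Fin n → ℝ) → Fin s → Fin n → ℝ) (i : Fin s)
    (h : ∀ u, Function.update (f 0) i u = f u) : IsLinearMap ℝ fun u => M (f u) := by
  have h1 : (fun u => M (f u)) = M.toLinearMap (f 0) i := by
    funext u; rw [MultilinearMap.toLinearMap_apply, h]
  rw [h1]
  exact LinearMap.isLinear _

theorem isLinearMap_Rie (x w c a : Fin n → ℝ) : IsLinearMap ℝ (Rie g x w c a) :=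
  isLinearMap_update (ev (riemann g x)) (fun u => ![w, c, a, u]) 3
    fun u => by ext i; fin_cases i <;> rfl

theorem isLinearMap_Nie (x e w c a : Fin n → ℝ) : IsLinearMap ℝ (Nie g x e w c a) :=
  isLinearMap_update (ev (covDeriv g (riemann g) x)) (fun u => ![e, w, c, a, u]) 4
    fun u => by ext i; fin_cases i <;> rfl

theorem isLinearMap_Nie_left (x w c a b : Fin n → ℝ) :
    IsLinearMap ℝ fun e => Nie g x e w c a b :=
  isLinearMap_update (ev (covDeriv g (riemann g) x)) (fun u => ![u, w, c, a, b]) 0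
    fun u => by ext i; fin_cases i <;> rfl

end Linear

section Exp

/-- The metric at `x` in the frame `F`. -/
def gF (g : MetricMat n) (x : Fin n → ℝ) (F : (Fin n → ℝ) →L[ℝ] (Fin n → ℝ)) :
    (Fin n → ℝ) →ₗ[ℝ] (Fin n → ℝ) →ₗ[ℝ] ℝ :=
  (gB g x).compl₁₂ (F : (Fin n → ℝ) →ₗ[ℝ] (Fin n → ℝ)) F

/-- The curvature at `x` in the frame `F`. -/
def RieF (g : MetricMat n) (x : Fin n → ℝ) (F : (Fin n → ℝ) →L[ℝ] (Fin n → ℝ))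
    (w c a b : Fin n → ℝ) : ℝ := Rie g x (F w) (F c) (F a) (F b)

/-- The covariant derivative of the curvature at `x` in the frame `F`. -/
def NieF (g : MetricMat n) (x : Fin n → ℝ) (F : (Fin n → ℝ) →L[ℝ] (Fin n → ℝ))
    (e w c a b : Fin n → ℝ) : ℝ := Nie g x (F e) (F w) (F c) (F a) (F b)

@[simp] theorem gF_apply (g : MetricMat n) (x : Fin n → ℝ) (F : (Fin n → ℝ) →L[ℝ] (Fin n → ℝ))
    (u v : Fin n → ℝ) : gF g x F u v = gB g x (F u) (F v) := rfl

theorem isLinearMap_RieF (g : MetricMat n) (x : Fin n → ℝ) (F : (Fin n → ℝ) →L[ℝ] (Fin n → ℝ))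
    (w c a : Fin n → ℝ) : IsLinearMap ℝ (RieF g x F w c a) :=
  ⟨fun u v => by simp [RieF, (isLinearMap_Rie x _ _ _).map_add],
    fun k u => by simp only [RieF, map_smul, (isLinearMap_Rie x _ _ _).map_smul]⟩

theorem isLinearMap_NieF (g : MetricMat n) (x : Fin n → ℝ) (F : (Fin n → ℝ) →L[ℝ] (Fin n → ℝ))
    (e w c a : Fin n → ℝ) : IsLinearMap ℝ (NieF g x F e w c a) :=
  ⟨fun u v => by simp [NieF, (isLinearMap_Nie x _ _ _ _).map_add],
    fun k u => by simp only [NieF, map_smul, (isLinearMap_Nie x _ _ _ _).map_smul]⟩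

variable {g : MetricMat n} {U : Set (Fin n → ℝ)} {x : Fin n → ℝ}
  {F : (Fin n → ℝ) →L[ℝ] (Fin n → ℝ)}

theorem gF_symm (hg : IsMetricOn g U) (hx : x ∈ U) (u v : Fin n → ℝ) :
    gF g x F u v = gF g x F v u := gB_symm (hg.symm x hx) _ _

theorem gF_nondeg (hg : IsMetricOn g U) (hx : x ∈ U) (hF : Function.Bijective F) (v : Fin n → ℝ)
    (hv : ∀ w, gF g x F w v = 0) : v = 0 := by
  apply (map_eq_zero_iff F hF.1).mp
  refine gB_nondeg (hg.nondeg x hx) fun w => ?_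
  obtain ⟨w, rfl⟩ := hF.2 w
  exact hv w

/-- `ex` is a normal coordinate map at `x` with respect to the frame `F`, defined on the ball
of radius `r`, and `P y` is the frame `F` parallel transported along the radial geodesic. -/
structure IsExpMap (g : MetricMat n) (U : Set (Fin n → ℝ)) (x : Fin n → ℝ)
    (F : (Fin n → ℝ) →L[ℝ] (Fin n → ℝ)) (r : ℝ) (ex : (Fin n → ℝ) → Fin n → ℝ)
    (P : (Fin n → ℝ) → (Fin n → ℝ) →L[ℝ] (Fin n → ℝ)) : Prop where
  pos : 0 < r
  smooth : ContDiffOn ℝ (⊤ : ℕ∞) ex (Metric.ball 0 r)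
  map_zero : ex 0 = x
  fderiv_zero : fderiv ℝ ex 0 = F
  mapsTo : ∀ y ∈ Metric.ball (0 : Fin n → ℝ) r, ex y ∈ U
  bijective : ∀ y ∈ Metric.ball (0 : Fin n → ℝ) r, Function.Bijective (P y)
  metric : ∀ y ∈ Metric.ball (0 : Fin n → ℝ) r, ∀ a b, gF g (ex y) (P y) a b = gF g x F a b
  rie : ∀ y ∈ Metric.ball (0 : Fin n → ℝ) r, ∀ w c a b,
    RieF g (ex y) (P y) w c a b = RieF g x F w c a b + NieF g x F y w c a b
  nie : ∀ y ∈ Metric.ball (0 : Fin n → ℝ) r, ∀ e w c a b,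
    NieF g (ex y) (P y) e w c a b = NieF g x F e w c a b
  jacobi : ∀ y ∈ Metric.ball (0 : Fin n → ℝ) r, ∀ w, ∃ E,
    IsJacobi (gF g x F) (RieF g x F) (NieF g x F) y w E ∧ fderiv ℝ ex y w = P y (E 1)

theorem bijective_of_gF_eq (hg : IsMetricOn g U) (hx : x ∈ U) (hF : Function.Bijective F)
    {x' : Fin n → ℝ} {P : (Fin n → ℝ) →L[ℝ] (Fin n → ℝ)}
    (h : ∀ a b, gF g x' P a b = gF g x F a b) : Function.Bijective P := by
  have hinj : Function.Injective P := (injective_iff_map_eq_zero P).mpr fun u hu =>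
    gF_nondeg hg hx hF u fun w => by rw [← h, gF_apply, hu, map_zero]
  exact ⟨hinj, LinearMap.injective_iff_surjective (f := (P : (Fin n → ℝ) →ₗ[ℝ] (Fin n → ℝ))).mp
    hinj⟩

theorem exists_isExpMap (hg : IsMetricOn g U)
    (h2 : ∀ x ∈ U, ∀ idx, covDeriv g (covDeriv g (riemann g)) x idx = 0) (hx : x ∈ U)
    (hF : Function.Bijective F) : ∃ r ex P, IsExpMap g U x F r ex P := by
  obtain ⟨r, hr, c, P, J, Q, hsm, H⟩ := exists_frame_flow (E := Fin n → ℝ) (Γ := Gm g) hg.isOpen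
    hg.contDiffOn_Gm hx F
  have h01 : (1 : ℝ) ∈ Icc (0 : ℝ) 1 := right_mem_Icc.mpr zero_le_one
  have hPa : ∀ y ∈ Metric.ball (0 : Fin n → ℝ) r, ∀ a, ∀ t ∈ Icc (0 : ℝ) 1,
      HasDerivAt (fun t => P y t a) (-Gm g (c y t) (P y t y) (P y t a)) t := fun y hy a t ht => by
    refine (((H y hy).2.2.1 t ht).2.2.clm_apply (hasDerivAt_const t a)).congr_deriv ?_
    simp
  have hmet : ∀ y ∈ Metric.ball (0 : Fin n → ℝ) r, ∀ t ∈ Icc (0 : ℝ) 1, ∀ a b,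
      gF g (c y t) (P y t) a b = gF g x F a b := by
    intro y hy t ht a b
    have := eq_of_hasDerivAt_zero (f := fun t => gB g (c y t) (P y t a) (P y t b)) (fun t ht => by
      obtain ⟨hU, hc, -⟩ := (H y hy).2.2.1 t ht
      refine (hasDerivAt_gB_transport hg (u' := 0) (v' := 0) hU hc
        (by simpa using hPa y hy a t ht) (by simpa using hPa y hy b t ht)).congr_deriv ?_
      simp) t ht
    simpa [(H y hy).1, (H y hy).2.1] using this
  have hnie : ∀ y ∈ Metric.ball (0 : Fin n → ℝ) r, ∀ t ∈ Icc (0 : ℝ) 1, ∀ e w k a b,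
      NieF g (c y t) (P y t) e w k a b = NieF g x F e w k a b := by
    intro y hy t ht e w k a b
    have := eq_of_hasDerivAt_zero (f := fun t => Nie g (c y t) (P y t e) (P y t w) (P y t k)
      (P y t a) (P y t b)) (fun t ht => by
      obtain ⟨hU, hc, -⟩ := (H y hy).2.2.1 t ht
      exact hasDerivAt_Nie_transport hg h2 hU hc (hPa y hy _ t ht) (hPa y hy _ t ht)
        (hPa y hy _ t ht) (hPa y hy _ t ht) (hPa y hy _ t ht)) t ht
    simp only [(H y hy).1, (H y hy).2.1] at this
    exact this
  have hrie : ∀ y ∈ Metric.ball (0 : Fin n → ℝ) r, ∀ t ∈ Icc (0 : ℝ) 1, ∀ w k a b,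
      RieF g (c y t) (P y t) w k a b = RieF g x F w k a b + t * NieF g x F y w k a b := by
    intro y hy t ht w k a b
    have := eq_of_hasDerivAt_zero (f := fun t => Rie g (c y t) (P y t w) (P y t k)
      (P y t a) (P y t b) - t * NieF g x F y w k a b) (fun t ht => by
      obtain ⟨hU, hc, -⟩ := (H y hy).2.2.1 t ht
      refine ((hasDerivAt_Rie_transport hg hU hc (hPa y hy _ t ht)
        (hPa y hy _ t ht) (hPa y hy _ t ht) (hPa y hy _ t ht)).sub
        ((hasDerivAt_id t).mul_const _)).congr_deriv ?_
      rw [← hnie y hy t ht]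
      simp [NieF]) t ht
    simp only [(H y hy).1, (H y hy).2.1, zero_mul, sub_zero] at this
    unfold RieF
    linarith
  have hbij : ∀ y ∈ Metric.ball (0 : Fin n → ℝ) r, ∀ t ∈ Icc (0 : ℝ) 1,
      Function.Bijective (P y t) := fun y hy t ht => bijective_of_gF_eq hg hx hF (hmet y hy t ht)
  obtain ⟨b, hb⟩ := exists_dual_basis (gF_symm (F := F) hg hx) (gF_nondeg hg hx hF)
  have hjac : ∀ y ∈ Metric.ball (0 : Fin n → ℝ) r, ∀ w, ∃ E,
      IsJacobi (gF g x F) (RieF g x F) (NieF g x F) y w E ∧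
        fderiv ℝ (fun y => c y 1) y w = P y 1 (E 1) := by
    intro y hy w
    obtain ⟨hc0, hP0, hcP, hJ⟩ := H y hy
    obtain ⟨hfd, hJ0, hQ0, hJQ⟩ := hJ w
    let K : ℝ → Fin n → ℝ := fun t =>
      P y t w + Q y w t y + Gm g (c y t) (P y t y) (J y w t)
    have hJd : ∀ t ∈ Icc (0 : ℝ) 1, HasDerivAt (J y w)
        (-Gm g (c y t) (P y t y) (J y w t) + K t) t := fun t ht =>
      (hJQ t ht).1.congr_deriv (by simp [K])
    have hKd : ∀ t ∈ Icc (0 : ℝ) 1, HasDerivAt K (-Gm g (c y t) (P y t y) (K t)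
        + Rm g (c y t) (P y t y) (J y w t) (P y t y)) t := by
      intro t ht
      obtain ⟨hU, hc, -⟩ := hcP t ht
      have hΓ : HasDerivAt (fun t => Gm g (c y t)) (fderiv ℝ (Gm g) (c y t) (P y t y)) t :=
        HasFDerivAt.comp_hasDerivAt (F := Fin n → ℝ)
          (E := (Fin n → ℝ) →L[ℝ] (Fin n → ℝ) →L[ℝ] (Fin n → ℝ)) t
          (hg.differentiableAt_Gm hU).hasFDerivAt hc
      have hQy := (hJQ t ht).2.clm_apply (hasDerivAt_const t y)
      refine (((hPa y hy w t ht).add hQy).add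
        ((hΓ.clm_apply (hPa y hy y t ht)).clm_apply (hJQ t ht).1)).congr_deriv ?_
      rw [Rm_apply]
      simp only [K, _root_.add_apply, _root_.neg_apply,
        ContinuousLinearMap.comp_apply, map_add, map_neg, map_zero, add_zero]
      rw [Gm_symm hg hU (P y t w) (P y t y), Gm_symm hg hU (Q y w t y) (P y t y),
        fderiv_Gm_symm hg hU (P y t y) (J y w t) (P y t y),
        Gm_symm hg hU (J y w t) (P y t y),
        Gm_symm hg hU (J y w t) (Gm g (c y t) (P y t y) (P y t y))]
      abel
    have hGE : ∀ t ∈ Icc (0 : ℝ) 1, ∀ X e : Fin n → ℝ,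
        (∀ i, e i = gB g (c y t) (P y t (b i)) X) → X = P y t e := by
      intro t ht X e he
      obtain ⟨X, rfl⟩ := (hbij y hy t ht).2 X
      congr 1
      ext i
      rw [he, ← gF_apply, hmet y hy t ht, hb]
    refine ⟨fun t i => gB g (c y t) (P y t (b i)) (J y w t), ⟨?_,
      fun t i => gB g (c y t) (P y t (b i)) (K t), ?_, fun t ht => ⟨?_,
      fun i => Rie g (c y t) (P y t (b i)) (P y t y) (P y t y) (J y w t), ?_, fun a => ?_⟩⟩, ?_⟩
    · ext i; simp [hJ0]
    · ext i
      simp only [K, hc0, hP0, hJ0, hQ0, map_zero, add_zero, _root_.zero_apply]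
      rw [← gF_apply, hb]
    · obtain ⟨hU, hc, -⟩ := hcP t ht
      refine hasDerivAt_pi.mpr fun i => ?_
      refine (hasDerivAt_gB_transport hg (u' := 0) hU hc
        (by simpa using hPa y hy (b i) t ht) (hJd t ht)).congr_deriv ?_
      simp
    · obtain ⟨hU, hc, -⟩ := hcP t ht
      refine hasDerivAt_pi.mpr fun i => ?_
      refine (hasDerivAt_gB_transport hg (u' := 0) hU hc
        (by simpa using hPa y hy (b i) t ht) (hKd t ht)).congr_deriv ?_
      rw [Rie_eq hg hU]
      simp
    · obtain ⟨hU, hc, -⟩ := hcP t ht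
      have hJE := hGE t ht (J y w t) _ fun i => rfl
      rw [← hrie y hy t ht, RieF, ← hJE, Rie_eq hg hU]
      have := hGE t ht (Rm g (c y t) (P y t y) (J y w t) (P y t y))
        (fun i => Rie g (c y t) (P y t (b i)) (P y t y) (P y t y) (J y w t))
        fun i => Rie_eq hg hU _ _ _ _
      rw [this, ← hmet y hy t ht, gF_apply]
    · rw [hfd]
      exact hGE 1 h01 _ _ fun i => rfl
  have h0 : (0 : Fin n → ℝ) ∈ Metric.ball (0 : Fin n → ℝ) r := Metric.mem_ball_self hr
  have hP0 : ∀ a, P 0 1 a = F a := fun a => by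
    have h := constant_of_has_deriv_right_zero (f := fun t => P 0 t a) (a := 0) (b := 1)
      (fun t ht => (hPa 0 h0 a t ht).continuousAt.continuousWithinAt)
      (fun t ht => ((hPa 0 h0 a t (Ico_subset_Icc_self ht)).congr_deriv
        (by simp)).hasDerivWithinAt) 1 h01
    rw [h, (H 0 h0).2.1]
  refine ⟨r, fun y => c y 1, fun y => P y 1, hr, hsm, ?_, ?_,
    fun y hy => ((H y hy).2.2.1 1 h01).1, fun y hy => hbij y hy 1 h01,
    fun y hy => hmet y hy 1 h01, fun y hy w k a b => ?_, fun y hy => hnie y hy 1 h01, hjac⟩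
  · have h := constant_of_has_deriv_right_zero (f := c 0) (a := 0) (b := 1)
      (fun t ht => ((H 0 h0).2.2.1 t ht).2.1.continuousAt.continuousWithinAt)
      (fun t ht => (((H 0 h0).2.2.1 t (Ico_subset_Icc_self ht)).2.1.congr_deriv
        (by simp)).hasDerivWithinAt) 1 h01
    exact h.trans (H 0 h0).1
  · refine ContinuousLinearMap.ext fun w => ?_
    obtain ⟨E, hE, hw⟩ := hjac 0 h0 w
    have hR0 : ∀ a, RieF g x F a 0 0 = 0 := fun a => by
      funext b
      simp only [RieF, map_zero]
      exact (ev (riemann g x)).map_coord_zero (i := 1) rfl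
    have hT0 : ∀ a, NieF g x F 0 a 0 0 = 0 := fun a => by
      funext b
      simp only [NieF, map_zero]
      exact (ev (covDeriv g (riemann g) x)).map_coord_zero (i := 0) rfl
    have h1 := hE.eq (gF_symm hg hx) (gF_nondeg hg hx hF) (fun a => isLinearMap_RieF g x F a 0 0)
      (fun a => isLinearMap_NieF g x F 0 a 0 0) (isJacobi_zero hR0 hT0 w)
    rw [hw, h1, hP0, one_smul]
  · rw [hrie y hy 1 h01, one_mul]

end Exp

end

section

section Euclidean

variable {W ι : Type*} [NormedAddCommGroup W] [InnerProductSpace ℝ W] [Fintype ι]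

open scoped InnerProductSpace

theorem sum_skew_eq_zero (f : OrthonormalBasis ι ℝ W) (X : W →ₗ[ℝ] W)
    (hX : ∀ a b, ⟪X a, b⟫_ℝ = -⟪a, X b⟫_ℝ) (β : W →ₗ[ℝ] W →ₗ[ℝ] ℝ) :
    ∑ i, (β (X (f i)) (f i) + β (f i) (X (f i))) = 0 := by
  have h1 : ∀ i, β (X (f i)) (f i) = ∑ k, ⟪f k, X (f i)⟫_ℝ * β (f k) (f i) := fun i => by
    conv_lhs => rw [← f.sum_repr' (X (f i))]
    simp [map_sum]
  have h2 : ∀ i, β (f i) (X (f i)) = ∑ k, ⟪f k, X (f i)⟫_ℝ * β (f i) (f k) := fun i => by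
    conv_lhs => rw [← f.sum_repr' (X (f i))]
    simp [map_sum]
  simp only [h1, h2, Finset.sum_add_distrib]
  rw [Finset.sum_comm, ← Finset.sum_add_distrib]
  refine Finset.sum_eq_zero fun i _ => ?_
  rw [← Finset.sum_add_distrib]
  refine Finset.sum_eq_zero fun k _ => ?_
  have : ⟪f i, X (f k)⟫_ℝ = -⟪f k, X (f i)⟫_ℝ := by
    have := hX (f i) (f k)
    rw [real_inner_comm] at this
    linarith
  rw [this]; ring

/-- The algebraic data carried by the curvature tensor on a screen space: the curvature `ro` of the
screen, the mixed part `Cv` and its partial transpose `Ca`. -/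
structure ScreenData (ro : W →ₗ[ℝ] W →ₗ[ℝ] W →ₗ[ℝ] W) (Cv Ca : W →ₗ[ℝ] W →ₗ[ℝ] W) : Prop where
  anti : ∀ a b c, ro a b c = -ro b a c
  skew : ∀ a b c d, ⟪ro a b c, d⟫_ℝ = -⟪c, ro a b d⟫_ℝ
  pair : ∀ a b c d, ⟪ro a b c, d⟫_ℝ = ⟪ro d c b, a⟫_ℝ
  bianchi : ∀ a b c, ro a b c + ro b c a + ro c a b = 0
  cv_anti : ∀ a b, Cv a b = -Cv b a
  cv_bianchi : ∀ a b c, ⟪Cv a b, c⟫_ℝ + ⟪Cv b c, a⟫_ℝ + ⟪Cv c a, b⟫_ℝ = 0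
  transpose : ∀ a b c, ⟪Ca a b, c⟫_ℝ = ⟪Cv c b, a⟫_ℝ
  ro_ro : ∀ e f a b c, ro e f (ro a b c) = ro (ro e f a) b c + ro a (ro e f b) c + ro a b (ro e f c)
  ro_cv : ∀ e f c d, ro e f (Cv c d) = Cv (ro e f c) d + Cv c (ro e f d) + ro c d (Cv e f)
  ca_ro : ∀ a c d e, Ca a (ro c d e) = ro (Ca a c) d e + ro c (Ca a d) e + ro c d (Ca a e)
  ca_cv : ∀ a, ∃ b, ∀ c d, Ca a (Cv c d) = Cv (Ca a c) d + Cv c (Ca a d) - ro c d b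

variable {ro : W →ₗ[ℝ] W →ₗ[ℝ] W →ₗ[ℝ] W} {Cv Ca : W →ₗ[ℝ] W →ₗ[ℝ] W}

theorem ScreenData.ro_cv_eq_zero (h : ScreenData ro Cv Ca) (f : OrthonormalBasis ι ℝ W)
    (hN : ∀ w, ∑ i, ∑ j, ⟪Cv (f i) (f j), ro (f i) (f j) w⟫_ℝ = 0) (a b c d : W) :
    ro c d (Cv a b) = 0 := by
  set u := Cv a b with hu
  have key : ∑ i, ∑ j, ⟪ro (f i) (f j) u, ro (f i) (f j) u⟫_ℝ = 0 := by
    have e1 : ∀ i j, ⟪ro (f i) (f j) u, ro (f i) (f j) u⟫_ℝ =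
        -(⟪Cv (ro a b (f i)) (f j), ro (f i) (f j) u⟫_ℝ + ⟪Cv (f i) (f j), ro (ro a b (f i)) (f j) u⟫_ℝ)
        -(⟪Cv (f i) (ro a b (f j)), ro (f i) (f j) u⟫_ℝ + ⟪Cv (f i) (f j), ro (f i) (ro a b (f j)) u⟫_ℝ)
        - ⟪Cv (f i) (f j), ro (f i) (f j) (ro a b u)⟫_ℝ := fun i j => by
      have h1 := h.ro_cv a b (f i) (f j)
      have h2 := congrArg (fun z => ⟪z, ro (f i) (f j) u⟫_ℝ) h1
      simp only [inner_add_left] at h2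
      rw [h.skew, h.ro_ro] at h2
      simp only [inner_add_right] at h2
      linarith
    have s1 : ∀ j, ∑ i, (⟪Cv (ro a b (f i)) (f j), ro (f i) (f j) u⟫_ℝ +
        ⟪Cv (f i) (f j), ro (ro a b (f i)) (f j) u⟫_ℝ) = 0 := fun j =>
      sum_skew_eq_zero f (ro a b) (fun x y => h.skew a b x y)
        ((innerₗ W).compl₁₂ (Cv.flip (f j)) ((ro.flip (f j)).flip u))
    have s2 : ∀ i, ∑ j, (⟪Cv (f i) (ro a b (f j)), ro (f i) (f j) u⟫_ℝ +
        ⟪Cv (f i) (f j), ro (f i) (ro a b (f j)) u⟫_ℝ) = 0 := fun i =>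
      sum_skew_eq_zero f (ro a b) (fun x y => h.skew a b x y)
        ((innerₗ W).compl₁₂ (Cv (f i)) ((ro (f i)).flip u))
    simp only [e1]
    simp only [Finset.sum_sub_distrib, Finset.sum_neg_distrib, hN, s2]
    rw [Finset.sum_comm]
    simp only [s1]
    simp
  have hz : ∀ i j, ro (f i) (f j) u = 0 := by
    intro i j
    have h1 := (Finset.sum_eq_zero_iff_of_nonneg fun i _ =>
      Finset.sum_nonneg fun j _ => real_inner_self_nonneg).1 key i (Finset.mem_univ _)
    have h2 := (Finset.sum_eq_zero_iff_of_nonneg fun j _ => real_inner_self_nonneg).1 h1 j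
      (Finset.mem_univ _)
    exact inner_self_eq_zero.1 h2
  have h0 : (ro.flip.flip : W →ₗ[ℝ] W →ₗ[ℝ] W →ₗ[ℝ] W).compr₂ (LinearMap.applyₗ u) = 0 :=
    f.toBasis.ext fun i => f.toBasis.ext fun j => by simpa using hz i j
  simpa using congrArg (fun L => L c d) h0

theorem ScreenData.cv_eq_zero [FiniteDimensional ℝ W] (h : ScreenData ro Cv Ca)
    (f : OrthonormalBasis ι ℝ W)
    (hN : ∀ w, ∑ i, ∑ j, ⟪Cv (f i) (f j), ro (f i) (f j) w⟫_ℝ = 0) (a b : W) : Cv a b = 0 := by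
  have hz := h.ro_cv_eq_zero f hN
  have hd : ∀ e f c d, Cv (ro e f c) d = -Cv c (ro e f d) := fun e f c d => by
    have := h.ro_cv e f c d
    rw [hz, hz, add_zero] at this
    exact eq_neg_of_add_eq_zero_left this.symm
  have cyc : ∀ e f c d b, ⟪Cv c (ro e f d), b⟫_ℝ = ⟪Cv d (ro e f b), c⟫_ℝ := fun e f c d b => by
    have h1 := h.cv_bianchi c (ro e f d) b
    have h2 : ⟪Cv b c, ro e f d⟫_ℝ = 0 := by
      rw [← neg_eq_zero, ← h.skew, hz, inner_zero_left]
    rw [hd, inner_neg_left] at h1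
    linarith
  have hr : ∀ e f c b, Cv c (ro e f b) = 0 := fun e f c b => by
    have h1 : ∀ d, ⟪Cv c (ro e f d), b⟫_ℝ = ⟪Cv c (ro e f b), d⟫_ℝ := fun d => by
      rw [cyc, cyc, h.cv_anti, hd, neg_neg]
    have := h1 (Cv c (ro e f b))
    rw [hz, map_zero, inner_zero_left] at this
    exact inner_self_eq_zero.1 this.symm
  have hl : ∀ e f c b, Cv (ro e f b) c = 0 := fun e f c b => by rw [h.cv_anti, hr, neg_zero]
  set W₂ : Submodule ℝ W := Submodule.span ℝ {x | ∃ e f b, x = ro e f b} with hW₂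
  have hW₂mem : ∀ q ∈ W₂ᗮ, ∀ e f, ro e f q = 0 := fun q hq e f => by
    have : ⟪ro e f (ro e f q), q⟫_ℝ = 0 :=
      (Submodule.mem_orthogonal W₂ q).1 hq _ (Submodule.subset_span ⟨e, f, _, rfl⟩)
    rw [h.skew, neg_eq_zero] at this
    exact inner_self_eq_zero.1 this
  have hW₂cv : ∀ p ∈ W₂, ∀ c, Cv p c = 0 := fun p hp c => by
    induction hp using Submodule.span_induction with
    | mem x hx => obtain ⟨e, f, b, rfl⟩ := hx; exact hl e f c b
    | zero => simp
    | add x y _ _ hx hy => rw [map_add, LinearMap.add_apply, hx, hy, add_zero]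
    | smul t x _ hx => rw [map_smul, LinearMap.smul_apply, hx, smul_zero]
  have hW₂inner : ∀ p ∈ W₂, ∀ c d, ⟪Cv c d, p⟫_ℝ = 0 := fun p hp c d => by
    induction hp using Submodule.span_induction with
    | mem x hx => obtain ⟨e, f, b, rfl⟩ := hx; rw [← neg_eq_zero, ← h.skew, hz, inner_zero_left]
    | zero => simp
    | add x y _ _ hx hy => rw [inner_add_right, hx, hy, add_zero]
    | smul t x _ hx => rw [inner_smul_right, hx, mul_zero]
  have symN : ∀ a ∈ W₂ᗮ, ∀ b ∈ W₂ᗮ, ∀ c d, ⟪Cv b (Cv c d), a⟫_ℝ + ⟪Cv a (Cv c d), b⟫_ℝ = 0 := by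
    have one : ∀ a, ∀ b ∈ W₂ᗮ, ∀ c d,
        ⟪Cv b (Cv c d), a⟫_ℝ = ⟪Ca b d, Ca a c⟫_ℝ - ⟪Ca b c, Ca a d⟫_ℝ := fun a b hb c d => by
      obtain ⟨z, hzz⟩ := h.ca_cv a
      have h1 := congrArg (fun x => ⟪x, b⟫_ℝ) (hzz c d)
      simp only [inner_add_left, inner_sub_left] at h1
      rw [h.transpose, h.skew, hW₂mem b hb, inner_zero_right, ← h.transpose b d,
        h.cv_anti c (Ca a d), inner_neg_left, ← h.transpose b c] at h1
      linarith
    intro a ha b hb c d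
    rw [one a b hb, one b a ha, real_inner_comm, real_inner_comm (Ca b c)]
    ring
  have sym : ∀ a b c d, ⟪Cv (Cv c d) b, a⟫_ℝ + ⟪Cv (Cv c d) a, b⟫_ℝ = 0 := by
    intro a b c d
    obtain ⟨p, hp, q, hq, rfl⟩ := W₂.exists_add_mem_mem_orthogonal a
    obtain ⟨p', hp', q', hq', rfl⟩ := W₂.exists_add_mem_mem_orthogonal b
    have h1 := symN q hq q' hq' c d
    have e : ∀ x ∈ W₂, Cv (Cv c d) x = 0 := fun x hx => by rw [h.cv_anti, hW₂cv x hx, neg_zero]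
    simp only [map_add, e p hp, e p' hp', inner_add_right, zero_add, hW₂inner p hp,
      hW₂inner p' hp']
    rw [h.cv_anti _ q', h.cv_anti _ q, inner_neg_left, inner_neg_left]
    linarith
  have hb : ∀ c d a b, ⟪Cv a b, Cv c d⟫_ℝ = -2 * ⟪Cv (Cv c d) a, b⟫_ℝ := fun c d a b => by
    have h1 := h.cv_bianchi (Cv c d) a b
    rw [h.cv_anti b, inner_neg_left] at h1
    linarith [sym a b c d]
  have hvv : ∀ c d c' d', Cv (Cv c d) (Cv c' d') = 0 := fun c d c' d' => by
    refine ext_inner_right ℝ fun b => ?_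
    rw [inner_zero_left]
    have h2 := hb c' d' (Cv c d) b
    have h3 := sym (Cv c' d') b c d
    rw [h.cv_anti (Cv c' d'), inner_neg_left] at h2
    linarith
  have hva : ∀ c d a, Cv (Cv c d) a = 0 := fun c d a => by
    have h3 := sym (Cv (Cv c d) a) a c d
    rw [hvv, inner_zero_left, add_zero] at h3
    exact inner_self_eq_zero.1 h3
  have := hb a b a b
  rw [hva, inner_zero_left, mul_zero] at this
  exact inner_self_eq_zero.1 this

/-- Least squares: a finite family of vectors can be corrected by the values of a family of linear
maps at a common vector so as to become orthogonal to all such values. -/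
theorem exists_least_squares {κ : Type*} [Fintype κ] [FiniteDimensional ℝ W]
    (L : κ → W →ₗ[ℝ] W) (v : κ → W) : ∃ w, ∀ w', ∑ k, ⟪v k - L k w, L k w'⟫_ℝ = 0 := by
  let Λ : W →ₗ[ℝ] PiLp 2 (fun _ : κ => W) :=
    (WithLp.linearEquiv 2 ℝ (κ → W)).symm.toLinearMap ∘ₗ LinearMap.pi L
  obtain ⟨p, ⟨w, rfl⟩, q, hq, hv⟩ :=
    (LinearMap.range Λ).exists_add_mem_mem_orthogonal (WithLp.toLp 2 v)
  refine ⟨w, fun w' => ?_⟩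
  have h1 : inner ℝ (Λ w') q = 0 := (Submodule.mem_orthogonal _ _).1 hq _ ⟨w', rfl⟩
  have h2 : q = WithLp.toLp 2 v - Λ w := by rw [hv]; abel
  rw [h2, real_inner_comm, PiLp.inner_apply] at h1
  exact h1

theorem ScreenData.exists_eq [FiniteDimensional ℝ W] (h : ScreenData ro Cv Ca) :
    ∃ w, ∀ c d, Cv c d = ro c d w := by
  let f := stdOrthonormalBasis ℝ W
  obtain ⟨w, hw⟩ := exists_least_squares (fun k : Fin _ × Fin _ => ro (f k.1) (f k.2))
    (fun k => Cv (f k.1) (f k.2))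
  have h' : ScreenData ro (Cv - (LinearMap.compr₂ ro (LinearMap.applyₗ w))) (Ca + ro w) := by
    refine ⟨h.anti, h.skew, h.pair, h.bianchi, fun a b => ?_, fun a b c => ?_, fun a b c => ?_,
      h.ro_ro, fun e f c d => ?_, fun a c d e => ?_, fun a => ?_⟩
    · simp only [LinearMap.sub_apply, LinearMap.compr₂_apply, LinearMap.applyₗ_apply_apply]
      rw [h.cv_anti, h.anti]; abel
    · simp only [LinearMap.sub_apply, LinearMap.compr₂_apply, LinearMap.applyₗ_apply_apply,
        inner_sub_left, h.skew _ _ w]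
      have h1 := congrArg (fun z => ⟪w, z⟫_ℝ) (h.bianchi a b c)
      simp only [inner_add_right, inner_zero_right] at h1
      linarith [h.cv_bianchi a b c]
    · simp only [LinearMap.sub_apply, LinearMap.compr₂_apply, LinearMap.applyₗ_apply_apply,
        inner_sub_left, LinearMap.add_apply, inner_add_left]
      rw [h.transpose, h.pair, h.skew c b a w, real_inner_comm a (ro c b w)]
      ring
    · simp only [LinearMap.sub_apply, LinearMap.compr₂_apply, LinearMap.applyₗ_apply_apply,
        map_sub]
      rw [h.ro_cv e f c d, h.ro_ro e f c d w]
      abel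
    · simp only [LinearMap.add_apply, map_add]
      rw [h.ca_ro a c d e, h.ro_ro w a c d e]
      abel
    · obtain ⟨b, hb⟩ := h.ca_cv a
      refine ⟨b + Ca a w - (Cv w a - ro w a w), fun c d => ?_⟩
      simp only [LinearMap.sub_apply, LinearMap.compr₂_apply, LinearMap.applyₗ_apply_apply,
        map_sub, LinearMap.add_apply, map_add]
      rw [hb c d, h.ro_cv w a c d, h.ro_ro w a c d w, h.ca_ro a c d w]
      abel
  refine ⟨w, fun c d => ?_⟩
  have := h'.cv_eq_zero f (fun w' => by
    have := hw w'
    rw [← Finset.univ_product_univ, Finset.sum_product] at this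
    simpa using this) c d
  simpa [sub_eq_zero] using this

end Euclidean

end

section

section LorentzForm

variable {V : Type*} [AddCommGroup V] [Module ℝ V]

/-- A symmetric bilinear form of signature `(1, n - 1)`, phrased through a timelike vector. -/
structure IsLorentzForm (G : V →ₗ[ℝ] V →ₗ[ℝ] ℝ) : Prop where
  symm : ∀ u v, G u v = G v u
  timelike : ∃ e, G e e < 0 ∧ ∀ v, G e v = 0 → v ≠ 0 → 0 < G v v

variable {G : V →ₗ[ℝ] V →ₗ[ℝ] ℝ}

theorem IsLorentzForm.nondeg (h : IsLorentzForm G) {v : V} (hv : ∀ w, G v w = 0) : v = 0 := by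
  obtain ⟨e, _, he⟩ := h.timelike
  by_contra hne
  have := he v (by rw [h.symm]; exact hv e) hne
  rw [hv] at this
  exact lt_irrefl _ this

theorem IsLorentzForm.exists_eq_smul_of_orthogonal (h : IsLorentzForm G) {l v : V} (hl : G l l = 0)
    (hl0 : l ≠ 0) (hv : G l v = 0) (hvv : G v v ≤ 0) : ∃ c : ℝ, v = c • l := by
  obtain ⟨e, _, he⟩ := h.timelike
  have hs : G e l ≠ 0 := fun h0 => (he l h0 hl0).ne' hl
  refine ⟨G e v / G e l, ?_⟩
  by_contra hne
  have := he (v - (G e v / G e l) • l) (by simp [hs]) (sub_ne_zero.2 hne)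
  simp only [map_sub, map_smul, LinearMap.sub_apply, LinearMap.smul_apply, smul_eq_mul, hl, hv,
    h.symm v l] at this
  linarith

theorem IsLorentzForm.pos_of_orthogonal_null (h : IsLorentzForm G) {l n v : V} (hl : G l l = 0)
    (hl0 : l ≠ 0) (hn : G l n = -1) (hv : G l v = 0) (hv' : G n v = 0) (hv0 : v ≠ 0) :
    0 < G v v := by
  by_contra hc
  obtain ⟨c, rfl⟩ := h.exists_eq_smul_of_orthogonal hl hl0 hv (not_lt.1 hc)
  rw [map_smul, h.symm, hn, smul_eq_mul] at hv'
  have : c = 0 := by linarith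
  exact hv0 (by rw [this, zero_smul])

theorem IsLorentzForm.exists_null_pair (h : IsLorentzForm G) {l : V} (hl : G l l = 0)
    (hl0 : l ≠ 0) : ∃ n, G n n = 0 ∧ G l n = -1 := by
  obtain ⟨e, _, he⟩ := h.timelike
  have hs : G e l ≠ 0 := fun h0 => (he l h0 hl0).ne' hl
  have hs' : G l e ≠ 0 := by rwa [h.symm]
  refine ⟨(-(G e l)⁻¹) • e + (G e e / (2 * G e l ^ 2)) • l, ?_, ?_⟩
  · simp only [map_add, map_smul, LinearMap.add_apply, LinearMap.smul_apply, smul_eq_mul, hl,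
      h.symm l e]
    field_simp
    ring
  · simp only [map_add, map_smul, smul_eq_mul, hl, h.symm l e]
    field_simp
    ring

end LorentzForm

theorem pair_symm_of_antisymm {V : Type*} (N : V → V → V → V → ℝ)
    (h1 : ∀ w c a b, N w c a b = -N w c b a) (h2 : ∀ w c a b, N w c a b = -N c w a b)
    (h3 : ∀ w c a b, N w c a b + N w a b c + N w b c a = 0) (w c a b : V) :
    N w c a b = N a b w c := by
  linarith [h3 w c a b, h3 c a b w, h3 a b w c, h3 b w c a, h1 w c a b, h1 w a b c, h1 w b c a,
    h1 c a b w, h1 c b w a, h1 c w a b, h1 a b w c, h1 a w c b, h1 a c b w, h1 b w c a, h1 b c a w,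
    h1 b a w c, h2 w c a b, h2 w a b c, h2 w b c a, h2 c a b w, h2 c b w a, h2 a b w c, h2 a w b c,
    h2 c w b a, h2 a b c w, h2 b c w a, h2 b c a w, h2 a c b w, h2 a c w b, h2 b w a c, h2 b w c a]

/-- The values at a point of the curvature tensor `R` and of its covariant derivative `T`,
together with the integrability conditions which follow from second-order symmetry. -/
structure CurvAlg (V : Type*) [AddCommGroup V] [Module ℝ V] where
  /-- the metric -/
  G : V →ₗ[ℝ] V →ₗ[ℝ] ℝ
  /-- the curvature operator -/
  R : V →ₗ[ℝ] V →ₗ[ℝ] V →ₗ[ℝ] V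
  /-- the derivative of the curvature operator, its first argument being the direction -/
  T : V →ₗ[ℝ] V →ₗ[ℝ] V →ₗ[ℝ] V →ₗ[ℝ] V
  lorentz : IsLorentzForm G
  R_anti : ∀ a b c, R a b c = -R b a c
  R_skew : ∀ a b c d, G (R a b c) d = -G c (R a b d)
  R_bianchi : ∀ a b c, R a b c + R b c a + R c a b = 0
  T_anti : ∀ e a b c, T e a b c = -T e b a c
  T_skew : ∀ e a b c d, G (T e a b c) d = -G c (T e a b d)
  T_bianchi : ∀ e a b c, T e a b c + T e b c a + T e c a b = 0
  T_bianchi_two : ∀ e a b c, T e a b c + T a b e c + T b e a c = 0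
  R_R : ∀ y z a b c, R y z (R a b c) = R (R y z a) b c + R a (R y z b) c + R a b (R y z c)
  R_T : ∀ y z e a b c, R y z (T e a b c) =
    T (R y z e) a b c + T e (R y z a) b c + T e a (R y z b) c + T e a b (R y z c)
  T_T_full : ∀ v y z e a b c, T v y z (T e a b c) =
    T (T v y z e) a b c + T e (T v y z a) b c + T e a (T v y z b) c + T e a b (T v y z c)
  T_R : ∀ v y z a b c, T v y z (R a b c) + R y z (T v a b c) =
    (T v (R y z a) b c + T v a (R y z b) c + T v a b (R y z c)) +
    (R (T v y z a) b c + R a (T v y z b) c + R a b (T v y z c))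
  T_T : ∀ v y z a b c, T v y z (T v a b c) =
    T v (T v y z a) b c + T v a (T v y z b) c + T v a b (T v y z c)

namespace CurvAlg

variable {V : Type*} [AddCommGroup V] [Module ℝ V] (K : CurvAlg V)

theorem G_symm (u v : V) : K.G u v = K.G v u := K.lorentz.symm u v

theorem R_pair (a b c d : V) : K.G (K.R a b c) d = K.G (K.R c d a) b := by
  have := pair_symm_of_antisymm (fun w c a b => K.G (K.R a b c) w)
    (fun w c a b => by rw [K.R_anti]; simp) (fun w c a b => by rw [K.R_skew, K.G_symm])
    (fun w c a b => by
      have := congrArg (fun x => K.G x w) (K.R_bianchi a b c)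
      simp only [map_add, LinearMap.add_apply, map_zero, LinearMap.zero_apply] at this
      linarith) d c a b
  rw [this, K.R_anti, map_neg, LinearMap.neg_apply, K.R_skew, K.G_symm, neg_neg, K.R_skew,
    K.G_symm, K.R_anti, map_neg, LinearMap.neg_apply, neg_neg]

theorem T_pair (e a b c d : V) : K.G (K.T e a b c) d = K.G (K.T e c d a) b := by
  have := pair_symm_of_antisymm (fun w c a b => K.G (K.T e a b c) w)
    (fun w c a b => by rw [K.T_anti]; simp) (fun w c a b => by rw [K.T_skew, K.G_symm])
    (fun w c a b => by
      have := congrArg (fun x => K.G x w) (K.T_bianchi e a b c)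
      simp only [map_add, LinearMap.add_apply, map_zero, LinearMap.zero_apply] at this
      linarith) d c a b
  rw [this, K.T_anti, map_neg, LinearMap.neg_apply, K.T_skew, K.G_symm, neg_neg, K.T_skew,
    K.G_symm, K.T_anti, map_neg, LinearMap.neg_apply, neg_neg]

theorem T_T_polar (v w y z a b c : V) : K.T v y z (K.T w a b c) + K.T w y z (K.T v a b c) =
    (K.T w (K.T v y z a) b c + K.T w a (K.T v y z b) c + K.T w a b (K.T v y z c)) +
    (K.T v (K.T w y z a) b c + K.T v a (K.T w y z b) c + K.T v a b (K.T w y z c)) := by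
  have h := K.T_T (v + w) y z a b c
  simp only [map_add, LinearMap.add_apply] at h
  have h1 := K.T_T v y z a b c
  have h2 := K.T_T w y z a b c
  rw [h1, h2] at h
  rw [← sub_eq_zero] at h ⊢
  rw [← h]
  abel

theorem T_T_sum (v w y z : V) : K.T (K.T v y z w + K.T w y z v) = 0 := by
  refine LinearMap.ext fun a => LinearMap.ext fun b => LinearMap.ext fun c => ?_
  have h1 := K.T_T_full v y z w a b c
  have h2 := K.T_T_full w y z v a b c
  have h3 := K.T_T_polar v w y z a b c
  rw [h1, h2] at h3
  simp only [map_add, LinearMap.add_apply, LinearMap.zero_apply]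
  rw [← sub_eq_zero] at h3
  rw [← h3]
  abel

/-- Where `T` is nonzero it is carried by a null line. -/
theorem exists_null (h : K.T ≠ 0) [FiniteDimensional ℝ V] : ∃ l, l ≠ 0 ∧ K.G l l = 0 ∧
    (∀ z, K.G l z = 0 → K.T z = 0) ∧ ∀ v x y, K.T v x y l = 0 := by
  set Z : Submodule ℝ V := LinearMap.ker K.T with hZ
  set U : Submodule ℝ V := LinearMap.BilinForm.orthogonal K.G Z with hU
  have memU : ∀ {u}, u ∈ U ↔ ∀ k, K.T k = 0 → K.G k u = 0 := by
    intro u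
    rw [hU, LinearMap.BilinForm.mem_orthogonal_iff]
    rfl
  have hnd : LinearMap.BilinForm.Nondegenerate K.G :=
    ⟨fun v hv => K.lorentz.nondeg hv,
      fun v hv => K.lorentz.nondeg fun w => by rw [K.G_symm]; exact hv w⟩
  have hrefl : LinearMap.BilinForm.IsRefl K.G := fun x y hxy => by
    rw [K.G_symm]; exact hxy
  have ha : ∀ u ∈ U, ∀ v w x y, K.G (K.T v x y w) u = -K.G (K.T w x y v) u := by
    intro u hu v w x y
    have := memU.1 hu _ (K.T_T_sum v w x y)
    rw [map_add, LinearMap.add_apply] at this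
    linarith
  have hb2 : ∀ e w u x y,
      K.G (K.T e x y w) u + K.G (K.T w x y u) e + K.G (K.T u x y e) w = 0 := by
    intro e w u x y
    have := congrArg (fun z => K.G z y) (K.T_bianchi_two e w u x)
    simp only [map_add, LinearMap.add_apply, map_zero, LinearMap.zero_apply] at this
    rw [K.T_pair, K.T_pair w, K.T_pair u] at this
    exact this
  have hsk : ∀ e x y w u, K.G (K.T e x y w) u = -K.G (K.T e x y u) w := fun e x y w u => by
    rw [K.T_skew, K.G_symm]
  have hb : ∀ u ∈ U, ∀ e w x y, K.G (K.T u x y e) w = -2 * K.G (K.T e x y w) u := by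
    intro u hu e w x y
    linarith [hb2 e w u x y, ha u hu e w x y, hsk w x y u e]
  have hUU : ∀ u ∈ U, ∀ w ∈ U, ∀ e x y, K.G (K.T u x y e) w = 0 := by
    intro u hu w hw e x y
    linarith [hb u hu e w x y, hb w hw e u x y, hsk e x y w u, ha u hu e w x y, hsk w x y e u]
  have hUZ : ∀ u ∈ U, ∀ w ∈ Z, ∀ e x y, K.G (K.T u x y e) w = 0 := by
    intro u hu w hw e x y
    have : K.T w = 0 := hw
    have h1 := ha u hu e w x y
    rw [this] at h1
    simp only [LinearMap.zero_apply, map_zero, neg_zero] at h1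
    linarith [hb u hu e w x y]
  have hsup : ∀ u ∈ U, ∀ w ∈ Z ⊔ U, ∀ e x y, K.G (K.T u x y e) w = 0 := by
    intro u hu w hw e x y
    obtain ⟨p, hp, q, hq, rfl⟩ := Submodule.mem_sup.1 hw
    rw [map_add, hUZ u hu p hp, hUU u hu q hq, add_zero]
  have horth : ∀ w, (∀ x, x ∈ Z → x ∈ U → K.G x w = 0) → w ∈ Z ⊔ U := by
    intro w hw
    rw [← LinearMap.BilinForm.orthogonal_orthogonal hnd hrefl (Z ⊔ U),
      LinearMap.BilinForm.mem_orthogonal_iff]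
    intro x hx
    rw [LinearMap.BilinForm.mem_orthogonal_iff] at hx
    refine hw x ?_ ?_
    · rw [← LinearMap.BilinForm.orthogonal_orthogonal hnd hrefl Z,
        LinearMap.BilinForm.mem_orthogonal_iff]
      exact fun y hy => hx y (Submodule.mem_sup_right hy)
    · exact memU.2 fun y hy => hx y (Submodule.mem_sup_left hy)
  have hTU : ∀ u ∈ U, K.T u = 0 := by
    intro u hu
    by_cases hex : ∃ l, l ∈ Z ∧ l ∈ U ∧ l ≠ 0
    · obtain ⟨l, hlZ, hlU, hl0⟩ := hex
      have hll : K.G l l = 0 := memU.1 hlU l hlZ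
      obtain ⟨n, hnn, hln⟩ := K.lorentz.exists_null_pair hll hl0
      have hmem : ∀ w, K.G l w = 0 → w ∈ Z ⊔ U := fun w hw => horth w fun x hxZ hxU => by
        obtain ⟨c, rfl⟩ := K.lorentz.exists_eq_smul_of_orthogonal hll hl0 (memU.1 hxU l hlZ)
          (memU.1 hxU x hxZ).le
        rw [map_smul, LinearMap.smul_apply, hw, smul_zero]
      have hdec : ∀ w, ∃ p, K.G l p = 0 ∧ w = p + (-K.G l w) • n := fun w =>
        ⟨w - (-K.G l w) • n, by simp [hln], by simp⟩
      have key : ∀ x y e w, K.G (K.T u x y e) w = 0 := by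
        intro x y e w
        obtain ⟨p, hp, h1⟩ := hdec w
        obtain ⟨q, hq, h2⟩ := hdec e
        have e1 : K.G (K.T u x y n) n = 0 := by linarith [hsk u x y n n]
        rw [h1, map_add, hsup u hu p (hmem p hp), zero_add, map_smul, hsk, h2, map_add,
          hsup u hu q (hmem q hq), map_smul, e1]
        simp
      refine LinearMap.ext fun x => LinearMap.ext fun y => LinearMap.ext fun e => ?_
      exact K.lorentz.nondeg (key x y e)
    · push Not at hex
      refine LinearMap.ext fun x => LinearMap.ext fun y => LinearMap.ext fun e => ?_
      refine K.lorentz.nondeg fun w => hsup u hu w (horth w fun x hxZ hxU => ?_) e x y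
      rw [hex x hxZ hxU]; simp
  have hne : ∃ l ∈ U, l ≠ 0 := by
    by_contra hcon
    push Not at hcon
    refine h (LinearMap.ext fun v => ?_)
    have : v ∈ LinearMap.BilinForm.orthogonal K.G U := by
      rw [LinearMap.BilinForm.mem_orthogonal_iff]
      intro x hx
      rw [hcon x hx]
      exact LinearMap.map_zero₂ _ _
    rw [hU, LinearMap.BilinForm.orthogonal_orthogonal hnd hrefl Z] at this
    exact this
  obtain ⟨l, hlU, hl0⟩ := hne
  have hll : K.G l l = 0 := memU.1 hlU l (hTU l hlU)
  have hker : ∀ z, K.G l z = 0 → K.T z = 0 := by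
    intro z hz
    have : z ∈ LinearMap.BilinForm.orthogonal K.G U := by
      rw [LinearMap.BilinForm.mem_orthogonal_iff]
      intro x hx
      obtain ⟨c, rfl⟩ := K.lorentz.exists_eq_smul_of_orthogonal hll hl0
        (memU.1 hx l (hTU l hlU)) (memU.1 hx x (hTU x hx)).le
      change K.G (c • l) z = 0
      rw [map_smul, LinearMap.smul_apply, hz, smul_zero]
    rw [hU, LinearMap.BilinForm.orthogonal_orthogonal hnd hrefl Z] at this
    exact this
  refine ⟨l, hl0, hll, hker, fun v x y => K.lorentz.nondeg fun w => ?_⟩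
  linarith [hsk v x y l w, ha l hlU v w x y, hb l hlU v w x y,
    show K.G (K.T l x y v) w = 0 by rw [hTU l hlU]; simp]

end CurvAlg

end

section

section Orthonormal

variable {V : Type*} [AddCommGroup V] [Module ℝ V]

/-- A subspace on which a symmetric form is positive definite is the isometric image of a Euclidean
space, and `pr` is the orthogonal projection in the corresponding coordinates. -/
theorem exists_euclidean_coords [FiniteDimensional ℝ V] {G : V →ₗ[ℝ] V →ₗ[ℝ] ℝ}
    (hs : ∀ u v, G u v = G v u) (S : Submodule ℝ V) (hpos : ∀ v ∈ S, v ≠ 0 → 0 < G v v) :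
    ∃ (k : ℕ) (i : EuclideanSpace ℝ (Fin k) →ₗ[ℝ] V) (pr : V →ₗ[ℝ] EuclideanSpace ℝ (Fin k)),
      (∀ x y, G (i x) (i y) = inner ℝ x y) ∧ (∀ x, i x ∈ S) ∧
      (∀ v x, inner ℝ (pr v) x = G v (i x)) ∧ ∀ v ∈ S, i (pr v) = v := by
  let B : LinearMap.BilinForm ℝ S := LinearMap.BilinForm.restrict G S
  have hB : ∀ u v : S, B u v = G u v := fun u v => rfl
  obtain ⟨b, hb⟩ := LinearMap.BilinForm.exists_orthogonal_basis (B := B)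
    ⟨fun u v => by simpa [hB] using hs u v⟩
  have hbpos : ∀ j, 0 < G (b j) (b j) := fun j =>
    hpos _ (b j).2 fun h0 => b.ne_zero j (Subtype.ext h0)
  set q : Fin (Module.finrank ℝ S) → ℝ := fun j => Real.sqrt (G (b j) (b j)) with hq
  have hq0 : ∀ j, q j ≠ 0 := fun j => (Real.sqrt_pos.2 (hbpos j)).ne'
  have hqq : ∀ j, q j * q j = G (b j) (b j) := fun j => Real.mul_self_sqrt (hbpos j).le
  set f : Fin (Module.finrank ℝ S) → V := fun j => (q j)⁻¹ • (b j : V) with hf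
  have hff : ∀ j l, G (f j) (f l) = if j = l then 1 else 0 := by
    intro j l
    simp only [hf, map_smul, LinearMap.smul_apply, smul_eq_mul]
    split_ifs with h
    · subst h
      rw [← hqq]
      have := hq0 j
      field_simp
    · have : G (b j) (b l) = 0 := hb h
      rw [this]; ring
  let i : EuclideanSpace ℝ (Fin (Module.finrank ℝ S)) →ₗ[ℝ] V :=
    (Fintype.linearCombination ℝ f) ∘ₗ (WithLp.linearEquiv 2 ℝ _).toLinearMap
  let pr : V →ₗ[ℝ] EuclideanSpace ℝ (Fin (Module.finrank ℝ S)) :=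
    (WithLp.linearEquiv 2 ℝ (Fin (Module.finrank ℝ S) → ℝ)).symm.toLinearMap ∘ₗ
      LinearMap.pi fun j => G.flip (f j)
  have hi : ∀ x, i x = ∑ j, x j • f j := fun x => by
    simp [i, Fintype.linearCombination_apply]
  have hpr : ∀ v j, pr v j = G v (f j) := fun v j => rfl
  have hprb : ∀ l, i (pr (b l)) = b l := by
    intro l
    have : ∀ j, pr (b l) j = if j = l then q l else 0 := fun j => by
      have e : (b l : V) = q l • f l := by simp [hf, smul_smul, hq0]
      rw [hpr, e, LinearMap.map_smul₂, hff, smul_eq_mul]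
      simp [eq_comm]
    simp only [hi, this]
    simp [hf, smul_smul, hq0]
  refine ⟨_, i, pr, fun x y => ?_, fun x => ?_, fun v x => ?_, fun v hv => ?_⟩
  · simp only [hi, map_sum, map_smul, LinearMap.sum_apply, LinearMap.smul_apply, hff, smul_eq_mul,
      PiLp.inner_apply]
    simp [mul_comm]
  · rw [hi]
    exact S.sum_mem fun j _ => S.smul_mem _ (S.smul_mem _ (b j).2)
  · simp only [hi, PiLp.inner_apply, map_sum, map_smul, hpr, smul_eq_mul]
    simp
  · have : (i ∘ₗ pr) ∘ₗ S.subtype = S.subtype := b.ext fun l => hprb l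
    exact congrArg (fun L => L ⟨v, hv⟩) this

end Orthonormal

namespace CurvAlg

variable {V : Type*} [AddCommGroup V] [Module ℝ V] (K : CurvAlg V)

/-- `l` spans the null line along which the derivative of the curvature propagates. -/
structure IsAxis (l : V) : Prop where
  ne : l ≠ 0
  null : K.G l l = 0
  T_eq_zero : ∀ z, K.G l z = 0 → K.T z = 0
  T_right : ∀ v x y, K.T v x y l = 0

/-- `n` is a null vector normalized against `l`. -/
structure IsConj (l n : V) : Prop where
  null : K.G n n = 0
  pairing : K.G l n = -1

variable {K} {l n : V}

theorem IsAxis.T_eq (h : K.IsAxis l) (hn : K.IsConj l n) (e : V) :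
    K.T e = (-K.G l e) • K.T n := by
  have := h.T_eq_zero (e - (-K.G l e) • n) (by simp [hn.pairing])
  rwa [map_sub, sub_eq_zero, map_smul] at this

theorem IsAxis.T_orth (h : K.IsAxis l) {a b : V} (ha : K.G l a = 0) (hb : K.G l b = 0) (e c : V) :
    K.T e a b c = 0 := by
  have := K.T_bianchi_two e a b c
  rw [h.T_eq_zero a ha, h.T_eq_zero b hb] at this
  simpa using this

theorem IsAxis.T_form_left (h : K.IsAxis l) (hn : K.IsConj l n) (e a b c : V) :
    K.T e a b c = (-K.G l e) • K.T n n ((-K.G l a) • b - (-K.G l b) • a) c := by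
  have h1 := h.T_orth (a := a - (-K.G l a) • n) (b := b - (-K.G l b) • n) (by simp [hn.pairing])
    (by simp [hn.pairing]) n c
  have h2 : K.T n a n c = -K.T n n a c := K.T_anti n a n c
  have h3 : K.T n n n c = 0 := by
    have := K.T_anti n n n c
    have h2 : (2 : ℝ) • K.T n n n c = 0 := by rw [two_smul]; nth_rewrite 1 [this]; simp
    simpa using h2
  rw [h.T_eq hn e]
  simp only [LinearMap.smul_apply]
  congr 1
  simp only [map_sub, map_smul, LinearMap.sub_apply, LinearMap.smul_apply, h2, h3, smul_neg,
    smul_zero, sub_zero] at h1 ⊢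
  rw [← sub_eq_zero, ← h1]
  module

theorem IsAxis.T_form (h : K.IsAxis l) (hn : K.IsConj l n) (e a b c w : V) :
    K.G (K.T e a b c) w = (-K.G l e) * K.G (K.T n n ((-K.G l c) • w - (-K.G l w) • c) n)
      ((-K.G l a) • b - (-K.G l b) • a) := by
  rw [h.T_form_left hn, map_smul, LinearMap.smul_apply, smul_eq_mul, K.T_pair,
    h.T_form_left hn n c w n, hn.pairing]
  simp

theorem R_orth_of_axis (h : K.IsAxis l) (hT : K.T ≠ 0) (hn : K.IsConj l n) (y z : V) :
    ∀ v, K.G l v = 0 → K.G l (K.R y z v) = 0 := by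
  intro v hv
  have h0 : K.T (K.R y z v) = 0 := by
    refine LinearMap.ext fun a => LinearMap.ext fun b => LinearMap.ext fun c => ?_
    have := K.R_T y z v a b c
    simpa [h.T_eq_zero v hv] using this.symm
  rw [h.T_eq hn, smul_eq_zero] at h0
  rcases h0 with h0 | h0
  · simpa using h0
  · exact absurd (LinearMap.ext fun e => by rw [h.T_eq hn, h0]; simp) hT

theorem exists_R_axis_smul (h : K.IsAxis l) (hT : K.T ≠ 0) (hn : K.IsConj l n) (y z : V) :
    K.R y z l = (-K.G n (K.R y z l)) • l := by
  rw [← sub_eq_zero]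
  refine K.lorentz.nondeg fun w => ?_
  have h1 : K.G (K.R y z l) (w - (-K.G l w) • n) = 0 := by
    rw [K.R_skew, R_orth_of_axis h hT hn y z _ (by simp [hn.pairing]), neg_zero]
  simp only [map_sub, map_smul, LinearMap.sub_apply, LinearMap.smul_apply, smul_eq_mul] at h1 ⊢
  rw [K.G_symm n]
  linarith

/-- Euclidean coordinates on the screen space `{l, n}ᗮ`. -/
structure IsScreen (K : CurvAlg V) (l n : V) {k : ℕ} (i : EuclideanSpace ℝ (Fin k) →ₗ[ℝ] V)
    (pr : V →ₗ[ℝ] EuclideanSpace ℝ (Fin k)) : Prop where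
  isometry : ∀ x y, K.G (i x) (i y) = inner ℝ x y
  left : ∀ x, K.G l (i x) = 0
  right : ∀ x, K.G n (i x) = 0
  adjoint : ∀ v x, inner ℝ (pr v) x = K.G v (i x)
  decomp : ∀ v, v = (-K.G n v) • l + (-K.G l v) • n + i (pr v)

theorem exists_isScreen [FiniteDimensional ℝ V] (h : K.IsAxis l) (hn : K.IsConj l n) :
    ∃ (k : ℕ) (i : EuclideanSpace ℝ (Fin k) →ₗ[ℝ] V) (pr : V →ₗ[ℝ] EuclideanSpace ℝ (Fin k)),
      IsScreen K l n i pr := by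
  obtain ⟨k, i, pr, h1, h2, h3, h4⟩ := exists_euclidean_coords K.G_symm
    (LinearMap.ker (K.G l) ⊓ LinearMap.ker (K.G n)) fun v hv hv0 =>
      K.lorentz.pos_of_orthogonal_null h.null h.ne hn.pairing hv.1 hv.2 hv0
  have hi1 : ∀ x, K.G l (i x) = 0 := fun x => (h2 x).1
  have hi2 : ∀ x, K.G n (i x) = 0 := fun x => (h2 x).2
  have hnl : K.G n l = -1 := by rw [K.G_symm, hn.pairing]
  refine ⟨k, i, pr, h1, hi1, hi2, h3, fun v => ?_⟩
  set p := v - ((-K.G n v) • l + (-K.G l v) • n) with hp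
  have hpS : i (pr p) = p := h4 p ⟨by simp [hp, h.null, hn.pairing], by simp [hp, hn.null, hnl]⟩
  have hpr : pr p = pr v := by
    refine ext_inner_right ℝ fun x => ?_
    rw [h3, h3, hp]
    simp [hi1, hi2]
  rw [← hpr, hpS, hp]
  abel

variable {k : ℕ} {i : EuclideanSpace ℝ (Fin k) →ₗ[ℝ] V} {pr : V →ₗ[ℝ] EuclideanSpace ℝ (Fin k)}

theorem R_axis [FiniteDimensional ℝ V] (h : K.IsAxis l) (hT : K.T ≠ 0) (hn : K.IsConj l n)
    (y z : V) : K.R y z l = 0 := by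
  obtain ⟨k, i, pr, hS⟩ := exists_isScreen h hn
  set c := -K.G n (K.R y z l) with hc
  have hRl : K.R y z l = c • l := exists_R_axis_smul h hT hn y z
  suffices c = 0 by rw [hRl, this, zero_smul]
  let X : EuclideanSpace ℝ (Fin k) →ₗ[ℝ] EuclideanSpace ℝ (Fin k) := pr ∘ₗ K.R y z ∘ₗ i
  let A : V →ₗ[ℝ] V →ₗ[ℝ] ℝ := K.G ∘ₗ (K.T n n).flip n
  have hA : ∀ a b, A a b = K.G (K.T n n a n) b := fun a b => rfl
  have hAsymm : ∀ a b, A a b = A b a := fun a b => by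
    rw [hA, hA, K.T_pair]
  have hAl : ∀ a, A a l = 0 := fun a => by
    rw [hA, K.T_skew, h.T_right]; simp
  have hXskew : ∀ a b, inner ℝ (X a) b = -inner ℝ a (X b) := fun a b => by
    change inner ℝ (pr (K.R y z (i a))) b = -inner ℝ a (pr (K.R y z (i b)))
    rw [hS.adjoint, real_inner_comm, hS.adjoint, K.R_skew, K.G_symm]
  have hAX : ∀ a b, A (K.R y z (i a)) b = A (i (X a)) b := fun a b => by
    have h1 := hS.decomp (K.R y z (i a))
    rw [R_orth_of_axis h hT hn y z _ (hS.left a)] at h1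
    rw [h1]
    simp only [neg_zero, zero_smul, add_zero, map_add, map_smul, LinearMap.add_apply,
      LinearMap.smul_apply]
    rw [hAsymm l, hAl]
    simp [X]
  have hid : ∀ a b, A (i (X a)) (i b) + A (i a) (i (X b)) = 3 * c * A (i a) (i b) := by
    intro a b
    rw [← hAX, hAsymm (i a), ← hAX, hAsymm _ (i a)]
    have h1 := congrArg (fun v => K.G v (i b)) (K.R_T y z n n (i a) n)
    simp only [map_add, LinearMap.add_apply] at h1
    have hs : K.G l (K.R y z n - (-c) • n) = 0 := by
      rw [map_sub, ← neg_eq_iff_eq_neg.2 (K.R_skew y z l n), hRl]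
      simp [hn.pairing]
    have hs' : K.G l (K.R y z n) = c := by
      simp only [map_sub, map_smul, hn.pairing, smul_eq_mul] at hs
      linarith
    have e1 : K.T (K.R y z n) = (-c) • K.T n := by rw [h.T_eq hn, hs']
    have e2 : K.T n (K.R y z n) (i a) n = (-c) • K.T n n (i a) n := by
      have := h.T_orth hs (hS.left a) n n
      rwa [map_sub, map_smul, LinearMap.sub_apply, LinearMap.sub_apply, LinearMap.smul_apply,
        LinearMap.smul_apply, sub_eq_zero] at this
    have e3 : K.G (K.T n n (i a) (K.R y z n)) (i b) = -c * K.G (K.T n n (i a) n) (i b) := by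
      have : K.G (K.T n n (i a) (K.R y z n - (-c) • n)) (i b) = 0 := by
        rw [K.T_pair, h.T_orth hs (hS.left b)]; simp
      rwa [map_sub, map_smul, map_sub, map_smul, LinearMap.sub_apply, LinearMap.smul_apply,
        sub_eq_zero] at this
    rw [K.R_skew, e1, e2, e3] at h1
    simp only [map_smul, LinearMap.smul_apply, smul_eq_mul] at h1
    rw [hA, hA, hA]
    linarith
  by_contra hc0
  have hzero : ∀ a b, A (i a) (i b) = 0 := by
    let f := EuclideanSpace.basisFun (Fin k) ℝ
    have hsum : ∑ b, ∑ a, 3 * c * (A (i (f a)) (i (f b)) * A (i (f a)) (i (f b))) = 0 := by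
      have h1 : ∀ a b, 3 * c * (A (i (f a)) (i (f b)) * A (i (f a)) (i (f b))) =
          A (i (X (f a))) (i (f b)) * A (i (f a)) (i (f b)) +
          A (i (X (f b))) (i (f a)) * A (i (f b)) (i (f a)) := fun a b => by
        rw [hAsymm (i (X (f b))), hAsymm (i (f b)) (i (f a)), ← mul_assoc, ← hid]; ring
      have h2 : ∀ b, ∑ a, A (i (X (f a))) (i (f b)) * A (i (f a)) (i (f b)) = 0 := fun b => by
        have := sum_skew_eq_zero f X hXskew
          ((LinearMap.mul ℝ ℝ).compl₁₂ ((A.flip (i (f b))) ∘ₗ i) ((A.flip (i (f b))) ∘ₗ i))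
        simp only [LinearMap.compl₁₂_apply, LinearMap.comp_apply, LinearMap.flip_apply,
          LinearMap.mul_apply'] at this
        rw [← mul_left_cancel_iff_of_pos (two_pos (α := ℝ)), mul_zero, ← this, Finset.mul_sum]
        exact Finset.sum_congr rfl fun a _ => by ring
      simp only [h1, Finset.sum_add_distrib, h2, zero_add]
      rw [Finset.sum_comm]
      simp only [h2, Finset.sum_const_zero]
    simp only [← Finset.mul_sum] at hsum
    have h3 : (3 : ℝ) * c ≠ 0 := by simpa using hc0
    have hsum := (mul_eq_zero.1 hsum).resolve_left h3
    have hz : ∀ a b, A (i (f a)) (i (f b)) = 0 := fun a b => by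
      have h1 := (Finset.sum_eq_zero_iff_of_nonneg fun b _ =>
        Finset.sum_nonneg fun a _ => mul_self_nonneg _).1 hsum b (Finset.mem_univ _)
      have h2 := (Finset.sum_eq_zero_iff_of_nonneg fun a _ => mul_self_nonneg _).1 h1 a
        (Finset.mem_univ _)
      exact mul_self_eq_zero.1 h2
    have : A.compl₁₂ i i = 0 := f.toBasis.ext fun a => f.toBasis.ext fun b => by
      simpa using hz a b
    exact fun a b => by simpa using congrArg (fun L => L a b) this
  have hzero' : ∀ a b, K.G l a = 0 → K.G l b = 0 → A a b = 0 := fun a b ha hb => by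
    rw [hS.decomp a, hS.decomp b, ha, hb]
    simp only [neg_zero, zero_smul, add_zero, map_add, map_smul, LinearMap.add_apply,
      LinearMap.smul_apply, hAl, hAsymm l, hzero]
    simp
  refine hT (LinearMap.ext fun e => LinearMap.ext fun a => LinearMap.ext fun b =>
    LinearMap.ext fun c => K.lorentz.nondeg fun w => ?_)
  rw [h.T_form hn, ← hA, hzero' _ _ (by simp [mul_comm]) (by simp [mul_comm]), mul_zero]

end CurvAlg

end

section

namespace CurvAlg

variable {V : Type*} [AddCommGroup V] [Module ℝ V] {K : CurvAlg V} {l n : V}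
variable {k : ℕ} {i : EuclideanSpace ℝ (Fin k) →ₗ[ℝ] V} {pr : V →ₗ[ℝ] EuclideanSpace ℝ (Fin k)}

/-- The null vector `l` is annihilated by the curvature operators. -/
def RAxis (K : CurvAlg V) (l : V) : Prop := ∀ y z, K.R y z l = 0

theorem RAxis.left (h : K.RAxis l) (b c : V) : K.R l b c = 0 :=
  K.lorentz.nondeg fun w => by rw [K.R_pair, h]; simp

theorem RAxis.mid (h : K.RAxis l) (a c : V) : K.R a l c = 0 := by
  rw [K.R_anti, h.left, neg_zero]

theorem RAxis.orth (h : K.RAxis l) (a b c : V) : K.G l (K.R a b c) = 0 := by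
  rw [← neg_eq_zero, ← K.R_skew, h]; simp

theorem eq_smul_of_orth (hn : K.IsConj l n) {v : V} (hv : ∀ w, K.G l w = 0 → K.G v w = 0) :
    v = (-K.G n v) • l := by
  rw [← sub_eq_zero]
  refine K.lorentz.nondeg fun w => ?_
  have h1 : K.G v (w - (-K.G l w) • n) = 0 := hv _ (by simp [hn.pairing])
  simp only [map_sub, map_smul, LinearMap.sub_apply, LinearMap.smul_apply, smul_eq_mul] at h1 ⊢
  rw [K.G_symm n]
  linarith

theorem IsAxis.T_R_orth (h : K.IsAxis l) (hR : K.RAxis l) (hn : K.IsConj l n) {a b c : V}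
    (ha : K.G l a = 0) (hb : K.G l b = 0) (hc : K.G l c = 0) (z : V) :
    K.T n n z (K.R a b c) = 0 := by
  have hl : ∀ a, K.G l a = 0 → ∃ t : ℝ, K.T n n z a = t • l := fun a ha =>
    ⟨_, eq_smul_of_orth hn fun w hw => by rw [K.T_pair, h.T_orth ha hw]; simp⟩
  obtain ⟨ta, hta⟩ := hl a ha
  obtain ⟨tb, htb⟩ := hl b hb
  obtain ⟨tc, htc⟩ := hl c hc
  have h1 := K.T_R n n z a b c
  have h2 := K.R_T n z n a b c
  rw [h.T_eq_zero _ (hR.orth n z n)] at h2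
  rw [h2, hta, htb, htc] at h1
  simpa [hR.left, hR.mid, show ∀ y z, K.R y z l = 0 from hR] using h1

theorem IsScreen.R_right (hS : IsScreen K l n i pr) (hR : K.RAxis l) {v : V} (hv : K.G l v = 0)
    (y z : V) : K.R y z (i (pr v)) = K.R y z v := by
  conv_rhs => rw [hS.decomp v, hv]
  simp [show ∀ y z, K.R y z l = 0 from hR]

theorem IsScreen.R_left (hS : IsScreen K l n i pr) (hR : K.RAxis l) {v : V} (hv : K.G l v = 0)
    (y z : V) : K.R (i (pr v)) y z = K.R v y z := by
  conv_rhs => rw [hS.decomp v, hv]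
  simp [hR.left]

theorem IsScreen.R_mid (hS : IsScreen K l n i pr) (hR : K.RAxis l) {v : V} (hv : K.G l v = 0)
    (y z : V) : K.R y (i (pr v)) z = K.R y v z := by
  conv_rhs => rw [hS.decomp v, hv]
  simp [hR.mid]

/-- The curvature operators compressed to the screen space. -/
def screenR (K : CurvAlg V) (i : EuclideanSpace ℝ (Fin k) →ₗ[ℝ] V)
    (pr : V →ₗ[ℝ] EuclideanSpace ℝ (Fin k)) :
    EuclideanSpace ℝ (Fin k) →ₗ[ℝ] EuclideanSpace ℝ (Fin k) →ₗ[ℝ]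
      EuclideanSpace ℝ (Fin k) →ₗ[ℝ] EuclideanSpace ℝ (Fin k) :=
  LinearMap.mk₂ ℝ (fun a b => pr ∘ₗ K.R (i a) (i b) ∘ₗ i)
    (fun a b c => by ext1; simp) (fun t a b => by ext1; simp)
    (fun a b c => by ext1; simp) (fun t a b => by ext1; simp)

/-- The mixed part of the curvature on the screen space. -/
def screenC (K : CurvAlg V) (n : V) (i : EuclideanSpace ℝ (Fin k) →ₗ[ℝ] V)
    (pr : V →ₗ[ℝ] EuclideanSpace ℝ (Fin k)) :
    EuclideanSpace ℝ (Fin k) →ₗ[ℝ] EuclideanSpace ℝ (Fin k) →ₗ[ℝ] EuclideanSpace ℝ (Fin k) :=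
  (K.R.compl₁₂ i i).compr₂ (-(pr ∘ₗ LinearMap.applyₗ n))

/-- The partial transpose of the mixed part of the curvature on the screen space. -/
def screenCt (K : CurvAlg V) (n : V) (i : EuclideanSpace ℝ (Fin k) →ₗ[ℝ] V)
    (pr : V →ₗ[ℝ] EuclideanSpace ℝ (Fin k)) :
    EuclideanSpace ℝ (Fin k) →ₗ[ℝ] EuclideanSpace ℝ (Fin k) →ₗ[ℝ] EuclideanSpace ℝ (Fin k) :=
  ((K.R n).compl₁₂ i i).compr₂ pr

theorem screenR_apply (a b c : EuclideanSpace ℝ (Fin k)) :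
    screenR K i pr a b c = pr (K.R (i a) (i b) (i c)) := rfl

theorem screenC_apply (a b : EuclideanSpace ℝ (Fin k)) :
    screenC K n i pr a b = -pr (K.R (i a) (i b) n) := rfl

theorem screenCt_apply (a b : EuclideanSpace ℝ (Fin k)) :
    screenCt K n i pr a b = pr (K.R n (i a) (i b)) := rfl

theorem IsScreen.screenData (hS : IsScreen K l n i pr) (hR : K.RAxis l) :
    ScreenData (screenR K i pr) (screenC K n i pr) (screenCt K n i pr) := by
  refine ⟨fun a b c => ?_, fun a b c d => ?_, fun a b c d => ?_, fun a b c => ?_, fun a b => ?_,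
    fun a b c => ?_, fun a b c => ?_, fun e f a b c => ?_, fun e f c d => ?_, fun a c d e => ?_,
    fun a => ⟨pr (K.R n (i a) n), fun c d => ?_⟩⟩ <;>
  simp only [screenR_apply, screenC_apply, screenCt_apply, inner_neg_left, hS.adjoint, map_neg,
    hS.R_right hR (hR.orth _ _ _), hS.R_left hR (hR.orth _ _ _), hS.R_mid hR (hR.orth _ _ _)]
  · rw [K.R_anti, map_neg]
  · rw [real_inner_comm, hS.adjoint, K.R_skew, K.G_symm]
  · rw [K.R_pair, K.R_skew, K.G_symm, K.R_anti]; simp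
  · rw [← map_add, ← map_add, K.R_bianchi, map_zero]
  · rw [K.R_anti, map_neg]
  · have h1 := congrArg (K.G n) (K.R_bianchi (i a) (i b) (i c))
    simp only [map_add, map_zero] at h1
    rw [K.R_skew, K.R_skew _ _ n, K.R_skew _ _ n]
    linarith
  · rw [K.R_pair, K.R_anti]; simp
  · rw [K.R_R]; simp
  · rw [K.R_R]; simp; abel
  · rw [K.R_R]; simp
  · rw [K.R_R]; simp; abel

/-- The conjugate null vector may be chosen orthogonal to all curvature values on `lᗮ`. -/
theorem exists_isConj_orth [FiniteDimensional ℝ V] (h : K.IsAxis l) (hR : K.RAxis l) :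
    ∃ n, K.IsConj l n ∧ ∀ a b c, K.G l a = 0 → K.G l b = 0 → K.G l c = 0 →
      K.G n (K.R a b c) = 0 := by
  obtain ⟨n, hnn, hln⟩ := K.lorentz.exists_null_pair h.null h.ne
  obtain ⟨k, i, pr, hS⟩ := exists_isScreen h ⟨hnn, hln⟩
  obtain ⟨w, hw⟩ := (hS.screenData hR).exists_eq
  simp only [screenR_apply, screenC_apply] at hw
  have hnl : K.G n l = -1 := by rw [K.G_symm, hln]
  have hil : ∀ x, K.G (i x) l = 0 := fun x => by rw [K.G_symm, hS.left]
  have hin : ∀ x, K.G (i x) n = 0 := fun x => by rw [K.G_symm, hS.right]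
  refine ⟨n + i w + (inner ℝ w w / 2) • l, ⟨?_, ?_⟩, fun a b c ha hb hc => ?_⟩
  · simp only [map_add, map_smul, LinearMap.add_apply, LinearMap.smul_apply, hnn, hS.left,
      hS.right, hS.isometry, hin, hil, hnl, hln, h.null, smul_eq_mul]
    ring
  · simp [hln, hS.left, h.null]
  · rw [← hS.R_right hR hc, ← hS.R_left hR ha, ← hS.R_mid hR hb]
    have h1 := congrArg (fun z => inner ℝ z (pr c)) (hw (pr a) (pr b))
    simp only [inner_neg_left, hS.adjoint] at h1
    rw [K.R_skew, K.R_skew] at h1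
    simp only [map_add, map_smul, LinearMap.add_apply, LinearMap.smul_apply, hR.orth]
    simp only [smul_eq_mul]
    linarith

/-- A decomposition of the tangent space adapted to the curvature: the null pair `l, n`, the plane
wave directions (`iN`) and the locally symmetric directions (`iD`). -/
structure IsAdapted (K : CurvAlg V) (l n : V) {d m : ℕ} (iN : EuclideanSpace ℝ (Fin d) →ₗ[ℝ] V)
    (prN : V →ₗ[ℝ] EuclideanSpace ℝ (Fin d)) (iD : EuclideanSpace ℝ (Fin m) →ₗ[ℝ] V)
    (prD : V →ₗ[ℝ] EuclideanSpace ℝ (Fin m)) : Prop where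
  axis : K.IsAxis l
  rAxis : K.RAxis l
  conj : K.IsConj l n
  orth : ∀ a b c, K.G l a = 0 → K.G l b = 0 → K.G l c = 0 → K.G n (K.R a b c) = 0
  isometryN : ∀ x y, K.G (iN x) (iN y) = inner ℝ x y
  isometryD : ∀ x y, K.G (iD x) (iD y) = inner ℝ x y
  leftN : ∀ x, K.G l (iN x) = 0
  rightN : ∀ x, K.G n (iN x) = 0
  leftD : ∀ x, K.G l (iD x) = 0
  rightD : ∀ x, K.G n (iD x) = 0
  orthND : ∀ x y, K.G (iN x) (iD y) = 0
  decomp : ∀ v, v = (-K.G n v) • l + (-K.G l v) • n + iN (prN v) + iD (prD v)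
  adjointN : ∀ v x, inner ℝ (prN v) x = K.G v (iN x)
  adjointD : ∀ v x, inner ℝ (prD v) x = K.G v (iD x)
  R_mem : ∀ a b c, K.G l a = 0 → K.G l b = 0 → K.G l c = 0 → ∃ x, K.R a b c = iD x
  span : ∀ x, (∀ a b c, K.G l a = 0 → K.G l b = 0 → K.G l c = 0 → K.G (K.R a b c) (iD x) = 0) →
    x = 0
  mixed : ∀ z x, K.G (K.R n z n) (iD x) = 0
  T_D : ∀ z x, K.G (K.T n n z n) (iD x) = 0

theorem exists_isAdapted [FiniteDimensional ℝ V] (hT : K.T ≠ 0) :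
    ∃ (l n : V) (d m : ℕ) (iN : EuclideanSpace ℝ (Fin d) →ₗ[ℝ] V)
    (prN : V →ₗ[ℝ] EuclideanSpace ℝ (Fin d)) (iD : EuclideanSpace ℝ (Fin m) →ₗ[ℝ] V)
    (prD : V →ₗ[ℝ] EuclideanSpace ℝ (Fin m)), IsAdapted K l n iN prN iD prD := by
  obtain ⟨l, hl0, hll, h3, h4⟩ := K.exists_null hT
  have hax : K.IsAxis l := ⟨hl0, hll, h3, h4⟩
  obtain ⟨n₀, hn1, hn2⟩ := K.lorentz.exists_null_pair hll hl0
  have hR : K.RAxis l := fun y z => R_axis hax hT ⟨hn1, hn2⟩ y z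
  obtain ⟨n, hn, ho⟩ := exists_isConj_orth hax hR
  have hnl : K.G n l = -1 := by rw [K.G_symm, hn.pairing]
  set S : Submodule ℝ V := LinearMap.ker (K.G l) ⊓ LinearMap.ker (K.G n) with hS
  have hpos : ∀ v ∈ S, v ≠ 0 → 0 < K.G v v := fun v hv hv0 =>
    K.lorentz.pos_of_orthogonal_null hll hl0 hn.pairing hv.1 hv.2 hv0
  set D : Submodule ℝ V := Submodule.span ℝ {v | ∃ a b c, K.G l a = 0 ∧ K.G l b = 0 ∧ K.G l c = 0 ∧
    v = K.R a b c} with hD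
  have hRD : ∀ a b c, K.G l a = 0 → K.G l b = 0 → K.G l c = 0 → K.R a b c ∈ D :=
    fun a b c ha hb hc => Submodule.subset_span ⟨a, b, c, ha, hb, hc, rfl⟩
  have hDle : D ≤ S := Submodule.span_le.2 (by
    rintro _ ⟨a, b, c, ha, hb, hc, rfl⟩
    exact ⟨hR.orth a b c, ho a b c ha hb hc⟩)
  have hDmap : ∀ z, ∀ v ∈ D, K.R n z v ∈ D := by
    intro z v hv
    induction hv using Submodule.span_induction with
    | mem v hv =>
      obtain ⟨a, b, c, ha, hb, hc, rfl⟩ := hv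
      rw [K.R_R]
      exact D.add_mem (D.add_mem (hRD _ _ _ (hR.orth _ _ _) hb hc)
        (hRD _ _ _ ha (hR.orth _ _ _) hc)) (hRD _ _ _ ha hb (hR.orth _ _ _))
    | zero => simp
    | add x y _ _ hx hy => rw [map_add]; exact D.add_mem hx hy
    | smul t x _ hx => rw [map_smul]; exact D.smul_mem _ hx
  have hDT : ∀ z, ∀ v ∈ D, K.T n n z v = 0 := by
    intro z v hv
    induction hv using Submodule.span_induction with
    | mem v hv =>
      obtain ⟨a, b, c, ha, hb, hc, rfl⟩ := hv
      exact hax.T_R_orth hR hn ha hb hc z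
    | zero => simp
    | add x y _ _ hx hy => rw [map_add, hx, hy, add_zero]
    | smul t x _ hx => rw [map_smul, hx, smul_zero]
  obtain ⟨m, iD, prD, hD1, hD2, hD3, hD4⟩ := exists_euclidean_coords K.G_symm D
    fun v hv => hpos v (hDle hv)
  set N : Submodule ℝ V := S ⊓ LinearMap.BilinForm.orthogonal K.G D with hN
  obtain ⟨d, iN, prN, hN1, hN2, hN3, hN4⟩ := exists_euclidean_coords K.G_symm N
    fun v hv => hpos v hv.1
  have hND : ∀ x y, K.G (iN x) (iD y) = 0 := fun x y => by
    rw [K.G_symm]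
    exact (LinearMap.BilinForm.mem_orthogonal_iff.1 (hN2 x).2) _ (hD2 y)
  have hlN : ∀ x, K.G l (iN x) = 0 := fun x => (hN2 x).1.1
  have hnN : ∀ x, K.G n (iN x) = 0 := fun x => (hN2 x).1.2
  have hlD : ∀ x, K.G l (iD x) = 0 := fun x => (hDle (hD2 x)).1
  have hnD : ∀ x, K.G n (iD x) = 0 := fun x => (hDle (hD2 x)).2
  refine ⟨l, n, d, m, iN, prN, iD, prD, hax, hR, hn, ho, hN1, hD1, hlN, hnN, hlD, hnD, hND,
    fun v => ?_, hN3, hD3, fun a b c ha hb hc => ⟨_, (hD4 _ (hRD a b c ha hb hc)).symm⟩,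
    fun x hx => ?_, fun z x => ?_, fun z x => ?_⟩
  · set p := v - ((-K.G n v) • l + (-K.G l v) • n) with hp
    have hpS : p ∈ S := ⟨by simp [hp, hll, hn.pairing], by simp [hp, hn.null, hnl]⟩
    have hprD : prD p = prD v := ext_inner_right ℝ fun x => by
      rw [hD3, hD3, hp]; simp [hlD, hnD]
    have hq : p - iD (prD v) ∈ N := by
      refine ⟨S.sub_mem hpS (hDle (hD2 _)), LinearMap.BilinForm.mem_orthogonal_iff.2 fun x hx => ?_⟩
      change K.G x (p - iD (prD v)) = 0
      rw [← hD4 x hx, map_sub, hD1, ← hprD, real_inner_comm, hD3, K.G_symm, sub_self]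
    have hprN : prN (p - iD (prD v)) = prN v := ext_inner_right ℝ fun x => by
      have : ∀ y, K.G (iD y) (iN x) = 0 := fun y => by rw [K.G_symm, hND]
      rw [hN3, hN3, hp]; simp [hlN, hnN, this]
    have := hN4 _ hq
    rw [hprN] at this
    rw [this, hp]
    abel
  · have : ∀ v ∈ D, K.G v (iD x) = 0 := by
      intro v hv
      induction hv using Submodule.span_induction with
      | mem v hv =>
        obtain ⟨a, b, c, ha, hb, hc, rfl⟩ := hv
        exact hx a b c ha hb hc
      | zero => simp
      | add x y _ _ hx hy => rw [map_add, LinearMap.add_apply, hx, hy, add_zero]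
      | smul t x _ hx => rw [map_smul, LinearMap.smul_apply, hx, smul_zero]
    have h1 := this _ (hD2 x)
    rw [hD1] at h1
    exact inner_self_eq_zero.1 h1
  · rw [K.R_skew, (hDle (hDmap z _ (hD2 x))).2, neg_zero]
  · rw [K.T_skew, hDT z _ (hD2 x)]; simp

end CurvAlg

end

section

/-- The flat Lorentzian form in null coordinates. -/
def cwDot {d : ℕ} (a b : Fin (d + 2) → ℝ) : ℝ :=
  -(a 0 * b 1) - a 1 * b 0 + ∑ i : Fin d, a i.succ.succ * b i.succ.succ

/-- The curvature tensor of a plane wave with profile matrix `P`. -/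
def cwQ {d : ℕ} (P : Matrix (Fin d) (Fin d) ℝ) (w c a b : Fin (d + 2) → ℝ) : ℝ :=
  2 * ∑ i, ∑ j, (w i.succ.succ * c 0 - c i.succ.succ * w 0) * P i j *
    (a j.succ.succ * b 0 - b j.succ.succ * a 0)

namespace CurvAlg

variable {V : Type*} [AddCommGroup V] [Module ℝ V] {K : CurvAlg V} {l n : V} {d m : ℕ}
  {iN : EuclideanSpace ℝ (Fin d) →ₗ[ℝ] V} {prN : V →ₗ[ℝ] EuclideanSpace ℝ (Fin d)}
  {iD : EuclideanSpace ℝ (Fin m) →ₗ[ℝ] V} {prD : V →ₗ[ℝ] EuclideanSpace ℝ (Fin m)}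

theorem IsAdapted.R_N (h : IsAdapted K l n iN prN iD prD) {a b : V} (ha : K.G l a = 0)
    (hb : K.G l b = 0) (e : EuclideanSpace ℝ (Fin d)) : K.R a b (iN e) = 0 := by
  obtain ⟨x, hx⟩ := h.R_mem a b (iN e) ha hb (h.leftN e)
  have h1 : K.G (K.R a b (iN e)) (iD x) = 0 := by
    obtain ⟨y, hy⟩ := h.R_mem a b (iD x) ha hb (h.leftD x)
    rw [K.R_skew, hy, h.orthND, neg_zero]
  rw [hx, h.isometryD] at h1
  rw [hx, inner_self_eq_zero.1 h1, map_zero]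

theorem IsAdapted.R_n (h : IsAdapted K l n iN prN iD prD) {a b : V} (ha : K.G l a = 0)
    (hb : K.G l b = 0) : K.R a b n = 0 := by
  refine K.lorentz.nondeg fun w => ?_
  have h1 : K.G (K.R a b n) (w - (-K.G l w) • n) = 0 := by
    rw [K.R_skew, h.orth a b _ ha hb (by simp [h.conj.pairing]), neg_zero]
  have h2 : K.G (K.R a b n) n = 0 := by
    have := K.R_skew a b n n
    rw [K.G_symm n] at this
    linarith
  simpa [h2] using h1

theorem IsAdapted.R_eq_D (h : IsAdapted K l n iN prN iD prD) {a b c w : V} (ha : K.G l a = 0)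
    (hb : K.G l b = 0) (hc : K.G l c = 0) (hw : K.G l w = 0) :
    K.G (K.R a b c) w = K.G (K.R (iD (prD a)) (iD (prD b)) (iD (prD c))) (iD (prD w)) := by
  have step : ∀ a b c w, K.G l a = 0 → K.G l b = 0 → K.G l c = 0 → K.G l w = 0 →
      K.G (K.R a b c) w = K.G (K.R a b (iD (prD c))) w := fun a b c w ha hb hc hw => by
    conv_lhs => rw [h.decomp c, hc]
    simp only [neg_zero, zero_smul, add_zero, map_add, map_smul, h.R_N ha hb,
      show ∀ y z, K.R y z l = 0 from h.rAxis, smul_zero, zero_add]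
  have flip : ∀ a b c w, K.G (K.R a b c) w = K.G (K.R b a w) c := fun a b c w => by
    rw [K.R_anti, map_neg, LinearMap.neg_apply, K.R_skew, K.G_symm, neg_neg]
  have hD := h.leftD
  rw [step a b c w ha hb hc hw, flip, step _ _ _ _ hb ha hw (hD _), flip, K.R_pair,
    step _ _ _ _ (hD _) (hD _) ha hb, flip, step _ _ _ _ (hD _) (hD _) hb (hD _), flip, K.R_pair]

theorem IsAdapted.R_form (h : IsAdapted K l n iN prN iD prD) (a b c w : V) :
    K.G (K.R a b c) w = K.G (K.R n ((-K.G l c) • w - (-K.G l w) • c) n)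
      ((-K.G l a) • b - (-K.G l b) • a) +
      K.G (K.R (iD (prD a)) (iD (prD b)) (iD (prD c))) (iD (prD w)) := by
  have hz : ∀ v, K.G l (v - (-K.G l v) • n) = 0 := fun v => by simp [h.conj.pairing]
  have hpD : ∀ v, prD (v - (-K.G l v) • n) = prD v := fun v => ext_inner_right ℝ fun x => by
    rw [h.adjointD, h.adjointD]; simp [h.rightD]
  have h0 : K.R n n = 0 := LinearMap.ext fun c => by
    have := K.R_anti n n c
    have h2 : (2 : ℝ) • K.R n n c = 0 := by rw [two_smul]; nth_rewrite 1 [this]; simp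
    simpa using h2
  have split : ∀ a b c, K.R a b c = K.R n ((-K.G l a) • b - (-K.G l b) • a) c +
      K.R (a - (-K.G l a) • n) (b - (-K.G l b) • n) c := fun a b c => by
    have h1 : K.R a n c = -K.R n a c := K.R_anti a n c
    simp only [map_sub, map_smul, LinearMap.sub_apply, LinearMap.smul_apply, h0, h1,
      LinearMap.zero_apply]
    module
  have h2 : ∀ a b, K.G l a = 0 → K.G l b = 0 → ∀ c w, K.G (K.R a b c) w =
      K.G (K.R (iD (prD a)) (iD (prD b)) (iD (prD c))) (iD (prD w)) := fun a b ha hb c w => by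
    have hn : K.R a b n = 0 := h.R_n ha hb
    have e1 : K.R a b c = K.R a b (c - (-K.G l c) • n) := by simp [hn]
    have e2 : ∀ v, K.G l v = 0 → K.G (K.R a b v) w = K.G (K.R a b v) (w - (-K.G l w) • n) :=
      fun v hv => by
        have : K.G (K.R a b v) n = 0 := by rw [K.R_skew, hn]; simp
        simp [this]
    rw [e1, e2 _ (hz c), h.R_eq_D ha hb (hz c) (hz w), hpD, hpD]
  have hx : K.G l ((-K.G l a) • b - (-K.G l b) • a) = 0 := by simp [mul_comm]
  rw [split a b c, map_add, LinearMap.add_apply, h2 _ _ (hz a) (hz b), hpD, hpD, K.R_pair,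
    split c w n, h.R_n (hz c) (hz w), add_zero]

/-- The adapted frame. -/
def frame (l n : V) (iN : EuclideanSpace ℝ (Fin d) →ₗ[ℝ] V)
    (iD : EuclideanSpace ℝ (Fin m) →ₗ[ℝ] V) : (Fin (d + 2 + m) → ℝ) →ₗ[ℝ] V where
  toFun y := split1 y 0 • n + split1 y 1 • l +
    iN (WithLp.toLp 2 fun i => split1 y i.succ.succ) + iD (WithLp.toLp 2 (split2 y))
  map_add' y z := by
    have h1 : split1 (n₁ := d + 2) (y + z) = split1 y + split1 z := rfl
    have h2 : split2 (n₁ := d + 2) (y + z) = split2 y + split2 z := rfl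
    have h3 : (fun i : Fin d => (split1 y + split1 z) i.succ.succ) =
      (fun i => split1 y i.succ.succ) + fun i => split1 z i.succ.succ := rfl
    rw [h1, h2, h3, WithLp.toLp_add, WithLp.toLp_add, map_add, map_add]
    simp only [Pi.add_apply]
    module
  map_smul' t y := by
    have h1 : split1 (n₁ := d + 2) (t • y) = t • split1 y := rfl
    have h2 : split2 (n₁ := d + 2) (t • y) = t • split2 y := rfl
    have h3 : (fun i : Fin d => (t • split1 y) i.succ.succ) =
      t • fun i => split1 y i.succ.succ := rfl
    rw [h1, h2, h3, WithLp.toLp_smul, WithLp.toLp_smul, map_smul, map_smul]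
    simp only [Pi.smul_apply, RingHom.id_apply]
    module

theorem frame_apply (y : Fin (d + 2 + m) → ℝ) : frame l n iN iD y = split1 y 0 • n +
    split1 y 1 • l + iN (WithLp.toLp 2 fun i => split1 y i.succ.succ) +
    iD (WithLp.toLp 2 (split2 y)) := rfl

theorem IsAdapted.left_frame (h : IsAdapted K l n iN prN iD prD) (y : Fin (d + 2 + m) → ℝ) :
    K.G l (frame l n iN iD y) = -split1 y 0 := by
  simp [frame_apply, h.leftN, h.leftD, h.conj.pairing, h.axis.null]

theorem IsAdapted.right_frame (h : IsAdapted K l n iN prN iD prD) (y : Fin (d + 2 + m) → ℝ) :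
    K.G n (frame l n iN iD y) = -split1 y 1 := by
  simp [frame_apply, h.rightN, h.rightD, K.G_symm n l, h.conj.pairing, h.conj.null]

theorem IsAdapted.prN_frame (h : IsAdapted K l n iN prN iD prD) (y : Fin (d + 2 + m) → ℝ) :
    prN (frame l n iN iD y) = WithLp.toLp 2 fun i => split1 y i.succ.succ :=
  ext_inner_right ℝ fun x => by
    rw [h.adjointN, frame_apply]
    simp [h.leftN, h.rightN, h.isometryN, K.G_symm (iD _), h.orthND]

theorem IsAdapted.prD_frame (h : IsAdapted K l n iN prN iD prD) (y : Fin (d + 2 + m) → ℝ) :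
    prD (frame l n iN iD y) = WithLp.toLp 2 (split2 y) :=
  ext_inner_right ℝ fun x => by
    rw [h.adjointD, frame_apply]
    simp [h.leftD, h.rightD, h.isometryD, h.orthND]

theorem IsAdapted.bijective_frame (h : IsAdapted K l n iN prN iD prD) :
    Function.Bijective (frame l n iN iD) := by
  constructor
  · rw [injective_iff_map_eq_zero]
    intro y hy
    have h0 := h.left_frame y
    have h1 := h.right_frame y
    have h2 := h.prN_frame y
    have h3 := h.prD_frame y
    rw [hy, map_zero] at h0 h1 h2 h3
    have e0 : split1 y 0 = 0 := by linarith
    have e1 : split1 y 1 = 0 := by linarith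
    ext j
    refine Fin.addCases (fun i => ?_) (fun j => ?_) j
    · change split1 y i = 0
      refine Fin.cases e0 (fun i => ?_) i
      refine Fin.cases e1 (fun i => ?_) i
      exact (congrFun (congrArg WithLp.ofLp h2) i).symm
    · exact (congrFun (congrArg WithLp.ofLp h3) j).symm
  · intro v
    refine ⟨Fin.append (Matrix.vecCons (-K.G l v) (Matrix.vecCons (-K.G n v) (prN v).ofLp))
      (prD v).ofLp, ?_⟩
    have h1 : split1 (Fin.append (Matrix.vecCons (-K.G l v)
        (Matrix.vecCons (-K.G n v) (prN v).ofLp)) (prD v).ofLp) =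
        Matrix.vecCons (-K.G l v) (Matrix.vecCons (-K.G n v) (prN v).ofLp) :=
      funext fun i => Fin.append_left _ _ _
    have h2 : split2 (Fin.append (Matrix.vecCons (-K.G l v)
        (Matrix.vecCons (-K.G n v) (prN v).ofLp)) (prD v).ofLp) = (prD v).ofLp :=
      funext fun i => Fin.append_right _ _ _
    rw [frame_apply, h1, h2]
    conv_rhs => rw [h.decomp v]
    simp only [Matrix.cons_val_zero, Matrix.cons_val_one, Matrix.cons_val_succ,
      WithLp.toLp_ofLp]
    abel

theorem IsAdapted.G_frame (h : IsAdapted K l n iN prN iD prD) (y z : Fin (d + 2 + m) → ℝ) :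
    K.G (frame l n iN iD y) (frame l n iN iD z) =
      cwDot (split1 y) (split1 z) + ∑ j, split2 y j * split2 z j := by
  conv_lhs => rw [frame_apply (y := y)]
  simp only [map_add, map_smul, LinearMap.add_apply, LinearMap.smul_apply, h.left_frame,
    h.right_frame]
  rw [K.G_symm (iN _), ← h.adjointN, h.prN_frame, K.G_symm (iD _), ← h.adjointD, h.prD_frame]
  simp only [cwDot, PiLp.inner_apply, smul_eq_mul, RCLike.inner_apply, conj_trivial]
  ring

/-- A bilinear form on Euclidean space in coordinates. -/
theorem bilin_eq_sum (B : EuclideanSpace ℝ (Fin d) →ₗ[ℝ] EuclideanSpace ℝ (Fin d) →ₗ[ℝ] ℝ)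
    (x y : EuclideanSpace ℝ (Fin d)) : B x y = ∑ i, ∑ j, x i *
      B (EuclideanSpace.basisFun (Fin d) ℝ i) (EuclideanSpace.basisFun (Fin d) ℝ j) * y j := by
  conv_lhs => rw [← (EuclideanSpace.basisFun (Fin d) ℝ).sum_repr x,
    ← (EuclideanSpace.basisFun (Fin d) ℝ).sum_repr y]
  simp only [map_sum, map_smul, LinearMap.sum_apply, LinearMap.smul_apply, smul_eq_mul,
    EuclideanSpace.basisFun_repr, Finset.mul_sum]
  rw [Finset.sum_comm]
  exact Finset.sum_congr rfl fun i _ => Finset.sum_congr rfl fun j _ => by ring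

theorem IsAdapted.form_frame (h : IsAdapted K l n iN prN iD prD) (Q : V →ₗ[ℝ] V →ₗ[ℝ] ℝ)
    (hs : ∀ a b, Q a b = Q b a) (hl : ∀ a, Q a l = 0) (hD : ∀ a x, Q a (iD x) = 0)
    (w c a b : Fin (d + 2 + m) → ℝ) :
    Q ((-K.G l (frame l n iN iD c)) • frame l n iN iD w -
      (-K.G l (frame l n iN iD w)) • frame l n iN iD c)
      ((-K.G l (frame l n iN iD a)) • frame l n iN iD b -
      (-K.G l (frame l n iN iD b)) • frame l n iN iD a) =
    cwQ (Matrix.of fun i j => -(1 / 2) * Q (iN (EuclideanSpace.basisFun (Fin d) ℝ i))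
      (iN (EuclideanSpace.basisFun (Fin d) ℝ j))) (split1 w) (split1 c) (split1 a) (split1 b) := by
  have hx : ∀ a b : V, K.G l a = 0 → K.G l b = 0 → Q a b = Q (iN (prN a)) (iN (prN b)) := by
    intro a b ha hb
    conv_lhs => rw [h.decomp a, h.decomp b, ha, hb]
    simp only [neg_zero, zero_smul, add_zero, map_add, map_smul, LinearMap.add_apply,
      LinearMap.smul_apply, hl, hD, hs l, hs (iD _), smul_zero, zero_add]
  rw [hx _ _ (by simp [mul_comm]) (by simp [mul_comm])]
  have := bilin_eq_sum (Q.compl₁₂ iN iN)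
  simp only [LinearMap.compl₁₂_apply] at this
  rw [this, cwQ, Finset.mul_sum]
  refine Finset.sum_congr rfl fun i _ => ?_
  rw [Finset.mul_sum]
  refine Finset.sum_congr rfl fun j _ => ?_
  simp only [map_sub, map_smul, h.prN_frame, h.left_frame, Matrix.of_apply]
  simp
  ring

/-- Normal form of the curvature and its derivative at a point. -/
theorem exists_normal_form [FiniteDimensional ℝ V] (K : CurvAlg V) (hT : K.T ≠ 0) :
    ∃ (d m : ℕ) (F : (Fin (d + 2 + m) → ℝ) →ₗ[ℝ] V) (α β : Matrix (Fin d) (Fin d) ℝ)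
      (r : (Fin m → ℝ) → (Fin m → ℝ) → (Fin m → ℝ) → (Fin m → ℝ) → ℝ),
      Function.Bijective F ∧ α.IsSymm ∧ β.IsSymm ∧ α ≠ 0 ∧
      (∀ y z, K.G (F y) (F z) =
        cwDot (split1 y) (split1 z) + ∑ j, split2 y j * split2 z j) ∧
      (∀ w c a b, K.G (K.R (F a) (F b) (F c)) (F w) =
        cwQ β (split1 w) (split1 c) (split1 a) (split1 b) +
          r (split2 w) (split2 c) (split2 a) (split2 b)) ∧
      (∀ e w c a b, K.G (K.T (F e) (F a) (F b) (F c)) (F w) =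
        split1 e 0 * cwQ α (split1 w) (split1 c) (split1 a) (split1 b)) ∧
      (0 < m → ∃ w c a b, r w c a b ≠ 0) := by
  obtain ⟨l, n, d, m, iN, prN, iD, prD, h⟩ := exists_isAdapted hT
  let QR : V →ₗ[ℝ] V →ₗ[ℝ] ℝ := K.G ∘ₗ (K.R n).flip n
  let QT : V →ₗ[ℝ] V →ₗ[ℝ] ℝ := K.G ∘ₗ (K.T n n).flip n
  have hQR : ∀ a b, QR a b = K.G (K.R n a n) b := fun a b => rfl
  have hQT : ∀ a b, QT a b = K.G (K.T n n a n) b := fun a b => rfl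
  have hQRs : ∀ a b, QR a b = QR b a := fun a b => by rw [hQR, hQR, K.R_pair]
  have hQTs : ∀ a b, QT a b = QT b a := fun a b => by rw [hQT, hQT, K.T_pair]
  have hF : ∀ e w c a b, K.G (K.T (frame l n iN iD e) (frame l n iN iD a) (frame l n iN iD b)
      (frame l n iN iD c)) (frame l n iN iD w) = split1 e 0 *
      cwQ (Matrix.of fun i j => -(1 / 2) * QT (iN (EuclideanSpace.basisFun (Fin d) ℝ i))
      (iN (EuclideanSpace.basisFun (Fin d) ℝ j))) (split1 w) (split1 c) (split1 a)
      (split1 b) := fun e w c a b => by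
    rw [h.axis.T_form h.conj, ← hQT, h.form_frame QT hQTs
      (fun a => by rw [hQT, K.T_skew, h.axis.T_right]; simp) (fun a x => h.T_D a x),
      h.left_frame, neg_neg]
  refine ⟨d, m, frame l n iN iD, _, Matrix.of fun i j => -(1 / 2) *
    QR (iN (EuclideanSpace.basisFun (Fin d) ℝ i)) (iN (EuclideanSpace.basisFun (Fin d) ℝ j)),
    fun w c a b => K.G (K.R (iD (WithLp.toLp 2 a)) (iD (WithLp.toLp 2 b)) (iD (WithLp.toLp 2 c)))
      (iD (WithLp.toLp 2 w)), h.bijective_frame, ?_, ?_, ?_, h.G_frame, fun w c a b => ?_,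
      hF, fun hm => ?_⟩
  · exact Matrix.IsSymm.ext fun i j => by simp only [Matrix.of_apply]; rw [hQTs]
  · exact Matrix.IsSymm.ext fun i j => by simp only [Matrix.of_apply]; rw [hQRs]
  · intro h0
    refine hT (LinearMap.ext fun e => LinearMap.ext fun a => LinearMap.ext fun b =>
      LinearMap.ext fun c => K.lorentz.nondeg fun w => ?_)
    obtain ⟨e, rfl⟩ := h.bijective_frame.2 e
    obtain ⟨a, rfl⟩ := h.bijective_frame.2 a
    obtain ⟨b, rfl⟩ := h.bijective_frame.2 b
    obtain ⟨c, rfl⟩ := h.bijective_frame.2 c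
    obtain ⟨w, rfl⟩ := h.bijective_frame.2 w
    rw [hF, h0]
    simp [cwQ]
  · rw [h.R_form, ← hQR, h.form_frame QR hQRs
      (fun a => by rw [hQR, K.R_skew, h.rAxis]; simp) (fun a x => h.mixed a x),
      h.prD_frame, h.prD_frame, h.prD_frame, h.prD_frame]
  · by_contra hcon
    push Not at hcon
    have : EuclideanSpace.single (⟨0, hm⟩ : Fin m) (1 : ℝ) = 0 := by
      refine h.span _ fun a b c ha hb hc => ?_
      have e : prD (iD (EuclideanSpace.single (⟨0, hm⟩ : Fin m) (1 : ℝ))) =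
          EuclideanSpace.single (⟨0, hm⟩ : Fin m) (1 : ℝ) := ext_inner_right ℝ fun x => by
        rw [h.adjointD, h.isometryD]
      rw [h.R_eq_D ha hb hc (h.leftD _)]
      exact hcon (prD _).ofLp (prD c).ofLp (prD a).ofLp (prD b).ofLp
    simpa using congrArg norm this

end CurvAlg

end

section

variable {n : ℕ} {g : MetricMat n} {U : Set (Fin n → ℝ)} {x : Fin n → ℝ}
  {F : (Fin n → ℝ) →L[ℝ] (Fin n → ℝ)}

theorem gB_ext (hg : IsMetricOn g U) (hx : x ∈ U) {u v : Fin n → ℝ}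
    (h : ∀ w, gB g x w u = gB g x w v) : u = v :=
  sub_eq_zero.mp (gB_nondeg (hg.nondeg x hx) fun w => by rw [map_sub, h, sub_self])

theorem Rm_Rm (hg : IsMetricOn g U)
    (h2 : ∀ x ∈ U, ∀ idx, covDeriv g (covDeriv g (riemann g)) x idx = 0) (hx : x ∈ U)
    (y z a b c : Fin n → ℝ) : Rm g x y z (Rm g x a b c) =
      Rm g x (Rm g x y z a) b c + Rm g x a (Rm g x y z b) c + Rm g x a b (Rm g x y z c) := by
  refine gB_ext hg hx fun w => ?_
  have h := Rie_derivation hg h2 hx y z w c a b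
  simp only [Rie_eq hg hx] at h
  rw [map_add, map_add]
  linarith [gB_Rm_skew hg hx y z w (Rm g x a b c)]

theorem Rm_dRm (hg : IsMetricOn g U)
    (h2 : ∀ x ∈ U, ∀ idx, covDeriv g (covDeriv g (riemann g)) x idx = 0) (hx : x ∈ U)
    (y z e a b c : Fin n → ℝ) : Rm g x y z (dRm g x e a b c) =
      dRm g x (Rm g x y z e) a b c + dRm g x e (Rm g x y z a) b c
        + dRm g x e a (Rm g x y z b) c + dRm g x e a b (Rm g x y z c) := by
  refine gB_ext hg hx fun w => ?_
  have h := Nie_derivation hg h2 hx y z e w c a b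
  simp only [Nie_eq hg hx] at h
  rw [map_add, map_add, map_add]
  linarith [gB_Rm_skew hg hx y z w (dRm g x e a b c)]

theorem isLinearMap_of_gB (hg : IsMetricOn g U) (hx : x ∈ U) {f : (Fin n → ℝ) → Fin n → ℝ}
    (h : ∀ w, IsLinearMap ℝ fun u => gB g x w (f u)) : IsLinearMap ℝ f :=
  ⟨fun u v => gB_ext hg hx fun w => by rw [(h w).map_add, map_add],
    fun k u => gB_ext hg hx fun w => by rw [(h w).map_smul, map_smul]⟩

/-- The curvature operator as a trilinear map. -/
def curvLin (g : MetricMat n) (x : Fin n → ℝ) :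
    (Fin n → ℝ) →ₗ[ℝ] (Fin n → ℝ) →ₗ[ℝ] (Fin n → ℝ) →ₗ[ℝ] (Fin n → ℝ) :=
  LinearMap.mk₂ ℝ (fun a b => (Rm g x a b : (Fin n → ℝ) →ₗ[ℝ] (Fin n → ℝ)))
    (fun a a' b => LinearMap.ext fun c => by simp [Rm_apply]; abel)
    (fun k a b => LinearMap.ext fun c => by simp [Rm_apply, smul_sub, smul_add])
    (fun a b b' => LinearMap.ext fun c => by simp [Rm_apply]; abel)
    (fun k a b => LinearMap.ext fun c => by simp [Rm_apply, smul_sub, smul_add])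

@[simp] theorem curvLin_apply (g : MetricMat n) (x a b c : Fin n → ℝ) :
    curvLin g x a b c = Rm g x a b c := rfl

theorem isLinearMap_dRm_zero (hg : IsMetricOn g U) (hx : x ∈ U) (a b c : Fin n → ℝ) :
    IsLinearMap ℝ fun e => dRm g x e a b c :=
  isLinearMap_of_gB hg hx fun w => by
    simp only [← Nie_eq hg hx]
    exact isLinearMap_Nie_left x w c a b

theorem isLinearMap_dRm_two (hg : IsMetricOn g U) (hx : x ∈ U) (e a c : Fin n → ℝ) :
    IsLinearMap ℝ fun b => dRm g x e a b c :=
  isLinearMap_of_gB hg hx fun w => by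
    simp only [← Nie_eq hg hx]
    exact isLinearMap_Nie x e w c a

theorem isLinearMap_dRm_one (hg : IsMetricOn g U) (hx : x ∈ U) (e b c : Fin n → ℝ) :
    IsLinearMap ℝ fun a => dRm g x e a b c := by
  simp only [dRm_antisymm g x e _ b c]
  have h := isLinearMap_dRm_two hg hx e b c
  exact ⟨fun u v => by rw [h.map_add, neg_add], fun k u => by rw [h.map_smul, smul_neg]⟩

theorem isLinearMap_dRm_three (hg : IsMetricOn g U) (hx : x ∈ U) (e a b : Fin n → ℝ) :
    IsLinearMap ℝ fun c => dRm g x e a b c :=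
  isLinearMap_of_gB hg hx fun w => by
    simp only [← Nie_eq hg hx]
    exact isLinearMap_update (ev (covDeriv g (riemann g) x)) (fun u => ![e, w, u, a, b]) 2
      fun u => by ext i; fin_cases i <;> rfl

/-- The derivative of the curvature operator as a multilinear map. -/
def dCurvLin (hg : IsMetricOn g U) (hx : x ∈ U) :
    (Fin n → ℝ) →ₗ[ℝ] (Fin n → ℝ) →ₗ[ℝ] (Fin n → ℝ) →ₗ[ℝ] (Fin n → ℝ) →ₗ[ℝ] (Fin n → ℝ) :=
  LinearMap.mk₂ ℝ (fun e a => LinearMap.mk₂ ℝ (fun b c => dRm g x e a b c)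
      (fun b b' c => (isLinearMap_dRm_two hg hx e a c).map_add b b')
      (fun k b c => (isLinearMap_dRm_two hg hx e a c).map_smul k b)
      (fun b c c' => (isLinearMap_dRm_three hg hx e a b).map_add c c')
      (fun k b c => (isLinearMap_dRm_three hg hx e a b).map_smul k c))
    (fun e e' a => LinearMap.ext₂ fun b c => (isLinearMap_dRm_zero hg hx a b c).map_add e e')
    (fun k e a => LinearMap.ext₂ fun b c => (isLinearMap_dRm_zero hg hx a b c).map_smul k e)
    (fun e a a' => LinearMap.ext₂ fun b c => (isLinearMap_dRm_one hg hx e b c).map_add a a')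
    (fun k e a => LinearMap.ext₂ fun b c => (isLinearMap_dRm_one hg hx e b c).map_smul k a)

@[simp] theorem dCurvLin_apply (hg : IsMetricOn g U) (hx : x ∈ U) (e a b c : Fin n → ℝ) :
    dCurvLin hg hx e a b c = dRm g x e a b c := rfl

theorem gB_dRm_skew (hg : IsMetricOn g U) (hx : x ∈ U) (e a b c d : Fin n → ℝ) :
    gB g x (dRm g x e a b c) d = -gB g x c (dRm g x e a b d) := by
  have h := Nie_antisymm_left hg hx e d c a b
  rw [Nie_eq hg hx, Nie_eq hg hx] at h
  rw [gB_symm (hg.symm x hx), h]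

theorem isLorentzForm_gB (hn : 0 < n) (h : IsLorentzMat (g x)) (hs : (g x).IsSymm) :
    IsLorentzForm (gB g x) := by
  obtain ⟨P, hP, hd⟩ := h
  have hG : ∀ u v, gB g x (P *ᵥ u) (P *ᵥ v) =
      ∑ i : Fin n, (if (i : ℕ) = 0 then (-1 : ℝ) else 1) * (u i * v i) := fun u v => by
    have h1 : (P *ᵥ u) ⬝ᵥ (g x *ᵥ (P *ᵥ v)) = u ⬝ᵥ ((Pᵀ * g x * P) *ᵥ v) := by
      simp only [← Matrix.mulVec_mulVec, Matrix.dotProduct_mulVec, Matrix.vecMul_transpose]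
    rw [gB, Matrix.toLinearMap₂'_apply', h1, hd, dotProduct]
    exact Finset.sum_congr rfl fun i _ => by rw [Matrix.mulVec_diagonal]; ring
  have hsurj : ∀ v, ∃ u, P *ᵥ u = v := (Matrix.mulVec_surjective_iff_isUnit.mpr
    ((Matrix.isUnit_iff_isUnit_det _).mpr hP))
  refine ⟨gB_symm hs, P *ᵥ Pi.single ⟨0, hn⟩ 1, ?_, fun v hv hne => ?_⟩
  · rw [hG, Finset.sum_eq_single ⟨0, hn⟩ (fun i _ hi => by simp [hi]) (by simp)]
    simp
  · obtain ⟨u, rfl⟩ := hsurj v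
    rw [hG, Finset.sum_eq_single ⟨0, hn⟩ (fun i _ hi => by simp [hi]) (by simp)] at hv
    have hu : u ⟨0, hn⟩ = 0 := by simpa using hv
    rw [hG]
    have hterm : ∀ i : Fin n, (if (i : ℕ) = 0 then (-1 : ℝ) else 1) * (u i * u i) = u i * u i :=
      fun i => by
        split_ifs with hi
        · have : i = ⟨0, hn⟩ := Fin.ext hi
          rw [this, hu]; ring
        · ring
    simp only [hterm]
    have hu0 : u ≠ 0 := fun h0 => hne (by rw [h0, Matrix.mulVec_zero])
    obtain ⟨j, hj⟩ := Function.ne_iff.mp hu0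
    exact Finset.sum_pos' (fun i _ => mul_self_nonneg _) ⟨j, Finset.mem_univ _, mul_self_pos.mpr hj⟩

variable {r : ℝ} {ex : (Fin n → ℝ) → Fin n → ℝ}
    {P : (Fin n → ℝ) → (Fin n → ℝ) →L[ℝ] (Fin n → ℝ)}

theorem IsExpMap.Rm_eq (hg : IsMetricOn g U) (hx : x ∈ U)
    (h : IsExpMap g U x (ContinuousLinearMap.id ℝ _) r ex P) {y : Fin n → ℝ}
    (hy : y ∈ Metric.ball (0 : Fin n → ℝ) r) (a b c : Fin n → ℝ) :
    Rm g (ex y) (P y a) (P y b) (P y c) = P y (Rm g x a b c + dRm g x y a b c) := by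
  have hU := h.mapsTo y hy
  refine gB_ext hg hU fun w => ?_
  obtain ⟨w, rfl⟩ := (h.bijective y hy).2 w
  have h1 := h.rie y hy w c a b
  have h2 := h.metric y hy w (Rm g x a b c + dRm g x y a b c)
  simp only [gF_apply, RieF, NieF, ContinuousLinearMap.id_apply, Rie_eq hg hU, Rie_eq hg hx,
    Nie_eq hg hx] at h1 h2
  rw [h1, h2, map_add]

theorem IsExpMap.dRm_eq (hg : IsMetricOn g U) (hx : x ∈ U)
    (h : IsExpMap g U x (ContinuousLinearMap.id ℝ _) r ex P) {y : Fin n → ℝ}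
    (hy : y ∈ Metric.ball (0 : Fin n → ℝ) r) (e a b c : Fin n → ℝ) :
    dRm g (ex y) (P y e) (P y a) (P y b) (P y c) = P y (dRm g x e a b c) := by
  have hU := h.mapsTo y hy
  refine gB_ext hg hU fun w => ?_
  obtain ⟨w, rfl⟩ := (h.bijective y hy).2 w
  have h1 := h.nie y hy e w c a b
  have h2 := h.metric y hy w (dRm g x e a b c)
  simp only [gF_apply, NieF, ContinuousLinearMap.id_apply, Nie_eq hg hU, Nie_eq hg hx] at h1 h2
  rw [h1, h2]

/-- The algebraic data of a second-order symmetric Lorentzian metric at a point. -/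
theorem exists_curvAlg (hg : IsMetricOn g U)
    (h2 : ∀ x ∈ U, ∀ idx, covDeriv g (covDeriv g (riemann g)) x idx = 0) (hx : x ∈ U)
    (hn : 0 < n) (hL : IsLorentzMat (g x)) :
    ∃ K : CurvAlg (Fin n → ℝ), K.G = gB g x ∧ (∀ a b c, K.R a b c = Rm g x a b c) ∧
      ∀ e a b c, K.T e a b c = dRm g x e a b c := by
  obtain ⟨r, ex, P, h⟩ := exists_isExpMap hg h2 hx (F := ContinuousLinearMap.id ℝ _)
    Function.bijective_id
  set R := curvLin g x with hR
  set T := dCurvLin hg hx with hT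
  have hRR : ∀ y z a b c, R y z (R a b c) = R (R y z a) b c + R a (R y z b) c + R a b (R y z c) :=
    Rm_Rm hg h2 hx
  have hRT : ∀ y z e a b c, R y z (T e a b c) =
      T (R y z e) a b c + T e (R y z a) b c + T e a (R y z b) c + T e a b (R y z c) :=
    Rm_dRm hg h2 hx
  have hscale : ∀ v : Fin n → ℝ, ∃ k : ℝ, 0 < k ∧ k • v ∈ Metric.ball (0 : Fin n → ℝ) r :=
    fun v => by
    refine ⟨r / (2 * (‖v‖ + 1)), by have := h.pos; positivity, ?_⟩
    rw [mem_ball_zero_iff, norm_smul, Real.norm_of_nonneg (by have := h.pos; positivity)]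
    have h1 : r / (2 * (‖v‖ + 1)) * ‖v‖ = r * (‖v‖ / (2 * (‖v‖ + 1))) := by ring
    rw [h1]
    have h3 : ‖v‖ / (2 * (‖v‖ + 1)) < 1 := by
      rw [div_lt_one (by positivity)]; linarith [norm_nonneg v]
    nlinarith [h.pos]
  have hS : ∀ v ∈ Metric.ball (0 : Fin n → ℝ) r, ∀ y z a b c,
      (R + T v) y z ((R + T v) a b c) = (R + T v) ((R + T v) y z a) b c
        + (R + T v) a ((R + T v) y z b) c + (R + T v) a b ((R + T v) y z c) :=
    fun v hv y z a b c => by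
    have h1 := Rm_Rm hg h2 (h.mapsTo v hv) (P v y) (P v z) (P v a) (P v b) (P v c)
    simp only [h.Rm_eq hg hx hv, ← map_add (P v)] at h1
    exact (h.bijective v hv).1 h1
  have hST : ∀ v ∈ Metric.ball (0 : Fin n → ℝ) r, ∀ y z e a b c,
      (R + T v) y z (T e a b c) = T ((R + T v) y z e) a b c + T e ((R + T v) y z a) b c
        + T e a ((R + T v) y z b) c + T e a b ((R + T v) y z c) :=
    fun v hv y z e a b c => by
    have h1 := Rm_dRm hg h2 (h.mapsTo v hv) (P v y) (P v z) (P v e) (P v a) (P v b) (P v c)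
    simp only [h.Rm_eq hg hx hv, h.dRm_eq hg hx hv, ← map_add (P v)] at h1
    exact (h.bijective v hv).1 h1
  have hTT : ∀ v y z e a b c, T v y z (T e a b c) =
      T (T v y z e) a b c + T e (T v y z a) b c + T e a (T v y z b) c + T e a b (T v y z c) := by
    intro v y z e a b c
    obtain ⟨k, hk, hv⟩ := hscale v
    have h1 := hST _ hv y z e a b c
    simp only [LinearMap.add_apply, map_add, hRT, map_smul, LinearMap.smul_apply] at h1
    refine smul_right_injective _ hk.ne' ?_
    simp only [smul_add]
    linear_combination (norm := module) h1
  have hneg : ∀ v ∈ Metric.ball (0 : Fin n → ℝ) r, -v ∈ Metric.ball (0 : Fin n → ℝ) r :=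
    fun v hv => by simpa using hv
  have hQ : ∀ v ∈ Metric.ball (0 : Fin n → ℝ) r, ∀ y z a b c, T v y z (T v a b c) =
      T v (T v y z a) b c + T v a (T v y z b) c + T v a b (T v y z c) := fun v hv y z a b c => by
    have h1 := hS _ hv y z a b c
    have h3 := hS _ (hneg v hv) y z a b c
    rw [← neg_one_smul ℝ v] at h3
    simp only [LinearMap.add_apply, map_add, map_smul, LinearMap.smul_apply] at h1 h3
    refine smul_right_injective _ (two_ne_zero' ℝ) ?_
    simp only [two_smul]
    linear_combination (norm := module) h1 + h3 - (2 : ℝ) • hRR y z a b c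
  have hL' : ∀ v ∈ Metric.ball (0 : Fin n → ℝ) r, ∀ y z a b c,
      T v y z (R a b c) + R y z (T v a b c) =
      (T v (R y z a) b c + T v a (R y z b) c + T v a b (R y z c)) +
      (R (T v y z a) b c + R a (T v y z b) c + R a b (T v y z c)) := fun v hv y z a b c => by
    have h1 := hS _ hv y z a b c
    simp only [LinearMap.add_apply, map_add] at h1
    linear_combination (norm := module) h1 - hRR y z a b c - hQ v hv y z a b c
  have hsymm := gB_symm (hg.symm x hx)
  refine ⟨{
    G := gB g x
    R := R
    T := T
    lorentz := isLorentzForm_gB hn hL (hg.symm x hx)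
    R_anti := fun a b c => by simp only [hR, curvLin_apply]; rw [Rm_antisymm]; rfl
    R_skew := fun a b c d => eq_neg_of_add_eq_zero_left (gB_Rm_skew hg hx a b c d)
    R_bianchi := Rm_bianchi hg hx
    T_anti := fun e a b c => dRm_antisymm g x e a b c
    T_skew := gB_dRm_skew hg hx
    T_bianchi := fun e a b c => gB_ext hg hx fun w => by
      have := Nie_bianchi hg hx e w c a b
      simp only [Nie_eq hg hx] at this
      simp only [hT, dCurvLin_apply, map_add, map_zero]
      linarith
    T_bianchi_two := dRm_bianchi hg hx
    R_R := hRR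
    R_T := hRT
    T_T_full := hTT
    T_R := fun v y z a b c => ?_
    T_T := fun v y z a b c => ?_ }, rfl, fun a b c => rfl, fun e a b c => rfl⟩
  · obtain ⟨k, hk, hv⟩ := hscale v
    have h1 := hL' _ hv y z a b c
    simp only [map_smul, LinearMap.smul_apply, ← smul_add] at h1
    exact smul_right_injective _ hk.ne' h1
  · obtain ⟨k, hk, hv⟩ := hscale v
    have h1 := hQ _ hv y z a b c
    simp only [map_smul, LinearMap.smul_apply, ← smul_add] at h1
    exact smul_right_injective _ hk.ne' (smul_right_injective _ hk.ne' h1)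

end

section

variable {d : ℕ}

/-- The screen components of a vector in Brinkmann coordinates. -/
def screen (d : ℕ) : (Fin (d + 2) → ℝ) →ₗ[ℝ] (Fin d → ℝ) :=
  LinearMap.funLeft ℝ ℝ fun i : Fin d => i.succ.succ

/-- The bilinear form of a matrix on the screen components. -/
def scr (M : Matrix (Fin d) (Fin d) ℝ) : (Fin (d + 2) → ℝ) →ₗ[ℝ] (Fin (d + 2) → ℝ) →ₗ[ℝ] ℝ :=
  (Matrix.toLinearMap₂' ℝ M).compl₁₂ (screen d) (screen d)

theorem scr_apply (M : Matrix (Fin d) (Fin d) ℝ) (u v : Fin (d + 2) → ℝ) :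
    scr M u v = ∑ i, ∑ j, M i j * u i.succ.succ * v j.succ.succ := by
  simp only [scr, LinearMap.compl₁₂_apply, Matrix.toLinearMap₂'_apply, smul_eq_mul]
  refine Finset.sum_congr rfl fun i _ => Finset.sum_congr rfl fun j _ => ?_
  change u i.succ.succ * (v j.succ.succ * M i j) = _
  ring

theorem scr_symm {M : Matrix (Fin d) (Fin d) ℝ} (hM : M.IsSymm) (u v : Fin (d + 2) → ℝ) :
    scr M u v = scr M v u := by
  rw [scr_apply, scr_apply, Finset.sum_comm]
  refine Finset.sum_congr rfl fun i _ => Finset.sum_congr rfl fun j _ => ?_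
  rw [hM.apply]; ring

theorem cwQ_eq_scr (M : Matrix (Fin d) (Fin d) ℝ) (w c a b : Fin (d + 2) → ℝ) :
    cwQ M w c a b = 2 * scr M (c 0 • w - w 0 • c) (b 0 • a - a 0 • b) := by
  rw [cwQ, scr_apply]
  congr 1
  refine Finset.sum_congr rfl fun i _ => Finset.sum_congr rfl fun j _ => ?_
  simp only [Pi.sub_apply, Pi.smul_apply, smul_eq_mul]
  ring

theorem cwQ_add (M N : Matrix (Fin d) (Fin d) ℝ) (w c a b : Fin (d + 2) → ℝ) :
    cwQ (M + N) w c a b = cwQ M w c a b + cwQ N w c a b := by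
  simp only [cwQ, Matrix.add_apply, mul_add, add_mul, Finset.sum_add_distrib]

theorem cwQ_smul (k : ℝ) (M : Matrix (Fin d) (Fin d) ℝ) (w c a b : Fin (d + 2) → ℝ) :
    cwQ (k • M) w c a b = k * cwQ M w c a b := by
  simp only [cwQ, Matrix.smul_apply, smul_eq_mul, Finset.mul_sum]
  exact Finset.sum_congr rfl fun i _ => Finset.sum_congr rfl fun j _ => by ring

theorem cwDot_add (w u v : Fin (d + 2) → ℝ) : cwDot w (u + v) = cwDot w u + cwDot w v := by
  simp only [cwDot, Pi.add_apply, mul_add, Finset.sum_add_distrib]; ring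

theorem cwDot_smul (k : ℝ) (w u : Fin (d + 2) → ℝ) : cwDot w (k • u) = k * cwDot w u := by
  simp only [cwDot, Pi.smul_apply, smul_eq_mul, mul_add, Finset.mul_sum]
  rw [Finset.sum_congr rfl fun i _ => mul_left_comm (w (Fin.succ (Fin.succ i))) k _]
  ring

/-- The flat form as a linear map in its second argument. -/
def cwDotL (w : Fin (d + 2) → ℝ) : (Fin (d + 2) → ℝ) →ₗ[ℝ] ℝ where
  toFun := cwDot w
  map_add' := cwDot_add w
  map_smul' := fun k u => cwDot_smul k w u

theorem cwDot_symm (u v : Fin (d + 2) → ℝ) : cwDot u v = cwDot v u := by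
  simp only [cwDot]
  rw [Finset.sum_congr rfl fun i _ => mul_comm (u (Fin.succ (Fin.succ i))) _]
  ring

theorem succ_succ_ne_one (k : Fin d) : (k.succ.succ : Fin (d + 2)) ≠ 1 :=
  Fin.ne_of_val_ne (by simp)

theorem cwDot_single_one (v : Fin (d + 2) → ℝ) : cwDot (Pi.single 1 1) v = -v 0 := by
  simp [cwDot, succ_succ_ne_one]

theorem cwDot_nondeg {v : Fin (d + 2) → ℝ} (h : ∀ w, cwDot w v = 0) : v = 0 := by
  ext k
  refine Fin.cases ?_ (fun k => Fin.cases ?_ (fun i => ?_) k) k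
  · simpa [cwDot_single_one] using h (Pi.single 1 1)
  · simpa [cwDot, Pi.single_apply] using h (Pi.single 0 1)
  · have := h (Pi.single i.succ.succ 1)
    simpa [cwDot, Pi.single_apply, Fin.succ_inj, Fin.succ_ne_zero, (succ_succ_ne_one _).symm]
      using this

variable (α β : Matrix (Fin d) (Fin d) ℝ)

/-- The order-two generalized Cahen-Wallach metric. -/
abbrev cw2 : MetricMat (d + 2) := cwMetric d fun u => u • α + β

/-- The profile form at a point. -/
def prof (x u v : Fin (d + 2) → ℝ) : ℝ := x 0 * scr α u v + scr β u v

theorem gB_cw (x u v : Fin (d + 2) → ℝ) :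
    gB (cw2 α β) x u v = -2 * prof α β x x x * (u 0 * v 0) + cwDot u v := by
  have hp : prof α β x x x = ∑ i, ∑ j, (x 0 • α + β) i j * x i.succ.succ * x j.succ.succ := by
    simp only [prof, scr_apply, Matrix.add_apply, Matrix.smul_apply, smul_eq_mul, add_mul,
      Finset.sum_add_distrib, Finset.mul_sum, mul_assoc]
  rw [gB_apply, hp]
  simp only [cwMetric, cwDot, Fin.sum_univ_succ (n := d + 1), Fin.sum_univ_succ (n := d),
    Fin.succ_zero_eq_one]
  simp [succ_succ_ne_one, (succ_succ_ne_one _).symm, (Fin.succ_ne_zero _).symm, Fin.succ_inj]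
  ring

theorem gB_cw_of_zero (x u : Fin (d + 2) → ℝ) {v : Fin (d + 2) → ℝ} (hv : v 0 = 0) :
    gB (cw2 α β) x u v = cwDot u v := by rw [gB_cw, hv]; ring

theorem isMetricOn_cw : IsMetricOn (cw2 α β) univ where
  isOpen := isOpen_univ
  smooth := fun a b => by
    refine ContDiff.contDiffOn ?_
    unfold cw2 cwMetric
    simp only [Matrix.add_apply, Matrix.smul_apply, smul_eq_mul]
    refine (ContDiff.add ?_ contDiff_const).add contDiff_const
    split_ifs
    · fun_prop
    · exact contDiff_const
  symm := fun x _ => Matrix.IsSymm.ext fun i j => by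
    rw [← gB_single (cw2 α β), ← gB_single (cw2 α β), gB_cw, gB_cw, cwDot_symm]
    ring
  nondeg := fun x _ => by
    rw [isUnit_iff_ne_zero]
    intro h0
    obtain ⟨v, hv, h⟩ := Matrix.exists_mulVec_eq_zero_iff.mpr h0
    have hB : ∀ w, gB (cw2 α β) x w v = 0 := fun w => by
      rw [gB, Matrix.toLinearMap₂'_apply', h, dotProduct_zero]
    have hv0 : v 0 = 0 := by
      have := hB (Pi.single 1 1)
      rw [gB_cw, cwDot_single_one] at this
      simpa using this
    exact hv (cwDot_nondeg fun w => by rw [← gB_cw_of_zero α β x w hv0, hB])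

end

section

variable {d : ℕ} (α β : Matrix (Fin d) (Fin d) ℝ)

theorem hasDerivAt_scr_line (M : Matrix (Fin d) (Fin d) ℝ) (u x a : Fin (d + 2) → ℝ) :
    HasDerivAt (fun t : ℝ => scr M u (x + t • a)) (scr M u a) 0 := by
  simp only [map_add, map_smul, smul_eq_mul]
  simpa using ((hasDerivAt_id (0 : ℝ)).mul_const (scr M u a)).const_add (scr M u x)

theorem hasDerivAt_scr_line_line (M : Matrix (Fin d) (Fin d) ℝ) (x a : Fin (d + 2) → ℝ) :
    HasDerivAt (fun t : ℝ => scr M (x + t • a) (x + t • a)) (scr M a x + scr M x a) 0 := by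
  have h := ((hasDerivAt_scr_line M x x a).add ((hasDerivAt_id (0 : ℝ)).mul
    (hasDerivAt_scr_line M a x a)))
  refine (h.congr_of_eventuallyEq (Filter.Eventually.of_forall fun t => ?_)).congr_deriv ?_
  · simp
  · simp [add_comm]

theorem hasDerivAt_zero_line (x a : Fin (d + 2) → ℝ) :
    HasDerivAt (fun t : ℝ => (x + t • a) 0) (a 0) 0 :=
  hasDerivAt_pi.mp (hasDerivAt_line x a) 0

theorem hasDerivAt_prof_line (u x a : Fin (d + 2) → ℝ) :
    HasDerivAt (fun t : ℝ => prof α β (x + t • a) u (x + t • a))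
      (a 0 * scr α u x + prof α β x u a) 0 := by
  have h := ((hasDerivAt_zero_line x a).mul (hasDerivAt_scr_line α u x a)).add
    (hasDerivAt_scr_line β u x a)
  refine h.congr_deriv ?_
  simp [prof]; ring

theorem hasDerivAt_prof_line_line (hα : α.IsSymm) (hβ : β.IsSymm) (x a : Fin (d + 2) → ℝ) :
    HasDerivAt (fun t : ℝ => prof α β (x + t • a) (x + t • a) (x + t • a))
      (a 0 * scr α x x + 2 * prof α β x a x) 0 := by
  have h := ((hasDerivAt_zero_line x a).mul (hasDerivAt_scr_line_line α x a)).add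
    (hasDerivAt_scr_line_line β x a)
  refine h.congr_deriv ?_
  simp [prof, scr_symm hα x a, scr_symm hβ x a]; ring

theorem dg_cw (hα : α.IsSymm) (hβ : β.IsSymm) (x e u v : Fin (d + 2) → ℝ) :
    dg (cw2 α β) x e u v =
      -2 * (e 0 * scr α x x + 2 * prof α β x e x) * (u 0 * v 0) := by
  have h1 := hasDerivAt_ev_const (T := gT (cw2 α β)) (v := ![u, v]) (t := 0)
    (by simpa using (isMetricOn_cw α β).smoothTF_gT.differentiableAt isOpen_univ (mem_univ x))
    (hasDerivAt_line x e)
  simp only [ev_gT, zero_smul, add_zero, Matrix.cons_val_zero, Matrix.cons_val_one, gB_cw] at h1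
  have h2 := (((hasDerivAt_prof_line_line α β hα hβ x e).const_mul (-2)).mul_const
    (u 0 * v 0)).add_const (cwDot u v)
  exact h1.unique h2

/-- The gradient of the profile function. -/
def profGrad (x : Fin (d + 2) → ℝ) : Fin (d + 2) → ℝ :=
  Matrix.vecCons 0 (Matrix.vecCons 0 fun i => 2 * prof α β x (Pi.single i.succ.succ 1) x)

theorem cwDot_profGrad (w x : Fin (d + 2) → ℝ) :
    cwDot w (profGrad α β x) = 2 * prof α β x w x := by
  have h : ∀ M : Matrix (Fin d) (Fin d) ℝ, scr M w x =
      ∑ i : Fin d, w i.succ.succ * scr M (Pi.single i.succ.succ 1) x := fun M => by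
    rw [scr_apply]
    refine Finset.sum_congr rfl fun i _ => ?_
    have : scr M (Pi.single i.succ.succ 1) x = ∑ j, M i j * x j.succ.succ := by
      rw [scr_apply, Finset.sum_eq_single i]
      · simp
      · intro j _ hj
        refine Finset.sum_eq_zero fun k _ => ?_
        rw [Pi.single_eq_of_ne (by simpa [Fin.succ_inj] using hj)]
        ring
      · simp
    rw [this, Finset.mul_sum]
    exact Finset.sum_congr rfl fun j _ => by ring
  simp only [cwDot, profGrad, Matrix.cons_val_zero, Matrix.cons_val_one, Matrix.cons_val_succ,
    prof, h α, h β, mul_add, Finset.mul_sum, Finset.sum_add_distrib]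
  simp only [mul_zero, neg_zero, sub_zero, zero_add]
  congr 1 <;> exact Finset.sum_congr rfl fun i _ => by ring

@[simp] theorem profGrad_zero (x : Fin (d + 2) → ℝ) : profGrad α β x 0 = 0 := rfl

theorem Gm_cw (hα : α.IsSymm) (hβ : β.IsSymm) (x u v : Fin (d + 2) → ℝ) :
    Gm (cw2 α β) x u v = (u 0 * v 0) • profGrad α β x +
      (u 0 * v 0 * scr α x x + 2 * prof α β x u x * v 0 + 2 * prof α β x v x * u 0) •
        Pi.single 1 1 := by
  refine gB_ext (isMetricOn_cw α β) (mem_univ x) fun w => ?_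
  rw [koszul (isMetricOn_cw α β) (mem_univ x), gB_cw_of_zero α β x w (by simp), cwDot_add,
    cwDot_smul, cwDot_smul, cwDot_profGrad, cwDot_symm w (Pi.single 1 1), cwDot_single_one,
    dg_cw α β hα hβ, dg_cw α β hα hβ, dg_cw α β hα hβ]
  ring

theorem Gm_cw_zero (hα : α.IsSymm) (hβ : β.IsSymm) (x u v : Fin (d + 2) → ℝ) :
    Gm (cw2 α β) x u v 0 = 0 := by rw [Gm_cw α β hα hβ]; simp

theorem cwDot_Gm_cw (hα : α.IsSymm) (hβ : β.IsSymm) (x w u v : Fin (d + 2) → ℝ) :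
    cwDot w (Gm (cw2 α β) x u v) = (u 0 * v 0) * (2 * prof α β x w x) -
      (u 0 * v 0 * scr α x x + 2 * prof α β x u x * v 0 + 2 * prof α β x v x * u 0) * w 0 := by
  rw [Gm_cw α β hα hβ, cwDot_add, cwDot_smul, cwDot_smul, cwDot_profGrad,
    cwDot_symm w (Pi.single 1 1), cwDot_single_one]
  ring

theorem cwDot_fderiv_Gm_cw (hα : α.IsSymm) (hβ : β.IsSymm) (x w a u v : Fin (d + 2) → ℝ) :
    cwDot w (fderiv ℝ (Gm (cw2 α β)) x a u v) =
      (u 0 * v 0) * (2 * (a 0 * scr α w x + prof α β x w a)) -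
      (u 0 * v 0 * (scr α a x + scr α x a) + 2 * (a 0 * scr α u x + prof α β x u a) * v 0
        + 2 * (a 0 * scr α v x + prof α β x v a) * u 0) * w 0 := by
  have h1 : HasDerivAt (fun t : ℝ => Gm (cw2 α β) (x + t • a) u v)
      (fderiv ℝ (Gm (cw2 α β)) x a u v) 0 := by
    have := hasDerivAt_comp_line
      (E := (Fin (d + 2) → ℝ) →L[ℝ] (Fin (d + 2) → ℝ) →L[ℝ] (Fin (d + 2) → ℝ)) ((isMetricOn_cw α β).differentiableAt_Gm (mem_univ x)) a
    simpa using (this.clm_apply (hasDerivAt_const 0 u)).clm_apply (hasDerivAt_const 0 v)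
  have h2 : HasDerivAt (fun t : ℝ => cwDot w (Gm (cw2 α β) (x + t • a) u v))
      (cwDot w (fderiv ℝ (Gm (cw2 α β)) x a u v)) 0 :=
    (LinearMap.toContinuousLinearMap (cwDotL w)).hasFDerivAt.comp_hasDerivAt (0 : ℝ) h1
  simp only [cwDot_Gm_cw α β hα hβ] at h2
  refine h2.unique ?_
  exact ((((hasDerivAt_prof_line α β w x a).const_mul 2).const_mul (u 0 * v 0)).sub
    (((((hasDerivAt_scr_line_line α x a).const_mul (u 0 * v 0)).add
      (((hasDerivAt_prof_line α β u x a).const_mul 2).mul_const (v 0))).add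
      (((hasDerivAt_prof_line α β v x a).const_mul 2).mul_const (u 0))).mul_const (w 0)))

theorem prof_Gm_cw (hα : α.IsSymm) (hβ : β.IsSymm) (x u v : Fin (d + 2) → ℝ) :
    prof α β x (Gm (cw2 α β) x u v) x = (u 0 * v 0) * prof α β x (profGrad α β x) x := by
  have h : ∀ M : Matrix (Fin d) (Fin d) ℝ, scr M (Pi.single 1 1) x = 0 := fun M => by
    simp [scr_apply, succ_succ_ne_one]
  simp only [Gm_cw α β hα hβ, prof, map_add, map_smul, LinearMap.add_apply, LinearMap.smul_apply,
    h, smul_eq_mul]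
  ring

theorem Rie_cw (hα : α.IsSymm) (hβ : β.IsSymm) (x w c a b : Fin (d + 2) → ℝ) :
    Rie (cw2 α β) x w c a b = cwQ (x 0 • α + β) w c a b := by
  have h0 : ∀ u v a : Fin (d + 2) → ℝ, fderiv ℝ (Gm (cw2 α β)) x a u v 0 = 0 := fun u v a => by
    have := cwDot_fderiv_Gm_cw α β hα hβ x (Pi.single 1 1) a u v
    rw [cwDot_single_one] at this
    have h : ∀ M : Matrix (Fin d) (Fin d) ℝ, ∀ y, scr M (Pi.single 1 1) y = 0 := fun M y => by
      simp [scr_apply, succ_succ_ne_one]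
    simpa [prof, h] using this
  have hR0 : Rm (cw2 α β) x a b c 0 = 0 := by
    simp [Rm_apply, h0, Gm_cw_zero α β hα hβ]
  rw [Rie_eq (isMetricOn_cw α β) (mem_univ x), gB_cw_of_zero α β x w hR0, Rm_apply]
  have hsub : ∀ u v : Fin (d + 2) → ℝ, cwDot w (u - v) = cwDot w u - cwDot w v :=
    fun u v => (cwDotL w).map_sub u v
  rw [hsub, cwDot_add, hsub]
  simp only [cwDot_fderiv_Gm_cw α β hα hβ]
  rw [cwDot_Gm_cw α β hα hβ, cwDot_Gm_cw α β hα hβ, Gm_cw_zero α β hα hβ, Gm_cw_zero α β hα hβ,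
    prof_Gm_cw α β hα hβ, prof_Gm_cw α β hα hβ, cwQ_add, cwQ_smul, cwQ_eq_scr, cwQ_eq_scr]
  simp only [prof, map_sub, map_smul, LinearMap.sub_apply, LinearMap.smul_apply, smul_eq_mul]
  rw [scr_symm hα b a, scr_symm hβ b a, scr_symm hα x a, scr_symm hα x b]
  ring

end

section

variable {d : ℕ} (α β : Matrix (Fin d) (Fin d) ℝ)

theorem scr_Gm_cw (hα : α.IsSymm) (hβ : β.IsSymm) (M : Matrix (Fin d) (Fin d) ℝ)
    (x u v : Fin (d + 2) → ℝ) :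
    scr M (Gm (cw2 α β) x u v) = (u 0 * v 0) • scr M (profGrad α β x) := by
  have h : scr M (Pi.single 1 1) = 0 := LinearMap.ext fun y => by
    simp [scr_apply, succ_succ_ne_one]
  rw [Gm_cw α β hα hβ, map_add, map_smul, map_smul, h, smul_zero, add_zero]

theorem cwQ_pair_symm {M : Matrix (Fin d) (Fin d) ℝ} (hM : M.IsSymm) (w c a b : Fin (d + 2) → ℝ) :
    cwQ M a b w c = cwQ M w c a b := by
  rw [cwQ_eq_scr, cwQ_eq_scr, scr_symm hM]

theorem cwQ_Gm_cw_left (hα : α.IsSymm) (hβ : β.IsSymm) (M : Matrix (Fin d) (Fin d) ℝ)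
    (x e w c a b : Fin (d + 2) → ℝ) :
    cwQ M (Gm (cw2 α β) x e w) c a b + cwQ M w (Gm (cw2 α β) x e c) a b = 0 := by
  rw [cwQ_eq_scr, cwQ_eq_scr, Gm_cw_zero α β hα hβ, Gm_cw_zero α β hα hβ, zero_smul, zero_smul,
    sub_zero, zero_sub, map_smul, map_neg, map_smul, scr_Gm_cw α β hα hβ, scr_Gm_cw α β hα hβ]
  simp only [LinearMap.smul_apply, LinearMap.neg_apply, smul_eq_mul]
  ring

theorem cwQ_Gm_cw_right (hα : α.IsSymm) (hβ : β.IsSymm) {M : Matrix (Fin d) (Fin d) ℝ}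
    (hM : M.IsSymm) (x e w c a b : Fin (d + 2) → ℝ) :
    cwQ M w c (Gm (cw2 α β) x e a) b + cwQ M w c a (Gm (cw2 α β) x e b) = 0 := by
  rw [← cwQ_pair_symm hM, ← cwQ_pair_symm hM w c a, cwQ_Gm_cw_left α β hα hβ]

theorem update_vec_four (o p q r u : Fin (d + 2) → ℝ) :
    Function.update ![o, p, q, r] 0 u = ![u, p, q, r] ∧
    Function.update ![o, p, q, r] 1 u = ![o, u, q, r] ∧
    Function.update ![o, p, q, r] 2 u = ![o, p, u, r] ∧
    Function.update ![o, p, q, r] 3 u = ![o, p, q, u] := by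
  refine ⟨?_, ?_, ?_, ?_⟩ <;> · ext i; fin_cases i <;> rfl

theorem update_vec_five (o p q r s u : Fin (d + 2) → ℝ) :
    Function.update ![o, p, q, r, s] 0 u = ![u, p, q, r, s] ∧
    Function.update ![o, p, q, r, s] 1 u = ![o, u, q, r, s] ∧
    Function.update ![o, p, q, r, s] 2 u = ![o, p, u, r, s] ∧
    Function.update ![o, p, q, r, s] 3 u = ![o, p, q, u, s] ∧
    Function.update ![o, p, q, r, s] 4 u = ![o, p, q, r, u] := by
  refine ⟨?_, ?_, ?_, ?_, ?_⟩ <;> · ext i; fin_cases i <;> rfl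

theorem Nie_cw (hα : α.IsSymm) (hβ : β.IsSymm) (x e w c a b : Fin (d + 2) → ℝ) :
    Nie (cw2 α β) x e w c a b = e 0 * cwQ α w c a b := by
  have hR : ∀ y w c a b, ev (riemann (cw2 α β) y) ![w, c, a, b] = cwQ (y 0 • α + β) w c a b :=
    Rie_cw α β hα hβ
  have h1 := hasDerivAt_ev_const (T := riemann (cw2 α β)) (v := ![w, c, a, b]) (t := 0)
    (by simpa using (isMetricOn_cw α β).smoothTF_riemann.differentiableAt isOpen_univ (mem_univ x))
    (hasDerivAt_line x e)
  simp only [hR, cwQ_add, cwQ_smul, zero_smul, add_zero] at h1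
  have h2 := ((hasDerivAt_zero_line x e).mul_const (cwQ α w c a b)).add_const (cwQ β w c a b)
  have h := ev_covDeriv (cw2 α β) (riemann (cw2 α β)) x e ![w, c, a, b]
  change Nie _ _ _ _ _ _ _ = _ at h
  have hM : (x 0 • α + β).IsSymm := (hα.smul _).add hβ
  obtain ⟨u0, -⟩ := update_vec_four w c a b (Gm (cw2 α β) x e w)
  obtain ⟨-, u1, -⟩ := update_vec_four w c a b (Gm (cw2 α β) x e c)
  obtain ⟨-, -, u2, -⟩ := update_vec_four w c a b (Gm (cw2 α β) x e a)
  obtain ⟨-, -, -, u3⟩ := update_vec_four w c a b (Gm (cw2 α β) x e b)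
  rw [h, h1.unique h2, Fin.sum_univ_four]
  change _ - (ev _ (Function.update _ 0 (Gm (cw2 α β) x e w)) +
    ev _ (Function.update _ 1 (Gm (cw2 α β) x e c)) +
    ev _ (Function.update _ 2 (Gm (cw2 α β) x e a)) +
    ev _ (Function.update _ 3 (Gm (cw2 α β) x e b))) = _
  rw [u0, u1, u2, u3, hR, hR, hR, hR]
  linear_combination -cwQ_Gm_cw_left α β hα hβ (x 0 • α + β) x e w c a b
    - cwQ_Gm_cw_right α β hα hβ hM x e w c a b

theorem covDeriv_covDeriv_riemann_cw (hα : α.IsSymm) (hβ : β.IsSymm) (x : Fin (d + 2) → ℝ)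
    (idx : Fin (4 + 1 + 1) → Fin (d + 2)) :
    covDeriv (cw2 α β) (covDeriv (cw2 α β) (riemann (cw2 α β))) x idx = 0 := by
  refine ev_eq_zero_iff.mp (MultilinearMap.ext fun v => ?_) idx
  have hv : v = Fin.cons (v 0) ![v 1, v 2, v 3, v 4, v 5] := by
    ext i; fin_cases i <;> rfl
  rw [hv]
  generalize v 0 = f
  generalize v 1 = e
  generalize v 2 = w
  generalize v 3 = c
  generalize v 4 = a
  generalize v 5 = b
  have hR : ∀ y e w c a b, ev (covDeriv (cw2 α β) (riemann (cw2 α β)) y) ![e, w, c, a, b] =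
    e 0 * cwQ α w c a b := Nie_cw α β hα hβ
  have h1 := hasDerivAt_ev_const (T := covDeriv (cw2 α β) (riemann (cw2 α β)))
    (v := ![e, w, c, a, b]) (t := 0)
    (by simpa using ((isMetricOn_cw α β).smoothTF_covDeriv
      (isMetricOn_cw α β).smoothTF_riemann).differentiableAt isOpen_univ (mem_univ x))
    (hasDerivAt_line x f)
  simp only [hR, zero_smul, add_zero] at h1
  have h2 := hasDerivAt_const (0 : ℝ) (e 0 * cwQ α w c a b)
  have h := ev_covDeriv (cw2 α β) (covDeriv (cw2 α β) (riemann (cw2 α β))) x f ![e, w, c, a, b]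
  obtain ⟨u0, -⟩ := update_vec_five e w c a b (Gm (cw2 α β) x f e)
  obtain ⟨-, u1, -⟩ := update_vec_five e w c a b (Gm (cw2 α β) x f w)
  obtain ⟨-, -, u2, -⟩ := update_vec_five e w c a b (Gm (cw2 α β) x f c)
  obtain ⟨-, -, -, u3, -⟩ := update_vec_five e w c a b (Gm (cw2 α β) x f a)
  obtain ⟨-, -, -, -, u4⟩ := update_vec_five e w c a b (Gm (cw2 α β) x f b)
  rw [h, h1.unique h2, Fin.sum_univ_five]
  change _ - (ev _ (Function.update _ 0 (Gm (cw2 α β) x f e)) +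
    ev _ (Function.update _ 1 (Gm (cw2 α β) x f w)) +
    ev _ (Function.update _ 2 (Gm (cw2 α β) x f c)) +
    ev _ (Function.update _ 3 (Gm (cw2 α β) x f a)) +
    ev _ (Function.update _ 4 (Gm (cw2 α β) x f b))) = 0
  rw [u0, u1, u2, u3, u4, hR, hR, hR, hR, hR, Gm_cw_zero α β hα hβ]
  linear_combination (-e 0) * cwQ_Gm_cw_left α β hα hβ α x f w c a b
    - e 0 * cwQ_Gm_cw_right α β hα hβ hα x f w c a b

end

section

theorem pd_eq_fderiv {n m : ℕ} {τ : (Fin n → ℝ) → Fin m → ℝ} {x : Fin n → ℝ}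
    (h : DifferentiableAt ℝ τ x) (i : Fin n) (a : Fin m) :
    pd i (fun y => τ y a) x = fderiv ℝ τ x (Pi.single i 1) a := by
  rw [pd, (hasFDerivAt_pi'.mp h.hasFDerivAt a).fderiv]
  rfl

theorem bilin_ext_single {n : ℕ} {B B' : (Fin n → ℝ) →ₗ[ℝ] (Fin n → ℝ) →ₗ[ℝ] ℝ}
    (h : ∀ i j, B (Pi.single i 1) (Pi.single j 1) = B' (Pi.single i 1) (Pi.single j 1)) :
    B = B' :=
  (Pi.basisFun ℝ (Fin n)).ext fun i => (Pi.basisFun ℝ (Fin n)).ext fun j => by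
    simpa using h i j

theorem isPullbackIsometry_iff {n m : ℕ} {g₁ : MetricMat n} {g₂ : MetricMat m}
    {τ : (Fin n → ℝ) → Fin m → ℝ} {S : Set (Fin n → ℝ)} (hS : IsOpen S) :
    IsPullbackIsometry g₁ g₂ τ S ↔ ContDiffOn ℝ (⊤ : ℕ∞) τ S ∧
      ∀ x ∈ S, ∀ u v, gB g₁ x u v = gB g₂ (τ x) (fderiv ℝ τ x u) (fderiv ℝ τ x v) := by
  unfold IsPullbackIsometry
  rw [← contDiffOn_pi]
  refine and_congr_right fun hτ => forall₂_congr fun x hx => ?_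
  have hd := differentiableAt_of_contDiffOn hS hτ hx
  have hb : ∀ i j, (∑ a, ∑ b, g₂ (τ x) a b * pd i (fun y => τ y a) x * pd j (fun y => τ y b) x) =
      gB g₂ (τ x) (fderiv ℝ τ x (Pi.single i 1)) (fderiv ℝ τ x (Pi.single j 1)) := fun i j => by
    rw [gB_apply]
    refine Finset.sum_congr rfl fun a _ => Finset.sum_congr rfl fun b _ => ?_
    rw [pd_eq_fderiv hd, pd_eq_fderiv hd, mul_assoc]
  simp only [hb]
  constructor
  · intro h u v
    have := bilin_ext_single (B := gB g₁ x) (B' := (gB g₂ (τ x)).compl₁₂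
      (fderiv ℝ τ x : (Fin n → ℝ) →ₗ[ℝ] Fin m → ℝ) (fderiv ℝ τ x : (Fin n → ℝ) →ₗ[ℝ] Fin m → ℝ))
      fun i j => by rw [gB_single, h]; rfl
    rw [this]; rfl
  · intro h i j
    rw [← gB_single g₁, h]

theorem IsAffineOn.bijective {n : ℕ} {g g' : MetricMat n} {τ : (Fin n → ℝ) → Fin n → ℝ}
    {U U' : Set (Fin n → ℝ)} (hτ : IsAffineOn g g' τ U U') {x : Fin n → ℝ} (hx : x ∈ U) :
    Function.Bijective (fderiv ℝ τ x) := by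
  have hinj : Function.Injective (fderiv ℝ τ x).toLinearMap := by
    rw [injective_iff_map_eq_zero]
    intro z hz
    have hz : fderiv ℝ τ x z = 0 := hz
    refine gB_nondeg (hτ.source.nondeg x hx) fun w => ?_
    rw [hτ.isom x hx, hz, map_zero]
  exact ⟨hinj, LinearMap.injective_iff_surjective.mp hinj⟩

theorem IsExpMap.image_mem_nhds {n : ℕ} {g : MetricMat n} {U : Set (Fin n → ℝ)} {x : Fin n → ℝ}
    {F : (Fin n → ℝ) →L[ℝ] (Fin n → ℝ)} {r : ℝ} {ex : (Fin n → ℝ) → Fin n → ℝ}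
    {P : (Fin n → ℝ) → (Fin n → ℝ) →L[ℝ] (Fin n → ℝ)} (h : IsExpMap g U x F r ex P)
    (hF : Function.Bijective F) {N : Set (Fin n → ℝ)} (hN : N ∈ nhds 0) : ex '' N ∈ nhds x := by
  have hs : HasStrictFDerivAt ex F 0 := by
    rw [← h.fderiv_zero]
    exact (h.smooth.contDiffAt (Metric.ball_mem_nhds 0 h.pos)).hasStrictFDerivAt (by simp)
  have := hs.map_nhds_eq_of_surj (LinearMap.range_eq_top.mpr hF.2)
  rw [h.map_zero] at this
  rw [← this]
  exact Filter.image_mem_map hN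

variable {d m : ℕ}

/-- The frame `F` at `x` puts metric, curvature and its derivative into the normal form of the
product of a generalized Cahen-Wallach space at `u = s` and a Riemannian space with
curvature `ρ`. -/
structure IsStd (α β : Matrix (Fin d) (Fin d) ℝ)
    (ρ : (Fin m → ℝ) → (Fin m → ℝ) → (Fin m → ℝ) → (Fin m → ℝ) → ℝ)
    (g : MetricMat (d + 2 + m)) (x : Fin (d + 2 + m) → ℝ)
    (F : (Fin (d + 2 + m) → ℝ) →L[ℝ] (Fin (d + 2 + m) → ℝ)) (s : ℝ) : Prop where
  bijective : Function.Bijective F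
  metric : ∀ y z, gB g x (F y) (F z) = cwDot (split1 y) (split1 z) + split2 y ⬝ᵥ split2 z
  rie : ∀ w c a b, Rie g x (F w) (F c) (F a) (F b) =
    cwQ (s • α + β) (split1 w) (split1 c) (split1 a) (split1 b) +
      ρ (split2 w) (split2 c) (split2 a) (split2 b)
  nie : ∀ e w c a b, Nie g x (F e) (F w) (F c) (F a) (F b) =
    split1 e 0 * cwQ α (split1 w) (split1 c) (split1 a) (split1 b)

variable {α β : Matrix (Fin d) (Fin d) ℝ}
  {ρ : (Fin m → ℝ) → (Fin m → ℝ) → (Fin m → ℝ) → (Fin m → ℝ) → ℝ}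
  {g g' : MetricMat (d + 2 + m)} {x : Fin (d + 2 + m) → ℝ}
  {F : (Fin (d + 2 + m) → ℝ) →L[ℝ] (Fin (d + 2 + m) → ℝ)} {s : ℝ}
  {U U' : Set (Fin (d + 2 + m) → ℝ)}

theorem IsStd.map (h : IsStd α β ρ g x F s) {τ : (Fin (d + 2 + m) → ℝ) → Fin (d + 2 + m) → ℝ}
    (hτ : IsAffineOn g g' τ U U') (hx : x ∈ U) :
    IsStd α β ρ g' (τ x) ((fderiv ℝ τ x).comp F) s where
  bijective := (hτ.bijective hx).comp h.bijective
  metric := fun y z => by rw [← h.metric, hτ.isom x hx]; rfl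
  rie := fun w c a b => by rw [← h.rie, hτ.Rie_eq hx]; rfl
  nie := fun e w c a b => by rw [← h.nie, hτ.Nie_eq hx]; rfl

section Exp
variable {r : ℝ} {ex : (Fin (d + 2 + m) → ℝ) → Fin (d + 2 + m) → ℝ}
  {P : (Fin (d + 2 + m) → ℝ) → (Fin (d + 2 + m) → ℝ) →L[ℝ] (Fin (d + 2 + m) → ℝ)}
  {y : Fin (d + 2 + m) → ℝ}

theorem IsStd.exp (h : IsStd α β ρ g x F s) (he : IsExpMap g U x F r ex P)
    (hy : y ∈ Metric.ball 0 r) : IsStd α β ρ g (ex y) (P y) (s + split1 y 0) where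
  bijective := he.bijective y hy
  metric := fun a b => by rw [← h.metric]; exact he.metric y hy a b
  rie := fun w c a b => by
    have h1 := he.rie y hy w c a b
    simp only [RieF, NieF] at h1
    rw [h1, h.rie, h.nie, add_smul]
    simp only [cwQ_add, cwQ_smul]
    ring
  nie := fun e w c a b => by rw [← h.nie]; exact he.nie y hy e w c a b

theorem IsStd.of_exp {F₀ : (Fin (d + 2 + m) → ℝ) →L[ℝ] (Fin (d + 2 + m) → ℝ)}
    (he : IsExpMap g U x F₀ r ex P) (hF₀ : Function.Bijective F₀)
    (hy : y ∈ Metric.ball 0 r) (h : IsStd α β ρ g (ex y) F s) :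
    ∃ F' s', IsStd α β ρ g x F' s' := by
  let Q := ContinuousLinearEquiv.ofBijective (P y)
    (LinearMap.ker_eq_bot.mpr (he.bijective y hy).1)
    (LinearMap.range_eq_top.mpr (he.bijective y hy).2)
  let E := ContinuousLinearEquiv.ofBijective F
    (LinearMap.ker_eq_bot.mpr h.bijective.1) (LinearMap.range_eq_top.mpr h.bijective.2)
  have hQ : ∀ v, P y (Q.symm v) = v := fun v => Q.apply_symm_apply v
  have hE : F (E.symm (P y y)) = P y y := E.apply_symm_apply _
  have hR : ∀ w c a b, Rie g x (F₀ w) (F₀ c) (F₀ a) (F₀ b) = Rie g (ex y) (P y w) (P y c) (P y a)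
      (P y b) - Nie g (ex y) (P y y) (P y w) (P y c) (P y a) (P y b) := fun w c a b => by
    have h1 := he.rie y hy w c a b
    have h2 := he.nie y hy y w c a b
    simp only [RieF, NieF] at h1 h2
    linarith
  refine ⟨F₀.comp (Q.symm.toContinuousLinearMap.comp F), s - split1 (E.symm (P y y)) 0, ?_, ?_, ?_,
    ?_⟩
  · exact hF₀.comp (Q.symm.bijective.comp h.bijective)
  · intro u v
    rw [← h.metric]
    have := he.metric y hy (Q.symm (F u)) (Q.symm (F v))
    simp only [gF_apply, hQ] at this
    exact this.symm
  · intro w c a b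
    change Rie g x (F₀ (Q.symm (F w))) (F₀ (Q.symm (F c))) (F₀ (Q.symm (F a)))
      (F₀ (Q.symm (F b))) = _
    rw [hR]
    simp only [hQ]
    have hn := h.nie (E.symm (P y y)) w c a b
    rw [hE] at hn
    rw [h.rie, hn, sub_smul, sub_eq_add_neg (s • α), ← neg_smul]
    simp only [cwQ_add, cwQ_smul]
    ring
  · intro e w c a b
    rw [← h.nie]
    have := he.nie y hy (Q.symm (F e)) (Q.symm (F w)) (Q.symm (F c)) (Q.symm (F a)) (Q.symm (F b))
    simp only [NieF, hQ] at this
    exact this.symm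

end Exp

end

section

theorem IsMetricOn.mono {n : ℕ} {g : MetricMat n} {U V : Set (Fin n → ℝ)} (h : IsMetricOn g U)
    (hV : IsOpen V) (hVU : V ⊆ U) : IsMetricOn g V :=
  ⟨hV, fun a b => (h.smooth a b).mono hVU, fun x hx => h.symm x (hVU hx),
    fun x hx => h.nondeg x (hVU hx)⟩

theorem isMetricOn_chart {n : ℕ} {M : Type} [TopologicalSpace M] (C : MetricChart n M) :
    IsMetricOn C.g C.ran := ⟨C.open_ran, C.smooth_g, C.symm_g, C.nondeg_g⟩

variable {n : ℕ} (X : PRManifold n)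

theorem isOpen_overlap (p q : X.M) :
    IsOpen ((X.chartAt p).φ '' ((X.chartAt p).dom ∩ (X.chartAt q).dom)) := by
  have : (X.chartAt p).φ '' ((X.chartAt p).dom ∩ (X.chartAt q).dom) =
      (X.chartAt p).ran ∩ (X.chartAt p).ψ ⁻¹' (X.chartAt q).dom := by
    ext x
    constructor
    · rintro ⟨a, ⟨ha, hb⟩, rfl⟩
      refine ⟨(X.chartAt p).maps_to a ha, ?_⟩
      rwa [mem_preimage, (X.chartAt p).left_inv a ha]
    · rintro ⟨hx, hy⟩
      exact ⟨_, ⟨(X.chartAt p).maps_from x hx, hy⟩, (X.chartAt p).right_inv x hx⟩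
  rw [this]
  exact (X.chartAt p).cont_psi.isOpen_inter_preimage (X.chartAt p).open_ran (X.chartAt q).open_dom

theorem isAffineOn_transition (p q : X.M) :
    IsAffineOn (X.chartAt p).g (X.chartAt q).g ((X.chartAt q).φ ∘ (X.chartAt p).ψ)
      ((X.chartAt p).φ '' ((X.chartAt p).dom ∩ (X.chartAt q).dom)) (X.chartAt q).ran := by
  obtain ⟨h1, h2⟩ := (isPullbackIsometry_iff (isOpen_overlap X p q)).mp (X.compatible p q)
  refine isAffineOn_of_isom ((isMetricOn_chart _).mono (isOpen_overlap X p q) ?_)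
    (isMetricOn_chart _) h1 ?_ h2
  · rintro _ ⟨a, ⟨ha, -⟩, rfl⟩
    exact (X.chartAt p).maps_to a ha
  · rintro _ ⟨a, ⟨ha, hb⟩, rfl⟩
    rw [Function.comp_apply, (X.chartAt p).left_inv a ha]
    exact (X.chartAt q).maps_to a hb

variable {d m : ℕ} {α β : Matrix (Fin d) (Fin d) ℝ}
  {ρ : (Fin m → ℝ) → (Fin m → ℝ) → (Fin m → ℝ) → (Fin m → ℝ) → ℝ}

/-- The manifold has the product normal form, read in the chart at `q`, at the point `p`. -/
def StdAt (α β : Matrix (Fin d) (Fin d) ℝ)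
    (ρ : (Fin m → ℝ) → (Fin m → ℝ) → (Fin m → ℝ) → (Fin m → ℝ) → ℝ)
    (X : PRManifold (d + 2 + m)) (q p : X.M) : Prop :=
  ∃ F s, IsStd α β ρ (X.chartAt q).g ((X.chartAt q).φ p) F s

variable {X : PRManifold (d + 2 + m)}

theorem StdAt.change {p q x : X.M} (hp : x ∈ (X.chartAt p).dom) (hq : x ∈ (X.chartAt q).dom)
    (h : StdAt α β ρ X p x) : StdAt α β ρ X q x := by
  obtain ⟨F, s, h⟩ := h
  have := h.map (isAffineOn_transition X p q) (mem_image_of_mem _ ⟨hp, hq⟩)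
  rw [Function.comp_apply, (X.chartAt p).left_inv x hp] at this
  exact ⟨_, _, this⟩

theorem covDeriv_covDeriv_chart (h : X.RthSymmetric 2) (q : X.M) :
    ∀ x ∈ (X.chartAt q).ran, ∀ idx,
      covDeriv (X.chartAt q).g (covDeriv (X.chartAt q).g (riemann (X.chartAt q).g)) x idx = 0 :=
  fun x hx idx => h q x hx idx

theorem eventually_of_chart {p : X.M} {N : Set (Fin (d + 2 + m) → ℝ)}
    (hN : N ∈ nhds ((X.chartAt p).φ p)) :
    ∀ᶠ x in nhds p, x ∈ (X.chartAt p).dom ∧ (X.chartAt p).φ x ∈ N := by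
  have hd := (X.chartAt p).open_dom.mem_nhds (X.mem_chart p)
  exact Filter.Eventually.and hd (((X.chartAt p).cont_phi.continuousAt hd).eventually_mem hN)

theorem eventually_stdAt (h2 : X.RthSymmetric 2) {p : X.M} (h : StdAt α β ρ X p p) :
    ∀ᶠ x in nhds p, StdAt α β ρ X x x := by
  obtain ⟨F, s, h⟩ := h
  obtain ⟨r, ex, P, he⟩ := exists_isExpMap (isMetricOn_chart (X.chartAt p))
    (covDeriv_covDeriv_chart h2 p) ((X.chartAt p).maps_to p (X.mem_chart p)) h.bijective
  filter_upwards [eventually_of_chart (he.image_mem_nhds h.bijective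
    (Metric.ball_mem_nhds 0 he.pos))] with x ⟨hx, y, hy, hyx⟩
  have := h.exp he hy
  rw [hyx] at this
  exact StdAt.change hx (X.mem_chart x) ⟨_, _, this⟩

theorem eventually_not_stdAt (h2 : X.RthSymmetric 2) {p : X.M} (h : ¬ StdAt α β ρ X p p) :
    ∀ᶠ x in nhds p, ¬ StdAt α β ρ X x x := by
  have hid : Function.Bijective
    (ContinuousLinearMap.id ℝ (Fin (d + 2 + m) → ℝ)) := Function.bijective_id
  obtain ⟨r, ex, P, he⟩ := exists_isExpMap (isMetricOn_chart (X.chartAt p))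
    (covDeriv_covDeriv_chart h2 p) ((X.chartAt p).maps_to p (X.mem_chart p)) hid
  filter_upwards [eventually_of_chart (he.image_mem_nhds hid
    (Metric.ball_mem_nhds 0 he.pos))] with x ⟨hx, y, hy, hyx⟩ hs
  obtain ⟨F, s, hs⟩ := StdAt.change (X.mem_chart x) hx hs
  rw [← hyx] at hs
  exact h (IsStd.of_exp he hid hy hs)

theorem forall_stdAt (hc : X.Conn) (h2 : X.RthSymmetric 2) {p q : X.M}
    (hp : p ∈ (X.chartAt q).dom) (h : StdAt α β ρ X q p) (x : X.M) : StdAt α β ρ X x x := by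
  have : ConnectedSpace X.M := hc
  have hcl : IsClopen {x : X.M | StdAt α β ρ X x x} := by
    refine ⟨⟨isOpen_iff_mem_nhds.mpr fun y hy => eventually_not_stdAt h2 hy⟩,
      isOpen_iff_mem_nhds.mpr fun y hy => eventually_stdAt h2 hy⟩
  exact eq_univ_iff_forall.mp (hcl.eq_univ ⟨p, h.change hp (X.mem_chart p)⟩) x

end

section

variable {a b : ℕ}

/-- The first projection of `ℝᵃ × ℝᵇ`. -/
def spl1 (a b : ℕ) : (Fin (a + b) → ℝ) →L[ℝ] (Fin a → ℝ) :=
  LinearMap.toContinuousLinearMap (LinearMap.funLeft ℝ ℝ (Fin.castAdd b))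

/-- The second projection of `ℝᵃ × ℝᵇ`. -/
def spl2 (a b : ℕ) : (Fin (a + b) → ℝ) →L[ℝ] (Fin b → ℝ) :=
  LinearMap.toContinuousLinearMap (LinearMap.funLeft ℝ ℝ (Fin.natAdd a))

theorem split1_append (u : Fin a → ℝ) (v : Fin b → ℝ) : split1 (Fin.append u v) = u :=
  funext fun i => Fin.append_left u v i

theorem split2_append (u : Fin a → ℝ) (v : Fin b → ℝ) : split2 (Fin.append u v) = v :=
  funext fun i => Fin.append_right u v i

theorem append_split (x : Fin (a + b) → ℝ) : Fin.append (split1 x) (split2 x) = x :=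
  Fin.append_castAdd_natAdd

theorem eq_of_split {x y : Fin (a + b) → ℝ} (h1 : split1 x = split1 y) (h2 : split2 x = split2 y) :
    x = y := by rw [← append_split x, h1, h2, append_split]

theorem split1_zero : split1 (0 : Fin (a + b) → ℝ) = 0 := rfl

theorem split2_zero : split2 (0 : Fin (a + b) → ℝ) = 0 := rfl

/-- The inclusion of the second factor of `ℝᵃ × ℝᵇ`. -/
def inj2 (a b : ℕ) : (Fin b → ℝ) →L[ℝ] (Fin (a + b) → ℝ) :=
  LinearMap.toContinuousLinearMap
    { toFun := fun v => Fin.append 0 v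
      map_add' := fun u v => eq_of_split (by
        change _ = split1 (Fin.append 0 u) + split1 (Fin.append 0 v)
        simp only [split1_append, add_zero]) (by
        change _ = split2 (Fin.append 0 u) + split2 (Fin.append 0 v)
        simp only [split2_append])
      map_smul' := fun k v => eq_of_split (by
        change _ = k • split1 (Fin.append 0 v)
        simp only [split1_append, smul_zero]) (by
        change _ = k • split2 (Fin.append 0 v)
        simp only [split2_append]) }

theorem inj2_apply (v : Fin b → ℝ) : inj2 a b v = Fin.append 0 v := rfl

theorem split1_inj2 (v : Fin b → ℝ) : split1 (inj2 a b v) = 0 := split1_append 0 v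

theorem split2_inj2 (v : Fin b → ℝ) : split2 (inj2 a b v) = v := split2_append 0 v

theorem mem_ball_split1 {r : ℝ} {x : Fin (a + b) → ℝ} (hx : x ∈ Metric.ball 0 r) :
    split1 x ∈ Metric.ball 0 r := by
  rw [mem_ball_zero_iff] at hx ⊢
  exact lt_of_le_of_lt ((pi_norm_le_iff_of_nonneg (norm_nonneg x)).mpr fun i =>
    norm_le_pi_norm x (Fin.castAdd b i)) hx

theorem mem_ball_split2 {r : ℝ} {x : Fin (a + b) → ℝ} (hx : x ∈ Metric.ball 0 r) :
    split2 x ∈ Metric.ball 0 r := by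
  rw [mem_ball_zero_iff] at hx ⊢
  exact lt_of_le_of_lt ((pi_norm_le_iff_of_nonneg (norm_nonneg x)).mpr fun i =>
    norm_le_pi_norm x (Fin.natAdd a i)) hx

theorem mem_ball_inj2 {r : ℝ} {x : Fin b → ℝ} (hx : x ∈ Metric.ball 0 r) :
    inj2 a b x ∈ Metric.ball 0 r := by
  rw [mem_ball_zero_iff] at hx ⊢
  refine lt_of_le_of_lt ((pi_norm_le_iff_of_nonneg (norm_nonneg x)).mpr fun i => ?_) hx
  refine Fin.addCases (fun i => ?_) (fun i => ?_) i
  · rw [inj2_apply, Fin.append_left]; simp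
  · rw [inj2_apply, Fin.append_right]; exact norm_le_pi_norm x i

theorem gB_prodMetricMat (G₁ : MetricMat a) (G₂ : MetricMat b) (z u v : Fin (a + b) → ℝ) :
    gB (prodMetricMat G₁ G₂) z u v = gB G₁ (split1 z) (split1 u) (split1 v) +
      gB G₂ (split2 z) (split2 u) (split2 v) := by
  simp only [gB_apply, prodMetricMat, Fin.sum_univ_add, Matrix.submatrix_apply,
    finSumFinEquiv_symm_apply_castAdd, finSumFinEquiv_symm_apply_natAdd,
    Matrix.fromBlocks_apply₁₁, Matrix.fromBlocks_apply₁₂, Matrix.fromBlocks_apply₂₁,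
    Matrix.fromBlocks_apply₂₂, Matrix.zero_apply, zero_mul, Finset.sum_const_zero, add_zero,
    zero_add]
  rfl

/-- The Euclidean inner product as a bilinear form. -/
def dotForm (b : ℕ) : (Fin b → ℝ) →ₗ[ℝ] (Fin b → ℝ) →ₗ[ℝ] ℝ :=
  LinearMap.mk₂ ℝ (· ⬝ᵥ ·) add_dotProduct smul_dotProduct dotProduct_add dotProduct_smul

theorem dotForm_apply (u v : Fin b → ℝ) : dotForm b u v = u ⬝ᵥ v := rfl

variable {d m : ℕ} {α β : Matrix (Fin d) (Fin d) ℝ}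

theorem cwQ_zero_left (M : Matrix (Fin d) (Fin d) ℝ) (c a b : Fin (d + 2) → ℝ) :
    cwQ M 0 c a b = 0 := by simp [cwQ]

theorem gB_cw_single (s : ℝ) (u v : Fin (d + 2) → ℝ) :
    gB (cw2 α β) (Pi.single 0 s) u v = cwDot u v := by
  have h : ∀ M : Matrix (Fin d) (Fin d) ℝ, scr M (Pi.single 0 s) = 0 := fun M =>
    LinearMap.ext fun y => by simp [scr_apply]
  rw [gB_cw, prof, h, h]
  simp

variable {ρ : (Fin m → ℝ) → (Fin m → ℝ) → (Fin m → ℝ) → (Fin m → ℝ) → ℝ}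
  {g : MetricMat (d + 2 + m)} {x : Fin (d + 2 + m) → ℝ}
  {F : (Fin (d + 2 + m) → ℝ) →L[ℝ] (Fin (d + 2 + m) → ℝ)} {s : ℝ}
  {U : Set (Fin (d + 2 + m) → ℝ)}

theorem IsStd.rie_inj2 (h : IsStd α β ρ g x F s) (w c a b : Fin m → ℝ) :
    ρ w c a b = Rie g x (F (inj2 (d + 2) m w)) (F (inj2 (d + 2) m c)) (F (inj2 (d + 2) m a))
      (F (inj2 (d + 2) m b)) := by
  rw [h.rie]
  simp only [split1_inj2, split2_inj2, cwQ_zero_left, zero_add]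

theorem IsStd.isLinearMap_curv (h : IsStd α β ρ g x F s) (w c a : Fin m → ℝ) :
    IsLinearMap ℝ (ρ w c a) := by
  refine ⟨fun u v => ?_, fun k v => ?_⟩
  · rw [h.rie_inj2, map_add, map_add, (isLinearMap_Rie x _ _ _).map_add, ← h.rie_inj2,
      ← h.rie_inj2]
  · rw [h.rie_inj2, map_smul, map_smul, (isLinearMap_Rie x _ _ _).map_smul, ← h.rie_inj2]

theorem IsStd.curv_zero_left (h : IsStd α β ρ g x F s) (hg : IsMetricOn g U) (hx : x ∈ U)
    (c a b : Fin m → ℝ) : ρ 0 c a b = 0 := by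
  rw [h.rie_inj2, Rie_eq hg hx, map_zero, map_zero, map_zero, LinearMap.zero_apply]

/-- The Jacobi equation of the generalized Cahen-Wallach space at `u = s`. -/
abbrev IsCWJacobi (α β : Matrix (Fin d) (Fin d) ℝ) (s : ℝ) (y w : Fin (d + 2) → ℝ)
    (E : ℝ → Fin (d + 2) → ℝ) : Prop :=
  IsJacobi (gF (cw2 α β) (Pi.single 0 s) (ContinuousLinearMap.id ℝ _))
    (RieF (cw2 α β) (Pi.single 0 s) (ContinuousLinearMap.id ℝ _))
    (NieF (cw2 α β) (Pi.single 0 s) (ContinuousLinearMap.id ℝ _)) y w E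

theorem IsCWJacobi.eq {y w : Fin (d + 2) → ℝ} {E E' : ℝ → Fin (d + 2) → ℝ}
    (h : IsCWJacobi α β s y w E) (h' : IsCWJacobi α β s y w E') : E 1 = E' 1 :=
  IsJacobi.eq (gF_symm (isMetricOn_cw α β) (mem_univ _))
    (gF_nondeg (isMetricOn_cw α β) (mem_univ _) Function.bijective_id)
    (fun _ => isLinearMap_RieF _ _ _ _ _ _) (fun _ => isLinearMap_NieF _ _ _ _ _ _ _) h h'

/-- The Jacobi equation of a symmetric space with curvature `ρ` in an orthonormal frame. -/
abbrev IsSymJacobi (ρ : (Fin m → ℝ) → (Fin m → ℝ) → (Fin m → ℝ) → (Fin m → ℝ) → ℝ)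
    (y w : Fin m → ℝ) (E : ℝ → Fin m → ℝ) : Prop :=
  IsJacobi (dotForm m) ρ (fun _ _ _ _ _ => 0) y w E

theorem IsSymJacobi.eq (hρ : ∀ w c a, IsLinearMap ℝ (ρ w c a)) {y w : Fin m → ℝ}
    {E E' : ℝ → Fin m → ℝ} (h : IsSymJacobi ρ y w E) (h' : IsSymJacobi ρ y w E') : E 1 = E' 1 :=
  IsJacobi.eq dotProduct_comm (fun v hv => dotProduct_self_eq_zero.mp (hv v))
    (fun _ => hρ _ _ _) (fun _ => ⟨fun _ _ => (add_zero 0).symm, fun _ _ => (smul_zero _).symm⟩) h h'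

theorem IsStd.isCWJacobi_split (h : IsStd α β ρ g x F s) (hα : α.IsSymm) (hβ : β.IsSymm)
    (hg : IsMetricOn g U) (hx : x ∈ U) {y w : Fin (d + 2 + m) → ℝ} {E : ℝ → Fin (d + 2 + m) → ℝ}
    (hE : IsJacobi (gF g x F) (RieF g x F) (NieF g x F) y w E) :
    IsCWJacobi α β s (split1 y) (split1 w) (fun t => split1 (E t)) := by
  obtain ⟨h0, L, hL, H⟩ := hE
  refine ⟨by simp only [h0, split1_zero], fun t => split1 (L t), by simp only [hL], fun t ht => ?_⟩
  obtain ⟨h1, l, h2, h3⟩ := H t ht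
  refine ⟨(spl1 (d + 2) m).hasFDerivAt.comp_hasDerivAt t h1, split1 l,
    (spl1 (d + 2) m).hasFDerivAt.comp_hasDerivAt t h2, fun a => ?_⟩
  have := h3 (Fin.append a 0)
  simp only [gF_apply, RieF, NieF, h.metric, h.rie, h.nie, split1_append, split2_append,
    zero_dotProduct, h.curv_zero_left hg hx, add_zero] at this
  simp only [gF_apply, RieF, NieF, ContinuousLinearMap.id_apply, gB_cw_single,
    Rie_cw α β hα hβ, Nie_cw α β hα hβ, Pi.single_eq_same, this]

theorem IsStd.isSymJacobi_split (h : IsStd α β ρ g x F s)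
    {y w : Fin (d + 2 + m) → ℝ} {E : ℝ → Fin (d + 2 + m) → ℝ}
    (hE : IsJacobi (gF g x F) (RieF g x F) (NieF g x F) y w E) :
    IsSymJacobi ρ (split2 y) (split2 w) (fun t => split2 (E t)) := by
  obtain ⟨h0, L, hL, H⟩ := hE
  refine ⟨by simp only [h0, split2_zero], fun t => split2 (L t), by simp only [hL], fun t ht => ?_⟩
  obtain ⟨h1, l, h2, h3⟩ := H t ht
  refine ⟨(spl2 (d + 2) m).hasFDerivAt.comp_hasDerivAt t h1, split2 l,
    (spl2 (d + 2) m).hasFDerivAt.comp_hasDerivAt t h2, fun a => ?_⟩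
  have := h3 (inj2 (d + 2) m a)
  simp only [gF_apply, RieF, NieF, h.metric, h.rie, h.nie, split1_inj2, split2_inj2,
    cwQ_zero_left, mul_zero, add_zero, zero_add] at this
  have hc : cwDot (0 : Fin (d + 2) → ℝ) (split1 l) = 0 := by simp [cwDot]
  rw [hc, zero_add] at this
  simp only [dotForm_apply, this, mul_zero, add_zero]

theorem isCWJacobi_zero (y : Fin (d + 2) → ℝ) : IsCWJacobi α β s y 0 fun _ => 0 := by
  refine ⟨rfl, fun _ => 0, rfl, fun t _ => ⟨hasDerivAt_const t _, 0, hasDerivAt_const t _,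
    fun a => ?_⟩⟩
  rw [map_zero, (isLinearMap_RieF _ _ _ _ _ _).map_zero, (isLinearMap_NieF _ _ _ _ _ _ _).map_zero]
  simp

theorem exists_cw_exp (hα : α.IsSymm) (hβ : β.IsSymm) (s : ℝ) :
    ∃ r ex P, IsExpMap (cw2 α β) univ (Pi.single 0 s) (ContinuousLinearMap.id ℝ _) r ex P :=
  exists_isExpMap (isMetricOn_cw α β) (fun y _ => covDeriv_covDeriv_riemann_cw α β hα hβ y)
    (mem_univ _) Function.bijective_id

theorem gB_cw_exp {r : ℝ} {ex : (Fin (d + 2) → ℝ) → Fin (d + 2) → ℝ}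
    {P : (Fin (d + 2) → ℝ) → (Fin (d + 2) → ℝ) →L[ℝ] (Fin (d + 2) → ℝ)}
    (he : IsExpMap (cw2 α β) univ (Pi.single 0 s) (ContinuousLinearMap.id ℝ _) r ex P)
    {y w w' : Fin (d + 2) → ℝ} (hy : y ∈ Metric.ball 0 r) {E E' : ℝ → Fin (d + 2) → ℝ}
    (hE : IsCWJacobi α β s y w E) (hE' : IsCWJacobi α β s y w' E') :
    gB (cw2 α β) (ex y) (fderiv ℝ ex y w) (fderiv ℝ ex y w') = cwDot (E 1) (E' 1) := by
  obtain ⟨A, hA, h1⟩ := he.jacobi y hy w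
  obtain ⟨A', hA', h2⟩ := he.jacobi y hy w'
  rw [h1, h2, IsCWJacobi.eq hE hA, IsCWJacobi.eq hE' hA', ← gB_cw_single s]
  exact he.metric y hy _ _

end

section

section
variable {n : ℕ} {g : MetricMat n} {U : Set (Fin n → ℝ)} {x : Fin n → ℝ}
  {F : (Fin n → ℝ) →L[ℝ] (Fin n → ℝ)} {r : ℝ} {ex : (Fin n → ℝ) → Fin n → ℝ}
  {P : (Fin n → ℝ) → (Fin n → ℝ) →L[ℝ] (Fin n → ℝ)}

theorem IsExpMap.mono (h : IsExpMap g U x F r ex P) {r' : ℝ} (h0 : 0 < r') (hr : r' ≤ r) :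
    IsExpMap g U x F r' ex P := by
  have hs := Metric.ball_subset_ball (x := (0 : Fin n → ℝ)) hr
  exact ⟨h0, h.smooth.mono hs, h.map_zero, h.fderiv_zero, fun y hy => h.mapsTo y (hs hy),
    fun y hy => h.bijective y (hs hy), fun y hy => h.metric y (hs hy),
    fun y hy => h.rie y (hs hy), fun y hy => h.nie y (hs hy), fun y hy => h.jacobi y (hs hy)⟩

theorem bijective_iff_isUnit (A : (Fin n → ℝ) →L[ℝ] (Fin n → ℝ)) :
    Function.Bijective A ↔ IsUnit A :=
  ContinuousLinearMap.isUnit_iff_bijective.symm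

theorem IsExpMap.exists_immersion (h : IsExpMap g U x F r ex P) (hF : Function.Bijective F) :
    ∃ r', IsExpMap g U x F r' ex P ∧
      ∀ y ∈ Metric.ball (0 : Fin n → ℝ) r', Function.Bijective (fderiv ℝ ex y) := by
  have hc : ContinuousAt (fderiv ℝ ex) 0 :=
    ((h.smooth.fderiv_of_isOpen (m := (⊤ : ℕ∞)) Metric.isOpen_ball (by simp)).continuousOn
      ).continuousAt (Metric.ball_mem_nhds 0 h.pos)
  have hu : ∀ᶠ y in nhds (0 : Fin n → ℝ), IsUnit (fderiv ℝ ex y) := by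
    refine hc.eventually_mem (s := {A | IsUnit A}) (Units.isOpen.mem_nhds ?_)
    rw [h.fderiv_zero]
    exact (bijective_iff_isUnit F).mp hF
  obtain ⟨ε, hε, hs⟩ := Metric.eventually_nhds_iff_ball.mp hu
  refine ⟨min ε r, h.mono (lt_min hε h.pos) (min_le_right _ _), fun y hy => ?_⟩
  exact (bijective_iff_isUnit _).mpr (hs y (Metric.ball_subset_ball (min_le_left _ _) hy))

/-- Local inverses of immersions between spaces of the same dimension. -/
theorem exists_local_inverse {ε : ℝ} (hε : 0 < ε) {f : (Fin n → ℝ) → Fin n → ℝ}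
    (hf : ContDiffOn ℝ (⊤ : ℕ∞) f (Metric.ball 0 ε))
    (hb : ∀ y ∈ Metric.ball (0 : Fin n → ℝ) ε, Function.Bijective (fderiv ℝ f y)) :
    ∃ S k, IsOpen S ∧ f 0 ∈ S ∧ ContDiffOn ℝ (⊤ : ℕ∞) k S ∧
      (∀ z ∈ S, k z ∈ Metric.ball 0 ε) ∧ ∀ z ∈ S, f (k z) = z := by
  have he : ∀ y ∈ Metric.ball (0 : Fin n → ℝ) ε,
      ∃ A : (Fin n → ℝ) ≃L[ℝ] (Fin n → ℝ), HasFDerivAt f (A : (Fin n → ℝ) →L[ℝ] (Fin n → ℝ)) y := by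
    intro y hy
    refine ⟨ContinuousLinearEquiv.ofBijective (fderiv ℝ f y)
      (LinearMap.ker_eq_bot.mpr (hb y hy).1) (LinearMap.range_eq_top.mpr (hb y hy).2), ?_⟩
    rw [ContinuousLinearEquiv.coe_ofBijective]
    exact (differentiableAt_of_contDiffOn Metric.isOpen_ball hf hy).hasFDerivAt
  have h0 : (0 : Fin n → ℝ) ∈ Metric.ball (0 : Fin n → ℝ) ε := Metric.mem_ball_self hε
  have hc : ∀ y ∈ Metric.ball (0 : Fin n → ℝ) ε, ContDiffAt ℝ (⊤ : ℕ∞) f y := fun y hy =>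
    hf.contDiffAt (Metric.isOpen_ball.mem_nhds hy)
  obtain ⟨A, hA⟩ := he 0 h0
  let e := (hc 0 h0).toOpenPartialHomeomorph f hA (by simp)
  have hfe : ∀ z, e z = f z := fun z => rfl
  refine ⟨e.target ∩ e.symm ⁻¹' Metric.ball 0 ε, e.symm, ?_, ⟨?_, ?_⟩, ?_, fun z hz => hz.2,
    fun z hz => e.right_inv hz.1⟩
  · exact e.continuousOn_symm.isOpen_inter_preimage e.open_target Metric.isOpen_ball
  · exact (hc 0 h0).image_mem_toOpenPartialHomeomorph_target hA (by simp)
  · have : e.symm (f 0) = 0 :=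
      e.left_inv ((hc 0 h0).mem_toOpenPartialHomeomorph_source hA (by simp))
    rw [mem_preimage, this]; exact h0
  · intro z hz
    obtain ⟨B, hB⟩ := he _ hz.2
    exact (e.contDiffAt_symm hz.1 hB (hc _ hz.2)).contDiffWithinAt

end

section Slice
variable {a m : ℕ} {h : MetricMat (a + m)} {k : MetricMat m} {U : Set (Fin (a + m) → ℝ)}
  {V : Set (Fin m → ℝ)}

theorem dg_slice (hh : IsMetricOn h U) (hk : IsMetricOn k V)
    (hs : ∀ y ∈ U, split2 y ∈ V ∧ ∀ v W, gB h y (inj2 a m v) W = gB k (split2 y) v (split2 W))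
    {y : Fin (a + m) → ℝ} (hy : y ∈ U) (e W : Fin (a + m) → ℝ) (v : Fin m → ℝ) :
    dg h y e (inj2 a m v) W = dg k (split2 y) (split2 e) v (split2 W) := by
  have h1 := hasDerivAt_ev_const (T := gT h) (v := ![inj2 a m v, W]) (t := 0)
    (by simpa using hh.smoothTF_gT.differentiableAt hh.isOpen hy) (hasDerivAt_line y e)
  have h2 := hasDerivAt_ev_const (T := gT k) (v := ![v, split2 W]) (t := 0)
    (by simpa using hk.smoothTF_gT.differentiableAt hk.isOpen (hs y hy).1)
    (hasDerivAt_line (split2 y) (split2 e))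
  have h3 := h1.unique (h2.congr_of_eventuallyEq (by
    filter_upwards [eventually_line_mem hh.isOpen hy e] with t ht
    rw [ev_gT, ev_gT]
    exact (hs _ ht).2 v W))
  simpa [dg] using h3

theorem isAffineOn_slice (hh : IsMetricOn h U) (hk : IsMetricOn k V)
    (hs : ∀ y ∈ U, split2 y ∈ V ∧ ∀ v W, gB h y (inj2 a m v) W = gB k (split2 y) v (split2 W))
    (hV : ∀ y ∈ V, inj2 a m y ∈ U) : IsAffineOn k h (inj2 a m) V U := by
  have hD : ∀ y, fderiv ℝ (inj2 a m) y = inj2 a m := fun y => ContinuousLinearMap.fderiv _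
  refine ⟨hk, hh, (inj2 a m).contDiff.contDiffOn, hV, fun y hy u v => ?_, fun y hy u v => ?_⟩
  · rw [hD, (hs _ (hV y hy)).2, split2_inj2, split2_inj2]
  · have hc : fderiv ℝ (fderiv ℝ (inj2 a m)) y = 0 := by
      rw [funext hD]; exact fderiv_const_apply _
    rw [hc, hD]
    refine gB_ext hh (hV y hy) fun w => ?_
    simp only [_root_.zero_apply, zero_add]
    have hsym := fun u v => gB_symm (hh.symm _ (hV y hy)) u v
    rw [koszul hh (hV y hy), hsym, (hs _ (hV y hy)).2, split2_inj2,
      gB_symm (hk.symm y hy), koszul hk hy, dg_symm hh (hV y hy) (inj2 a m u) w (inj2 a m v),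
      dg_symm hh (hV y hy) (inj2 a m v) w (inj2 a m u), dg_slice hh hk hs (hV y hy),
      dg_slice hh hk hs (hV y hy), dg_slice hh hk hs (hV y hy)]
    simp only [split2_inj2]
    rw [dg_symm hk hy u (split2 w) v, dg_symm hk hy v (split2 w) u]

end Slice

end

section

section
variable {k n : ℕ}

/-- The pullback of the metric `g` by the map `f`. -/
def pullMat (g : MetricMat n) (f : (Fin k → ℝ) → Fin n → ℝ) : MetricMat k := fun y =>
  Matrix.of fun i j => gB g (f y) (fderiv ℝ f y (Pi.single i 1)) (fderiv ℝ f y (Pi.single j 1))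

theorem gB_pullMat (g : MetricMat n) (f : (Fin k → ℝ) → Fin n → ℝ) (y u v : Fin k → ℝ) :
    gB (pullMat g f) y u v = gB g (f y) (fderiv ℝ f y u) (fderiv ℝ f y v) := by
  have := bilin_ext_single (B := gB (pullMat g f) y) (B' := (gB g (f y)).compl₁₂
    (fderiv ℝ f y : (Fin k → ℝ) →ₗ[ℝ] Fin n → ℝ) (fderiv ℝ f y : (Fin k → ℝ) →ₗ[ℝ] Fin n → ℝ))
    fun i j => by rw [gB_single]; rfl
  rw [this]; rfl

theorem gB_eq_dotProduct (g : MetricMat n) (x u v : Fin n → ℝ) :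
    gB g x u v = u ⬝ᵥ (g x *ᵥ v) := by
  simp only [gB_apply, dotProduct, Matrix.mulVec, Finset.mul_sum]
  exact Finset.sum_congr rfl fun i _ => Finset.sum_congr rfl fun j _ => by ring

theorem isUnit_det_of_gB {g : MetricMat n} {x : Fin n → ℝ}
    (h : ∀ v, (∀ w, gB g x w v = 0) → v = 0) : IsUnit (g x).det := by
  rw [isUnit_iff_ne_zero]
  intro h0
  obtain ⟨v, hv, hgv⟩ := Matrix.exists_mulVec_eq_zero_iff.mpr h0
  refine hv (h v fun w => ?_)
  rw [gB_eq_dotProduct, hgv, dotProduct_zero]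

theorem isMetricOn_pullMat {g : MetricMat n} {f : (Fin k → ℝ) → Fin n → ℝ}
    {U : Set (Fin n → ℝ)} {V : Set (Fin k → ℝ)} (hg : IsMetricOn g U) (hV : IsOpen V)
    (hf : ContDiffOn ℝ (⊤ : ℕ∞) f V) (hm : MapsTo f V U)
    (hn : ∀ y ∈ V, ∀ v, (∀ w, gB g (f y) (fderiv ℝ f y w) (fderiv ℝ f y v) = 0) → v = 0) :
    IsMetricOn (pullMat g f) V := by
  have hs : ∀ y ∈ V, (pullMat g f y).IsSymm := fun y hy =>
    Matrix.IsSymm.ext fun i j => gB_symm (hg.symm _ (hm hy)) _ _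
  refine ⟨hV, fun i j => ?_, hs, fun y hy => isUnit_det_of_gB fun v hv =>
    hn y hy v fun w => by rw [← gB_pullMat]; exact hv w⟩
  have hD : ∀ i a, ContDiffOn ℝ (⊤ : ℕ∞) (fun y => fderiv ℝ f y (Pi.single i 1) a) V := fun i a =>
    contDiffOn_pi.mp ((hf.fderiv_of_isOpen (m := (⊤ : ℕ∞)) hV (by simp)).clm_apply
      contDiffOn_const) a
  simp only [pullMat, Matrix.of_apply, gB_apply]
  exact ContDiffOn.sum fun a _ => ContDiffOn.sum fun b _ =>
    ((hg.smooth a b).comp hf hm).mul ((hD i a).mul (hD j b))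

end

section
variable {d m : ℕ} {α β : Matrix (Fin d) (Fin d) ℝ}
  {ρ : (Fin m → ℝ) → (Fin m → ℝ) → (Fin m → ℝ) → (Fin m → ℝ) → ℝ}
  {g : MetricMat (d + 2 + m)} {x : Fin (d + 2 + m) → ℝ}
  {F : (Fin (d + 2 + m) → ℝ) →L[ℝ] (Fin (d + 2 + m) → ℝ)} {s r : ℝ}
  {U : Set (Fin (d + 2 + m) → ℝ)} {ex : (Fin (d + 2 + m) → ℝ) → Fin (d + 2 + m) → ℝ}
  {P : (Fin (d + 2 + m) → ℝ) → (Fin (d + 2 + m) → ℝ) →L[ℝ] (Fin (d + 2 + m) → ℝ)}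

/-- In exponential coordinates the metric splits along the Jacobi fields. -/
theorem IsStd.gB_exp (h : IsStd α β ρ g x F s) (he : IsExpMap g U x F r ex P) (hα : α.IsSymm)
    (hβ : β.IsSymm) (hg : IsMetricOn g U) {y : Fin (d + 2 + m) → ℝ} (hy : y ∈ Metric.ball 0 r)
    (w w' : Fin (d + 2 + m) → ℝ) : ∃ A A' : ℝ → Fin (d + 2) → ℝ, ∃ B B' : ℝ → Fin m → ℝ,
      IsCWJacobi α β s (split1 y) (split1 w) A ∧ IsCWJacobi α β s (split1 y) (split1 w') A' ∧
      IsSymJacobi ρ (split2 y) (split2 w) B ∧ IsSymJacobi ρ (split2 y) (split2 w') B' ∧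
      gB g (ex y) (fderiv ℝ ex y w) (fderiv ℝ ex y w') =
        cwDot (A 1) (A' 1) + B 1 ⬝ᵥ B' 1 := by
  have hx : x ∈ U := he.map_zero ▸ he.mapsTo 0 (Metric.mem_ball_self he.pos)
  obtain ⟨E, hE, h1⟩ := he.jacobi y hy w
  obtain ⟨E', hE', h2⟩ := he.jacobi y hy w'
  refine ⟨_, _, _, _, h.isCWJacobi_split hα hβ hg hx hE, h.isCWJacobi_split hα hβ hg hx hE',
    h.isSymJacobi_split hE, h.isSymJacobi_split hE', ?_⟩
  rw [h1, h2, ← h.metric]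
  exact he.metric y hy _ _

/-- The metric of the second factor, in exponential coordinates. -/
def sliceMat (g : MetricMat (d + 2 + m)) (ex : (Fin (d + 2 + m) → ℝ) → Fin (d + 2 + m) → ℝ) :
    MetricMat m := pullMat g (ex ∘ inj2 (d + 2) m)

theorem fderiv_comp_inj2 (he : IsExpMap g U x F r ex P) {y : Fin m → ℝ}
    (hy : y ∈ Metric.ball 0 r) (v : Fin m → ℝ) :
    fderiv ℝ (ex ∘ inj2 (d + 2) m) y v =
      fderiv ℝ ex (inj2 (d + 2) m y) (inj2 (d + 2) m v) := by
  rw [fderiv_comp y (differentiableAt_of_contDiffOn Metric.isOpen_ball he.smooth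
    (mem_ball_inj2 hy)) (inj2 (d + 2) m).differentiableAt, ContinuousLinearMap.fderiv]
  rfl

theorem gB_sliceMat (he : IsExpMap g U x F r ex P) {y : Fin m → ℝ}
    (hy : y ∈ Metric.ball 0 r) (u v : Fin m → ℝ) :
    gB (sliceMat g ex) y u v = gB g (ex (inj2 (d + 2) m y))
      (fderiv ℝ ex (inj2 (d + 2) m y) (inj2 (d + 2) m u))
      (fderiv ℝ ex (inj2 (d + 2) m y) (inj2 (d + 2) m v)) := by
  rw [sliceMat, gB_pullMat, fderiv_comp_inj2 he hy, fderiv_comp_inj2 he hy]; rfl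

theorem IsStd.gB_sliceMat (h : IsStd α β ρ g x F s) (he : IsExpMap g U x F r ex P)
    (hα : α.IsSymm) (hβ : β.IsSymm) (hg : IsMetricOn g U) {y : Fin m → ℝ}
    (hy : y ∈ Metric.ball 0 r) {u v : Fin m → ℝ} {B B' : ℝ → Fin m → ℝ}
    (hB : IsSymJacobi ρ y u B) (hB' : IsSymJacobi ρ y v B') :
    gB (sliceMat g ex) y u v = B 1 ⬝ᵥ B' 1 := by
  rw [SecondOrderSymmetric.gB_sliceMat he hy]
  obtain ⟨A, A', C, C', hA, -, hC, hC', e⟩ :=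
    h.gB_exp he hα hβ hg (mem_ball_inj2 hy) (inj2 (d + 2) m u) (inj2 (d + 2) m v)
  rw [split2_inj2, split2_inj2] at hC hC'
  rw [split1_inj2, split1_inj2] at hA
  rw [e, IsCWJacobi.eq hA (isCWJacobi_zero 0), hB.eq h.isLinearMap_curv hC,
    hB'.eq h.isLinearMap_curv hC']
  simp [cwDot]

theorem IsStd.sliceMat_pos (h : IsStd α β ρ g x F s) (he : IsExpMap g U x F r ex P)
    (hα : α.IsSymm) (hβ : β.IsSymm) (hg : IsMetricOn g U)
    (hb : ∀ y ∈ Metric.ball (0 : Fin (d + 2 + m) → ℝ) r, Function.Bijective (fderiv ℝ ex y))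
    {y : Fin m → ℝ} (hy : y ∈ Metric.ball 0 r) {v : Fin m → ℝ} (hv : v ≠ 0) :
    0 < gB (sliceMat g ex) y v v := by
  have hx : x ∈ U := he.map_zero ▸ he.mapsTo 0 (Metric.mem_ball_self he.pos)
  obtain ⟨E, hE, hD⟩ := he.jacobi _ (mem_ball_inj2 hy) (inj2 (d + 2) m v)
  have hB := h.isSymJacobi_split hE
  have hA := h.isCWJacobi_split hα hβ hg hx hE
  rw [split2_inj2, split2_inj2] at hB
  rw [split1_inj2, split1_inj2] at hA
  rw [h.gB_sliceMat he hα hβ hg hy hB hB]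
  refine lt_of_le_of_ne (Finset.sum_nonneg fun i _ => mul_self_nonneg _) fun h0 => hv ?_
  have hE1 : E 1 = 0 := eq_of_split (IsCWJacobi.eq hA (isCWJacobi_zero 0))
    (dotProduct_self_eq_zero.mp h0.symm)
  rw [hE1, map_zero] at hD
  have := (injective_iff_map_eq_zero _).mp (hb _ (mem_ball_inj2 hy)).1 _ hD
  rw [← split2_inj2 (a := d + 2) v, this]; rfl

theorem IsStd.isMetricOn_sliceMat (h : IsStd α β ρ g x F s) (he : IsExpMap g U x F r ex P)
    (hα : α.IsSymm) (hβ : β.IsSymm) (hg : IsMetricOn g U)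
    (hb : ∀ y ∈ Metric.ball (0 : Fin (d + 2 + m) → ℝ) r, Function.Bijective (fderiv ℝ ex y)) :
    IsMetricOn (sliceMat g ex) (Metric.ball 0 r) := by
  refine isMetricOn_pullMat hg Metric.isOpen_ball (he.smooth.comp (inj2 _ _).contDiff.contDiffOn
    fun y hy => mem_ball_inj2 hy) (fun y hy => he.mapsTo _ (mem_ball_inj2 hy)) fun y hy v hv => ?_
  by_contra h0
  have := h.sliceMat_pos he hα hβ hg hb hy h0
  rw [sliceMat, gB_pullMat, hv] at this
  exact lt_irrefl _ this

theorem IsStd.sliceMat_posDef (h : IsStd α β ρ g x F s) (he : IsExpMap g U x F r ex P)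
    (hα : α.IsSymm) (hβ : β.IsSymm) (hg : IsMetricOn g U)
    (hb : ∀ y ∈ Metric.ball (0 : Fin (d + 2 + m) → ℝ) r, Function.Bijective (fderiv ℝ ex y))
    {y : Fin m → ℝ} (hy : y ∈ Metric.ball 0 r) : (sliceMat g ex y).PosDef := by
  refine Matrix.PosDef.of_dotProduct_mulVec_pos ?_ fun v hv => ?_
  · rw [Matrix.IsHermitian, Matrix.conjTranspose_eq_transpose_of_trivial]
    exact (h.isMetricOn_sliceMat he hα hβ hg hb).symm y hy
  · have := h.sliceMat_pos he hα hβ hg hb hy hv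
    rwa [gB_eq_dotProduct] at this

theorem IsStd.isAffineOn_exp (hg : IsMetricOn g U) (he : IsExpMap g U x F r ex P)
    (hb : ∀ y ∈ Metric.ball (0 : Fin (d + 2 + m) → ℝ) r, Function.Bijective (fderiv ℝ ex y)) :
    IsAffineOn (pullMat g ex) g ex (Metric.ball 0 r) U := by
  refine isAffineOn_of_isom (isMetricOn_pullMat hg Metric.isOpen_ball he.smooth
    (fun y hy => he.mapsTo y hy) fun y hy v hv => ?_) hg he.smooth (fun y hy => he.mapsTo y hy)
    fun y _ u v => gB_pullMat g ex y u v
  have h0 := gB_nondeg (hg.nondeg _ (he.mapsTo y hy)) (v := fderiv ℝ ex y v) fun w => by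
    obtain ⟨w, rfl⟩ := (hb y hy).2 w
    exact hv w
  exact (injective_iff_map_eq_zero _).mp (hb y hy).1 _ h0

theorem IsStd.isAffineOn_slice (h : IsStd α β ρ g x F s) (he : IsExpMap g U x F r ex P)
    (hα : α.IsSymm) (hβ : β.IsSymm) (hg : IsMetricOn g U)
    (hb : ∀ y ∈ Metric.ball (0 : Fin (d + 2 + m) → ℝ) r, Function.Bijective (fderiv ℝ ex y)) :
    IsAffineOn (sliceMat g ex) (pullMat g ex) (inj2 (d + 2) m) (Metric.ball 0 r)
      (Metric.ball 0 r) := by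
  refine SecondOrderSymmetric.isAffineOn_slice (isAffineOn_exp hg he hb).source
    (h.isMetricOn_sliceMat he hα hβ hg hb) (fun y hy => ⟨mem_ball_split2 hy, fun v W => ?_⟩)
    fun y hy => mem_ball_inj2 hy
  rw [gB_pullMat]
  obtain ⟨A, A', C, C', hA, -, hC, hC', e⟩ := h.gB_exp he hα hβ hg hy (inj2 (d + 2) m v) W
  rw [split2_inj2] at hC
  rw [split1_inj2] at hA
  rw [e, IsCWJacobi.eq hA (isCWJacobi_zero _), h.gB_sliceMat he hα hβ hg (mem_ball_split2 hy) hC hC']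
  simp [cwDot]

theorem IsStd.covDeriv_sliceMat (h : IsStd α β ρ g x F s) (he : IsExpMap g U x F r ex P)
    (hα : α.IsSymm) (hβ : β.IsSymm) (hg : IsMetricOn g U)
    (hb : ∀ y ∈ Metric.ball (0 : Fin (d + 2 + m) → ℝ) r, Function.Bijective (fderiv ℝ ex y))
    {y : Fin m → ℝ} (hy : y ∈ Metric.ball 0 r) (idx : Fin 5 → Fin m) :
    covDeriv (sliceMat g ex) (riemann (sliceMat g ex)) y idx = 0 := by
  have hx : x ∈ U := he.map_zero ▸ he.mapsTo 0 (Metric.mem_ball_self he.pos)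
  have hy' := mem_ball_inj2 (a := d + 2) hy
  have hN : ∀ e w c a b, Nie (sliceMat g ex) y e w c a b = 0 := by
    intro e w c a b
    rw [(h.isAffineOn_slice he hα hβ hg hb).Nie_eq hy, (isAffineOn_exp hg he hb).Nie_eq hy',
      ContinuousLinearMap.fderiv]
    obtain ⟨E, hE, h1⟩ := he.jacobi _ hy' (inj2 (d + 2) m e)
    obtain ⟨W, -, h2⟩ := he.jacobi _ hy' (inj2 (d + 2) m w)
    obtain ⟨C, -, h3⟩ := he.jacobi _ hy' (inj2 (d + 2) m c)
    obtain ⟨A, -, h4⟩ := he.jacobi _ hy' (inj2 (d + 2) m a)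
    obtain ⟨B, -, h5⟩ := he.jacobi _ hy' (inj2 (d + 2) m b)
    have hE := h.isCWJacobi_split hα hβ hg hx hE
    rw [split1_inj2, split1_inj2] at hE
    have hE : split1 (E 1) = 0 := IsCWJacobi.eq hE (isCWJacobi_zero 0)
    rw [h1, h2, h3, h4, h5, (h.exp he hy').nie, hE, Pi.zero_apply, zero_mul]
  rw [← ev_single (covDeriv (sliceMat g ex) (riemann (sliceMat g ex)) y) idx,
    ← hN (Pi.single (idx 0) 1) (Pi.single (idx 1) 1) (Pi.single (idx 2) 1) (Pi.single (idx 3) 1)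
      (Pi.single (idx 4) 1), Nie]
  congr 1
  ext i; fin_cases i <;> rfl

theorem IsStd.Rie_sliceMat (h : IsStd α β ρ g x F s) (he : IsExpMap g U x F r ex P)
    (hα : α.IsSymm) (hβ : β.IsSymm) (hg : IsMetricOn g U)
    (hb : ∀ y ∈ Metric.ball (0 : Fin (d + 2 + m) → ℝ) r, Function.Bijective (fderiv ℝ ex y))
    (w c a b : Fin m → ℝ) : Rie (sliceMat g ex) 0 w c a b = ρ w c a b := by
  have h0 : (0 : Fin m → ℝ) ∈ Metric.ball (0 : Fin m → ℝ) r := Metric.mem_ball_self he.pos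
  rw [(h.isAffineOn_slice he hα hβ hg hb).Rie_eq h0,
    (isAffineOn_exp hg he hb).Rie_eq (mem_ball_inj2 h0), ContinuousLinearMap.fderiv, map_zero,
    he.map_zero, he.fderiv_zero, h.rie_inj2]

end

end

section

section
variable {m : ℕ}

open Classical in
/-- The point of an open set of `ℝᵐ` with given coordinates. -/
def ptOf {U : Set (Fin m → ℝ)} (p₀ : U) (x : Fin m → ℝ) : U := if h : x ∈ U then ⟨x, h⟩ else p₀

theorem ptOf_val {U : Set (Fin m → ℝ)} (p₀ : U) {x : Fin m → ℝ} (hx : x ∈ U) :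
    (ptOf p₀ x : Fin m → ℝ) = x := by rw [ptOf, dif_pos hx]

/-- The tautological chart of an open set of `ℝᵐ` with a metric. -/
def openChart {g : MetricMat m} {U : Set (Fin m → ℝ)} (hg : IsMetricOn g U) (p₀ : U) :
    MetricChart m U where
  dom := univ
  open_dom := isOpen_univ
  φ := Subtype.val
  ψ := ptOf p₀
  ran := U
  open_ran := hg.isOpen
  maps_to := fun p _ => p.2
  maps_from := fun _ _ => mem_univ _
  left_inv := fun p _ => Subtype.ext (ptOf_val p₀ p.2)
  right_inv := fun _ hx => ptOf_val p₀ hx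
  cont_phi := continuous_subtype_val.continuousOn
  cont_psi := by
    rw [Topology.IsInducing.subtypeVal.continuousOn_iff]
    exact continuousOn_id.congr fun x hx => ptOf_val p₀ hx
  g := g
  smooth_g := hg.smooth
  symm_g := hg.symm
  nondeg_g := hg.nondeg

/-- An open set of `ℝᵐ` with a metric, as a pseudo-Riemannian manifold. -/
def openManifold {g : MetricMat m} {U : Set (Fin m → ℝ)} (hg : IsMetricOn g U) (p₀ : U) :
    PRManifold m where
  M := U
  top := inferInstance
  chartAt := fun _ => openChart hg p₀
  mem_chart := fun _ => mem_univ _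
  compatible := fun _ _ => by
    have hS : Subtype.val '' ((univ : Set U) ∩ univ) = U := by simp
    change IsPullbackIsometry g g (Subtype.val ∘ ptOf p₀) (Subtype.val '' ((univ : Set U) ∩ univ))
    rw [hS, isPullbackIsometry_iff hg.isOpen]
    have hid : ∀ x ∈ U, (Subtype.val ∘ ptOf p₀) x = x := fun x hx => ptOf_val p₀ hx
    refine ⟨contDiffOn_id.congr hid, fun x hx u v => ?_⟩
    have he : (Subtype.val ∘ ptOf p₀) =ᶠ[nhds x] id :=
      Filter.eventually_of_mem (hg.isOpen.mem_nhds hx) hid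
    rw [he.fderiv_eq, fderiv_id, hid x hx]
    rfl

end

section
variable {d m : ℕ} {α β : Matrix (Fin d) (Fin d) ℝ}
  {ρ : (Fin m → ℝ) → (Fin m → ℝ) → (Fin m → ℝ) → (Fin m → ℝ) → ℝ}
  {g g₀ : MetricMat (d + 2 + m)} {x x₀ : Fin (d + 2 + m) → ℝ}
  {F F₀ : (Fin (d + 2 + m) → ℝ) →L[ℝ] (Fin (d + 2 + m) → ℝ)} {s s₀ r r₀ : ℝ}
  {U U₀ : Set (Fin (d + 2 + m) → ℝ)} {ex₀ : (Fin (d + 2 + m) → ℝ) → Fin (d + 2 + m) → ℝ}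
  {P₀ : (Fin (d + 2 + m) → ℝ) → (Fin (d + 2 + m) → ℝ) →L[ℝ] (Fin (d + 2 + m) → ℝ)}

/-- A second-order symmetric metric is locally the product of a generalized Cahen-Wallach metric
and the second factor of any metric with the same algebraic data. -/
theorem IsStd.exists_isometry (h : IsStd α β ρ g x F s) (hg : IsMetricOn g U) (hx : x ∈ U)
    (h2 : ∀ x ∈ U, ∀ idx, covDeriv g (covDeriv g (riemann g)) x idx = 0)
    (hα : α.IsSymm) (hβ : β.IsSymm) (h₀ : IsStd α β ρ g₀ x₀ F₀ s₀) (hg₀ : IsMetricOn g₀ U₀)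
    (he₀ : IsExpMap g₀ U₀ x₀ F₀ r₀ ex₀ P₀) :
    ∃ S, IsOpen S ∧ x ∈ S ∧ S ⊆ U ∧ ∃ τ : (Fin (d + 2 + m) → ℝ) → Fin (d + 2 + m) → ℝ,
      (∀ z ∈ S, split2 (n₁ := d + 2) (τ z) ∈ Metric.ball 0 r₀) ∧
      IsPullbackIsometry g (prodMetricMat (cw2 α β) (sliceMat g₀ ex₀)) τ S := by
  obtain ⟨_, ex, P, he⟩ := exists_isExpMap hg h2 hx h.bijective
  obtain ⟨r, he, hb⟩ := he.exists_immersion h.bijective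
  obtain ⟨r', ec, Pc, hec⟩ := exists_cw_exp hα hβ s
  let ε := min r (min r' r₀)
  have hε : 0 < ε := lt_min he.pos (lt_min hec.pos he₀.pos)
  have hr := Metric.ball_subset_ball (x := (0 : Fin (d + 2 + m) → ℝ)) (min_le_left r (min r' r₀))
  have hr' := Metric.ball_subset_ball (x := (0 : Fin (d + 2) → ℝ))
    ((min_le_right r (min r' r₀)).trans (min_le_left _ _))
  have hr₀ := Metric.ball_subset_ball (x := (0 : Fin m → ℝ))
    ((min_le_right r (min r' r₀)).trans (min_le_right _ _))
  obtain ⟨S, k, hS, hxS, hk, hkm, hek⟩ := exists_local_inverse hε (he.smooth.mono hr)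
    fun y hy => hb y (hr hy)
  rw [he.map_zero] at hxS
  have hk1 : ∀ z ∈ S, split1 (k z) ∈ Metric.ball (0 : Fin (d + 2) → ℝ) r' := fun z hz =>
    hr' (mem_ball_split1 (hkm z hz))
  have hk2 : ∀ z ∈ S, split2 (k z) ∈ Metric.ball (0 : Fin m → ℝ) r₀ := fun z hz =>
    hr₀ (mem_ball_split2 (hkm z hz))
  have hdk : ∀ z ∈ S, DifferentiableAt ℝ k z := fun z hz => differentiableAt_of_contDiffOn hS hk hz
  have hDk : ∀ z ∈ S, ∀ u, fderiv ℝ ex (k z) (fderiv ℝ k z u) = u := fun z hz u => by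
    have he' : ex ∘ k =ᶠ[nhds z] id := Filter.eventually_of_mem (hS.mem_nhds hz) hek
    have h1 := he'.fderiv_eq (𝕜 := ℝ)
    rw [fderiv_comp z (differentiableAt_of_contDiffOn Metric.isOpen_ball he.smooth
      (hr (hkm z hz))) (hdk z hz), fderiv_id] at h1
    exact DFunLike.congr_fun h1 u
  let τ : (Fin (d + 2 + m) → ℝ) → Fin (d + 2 + m) → ℝ := fun z =>
    Fin.append (ec (split1 (k z))) (split2 (k z))
  have hτ1 : ∀ z, split1 (τ z) = ec (split1 (k z)) := fun z => split1_append _ _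
  have hτ2 : ∀ z, split2 (τ z) = split2 (k z) := fun z => split2_append _ _
  have hs1 : ContDiffOn ℝ (⊤ : ℕ∞) (fun z => ec (spl1 (d + 2) m (k z))) S :=
    hec.smooth.comp ((spl1 (d + 2) m).contDiff.comp_contDiffOn hk) hk1
  have hs2 : ContDiffOn ℝ (⊤ : ℕ∞) (fun z => spl2 (d + 2) m (k z)) S :=
    (spl2 (d + 2) m).contDiff.comp_contDiffOn hk
  have hτ : ContDiffOn ℝ (⊤ : ℕ∞) τ S := by
    rw [contDiffOn_pi]
    refine fun i => Fin.addCases (fun i => ?_) (fun i => ?_) i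
    · exact (contDiffOn_pi.mp hs1 i).congr fun z _ => congrFun (hτ1 z) i
    · exact (contDiffOn_pi.mp hs2 i).congr fun z _ => congrFun (hτ2 z) i
  have hdτ : ∀ z ∈ S, DifferentiableAt ℝ τ z := fun z hz => differentiableAt_of_contDiffOn hS hτ hz
  have hD1 : ∀ z ∈ S, ∀ u, split1 (fderiv ℝ τ z u) =
      fderiv ℝ ec (split1 (k z)) (split1 (fderiv ℝ k z u)) := fun z hz u => by
    have h1 := (spl1 (d + 2) m).hasFDerivAt.comp z (hdτ z hz).hasFDerivAt
    have h2 := (differentiableAt_of_contDiffOn Metric.isOpen_ball hec.smooth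
      (hk1 z hz)).hasFDerivAt.comp z ((spl1 (d + 2) m).hasFDerivAt.comp z (hdk z hz).hasFDerivAt)
    have h3 : (spl1 (d + 2) m ∘ τ) = ec ∘ (spl1 (d + 2) m ∘ k) := funext hτ1
    rw [h3] at h1
    exact DFunLike.congr_fun (h1.unique h2) u
  have hD2 : ∀ z ∈ S, ∀ u, split2 (fderiv ℝ τ z u) = split2 (fderiv ℝ k z u) := fun z hz u => by
    have h1 := (spl2 (d + 2) m).hasFDerivAt.comp z (hdτ z hz).hasFDerivAt
    have h2 := (spl2 (d + 2) m).hasFDerivAt.comp z (hdk z hz).hasFDerivAt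
    have h3 : (spl2 (d + 2) m ∘ τ) = (spl2 (d + 2) m ∘ k) := funext hτ2
    rw [h3] at h1
    exact DFunLike.congr_fun (h1.unique h2) u
  refine ⟨S, hS, hxS, fun z hz => ?_, τ, fun z hz => hτ2 z ▸ hk2 z hz,
    (isPullbackIsometry_iff hS).mpr ⟨hτ, fun z hz u v => ?_⟩⟩
  · rw [← hek z hz]
    exact he.mapsTo _ (hr (hkm z hz))
  · obtain ⟨A, A', B, B', hA, hA', hB, hB', e⟩ := h.gB_exp he hα hβ hg (hr (hkm z hz))
      (fderiv ℝ k z u) (fderiv ℝ k z v)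
    rw [hDk z hz, hDk z hz, hek z hz] at e
    rw [e, gB_prodMetricMat, hD1 z hz, hD1 z hz, hD2 z hz, hD2 z hz, hτ1, hτ2,
      gB_cw_exp hec (hk1 z hz) hA hA', h₀.gB_sliceMat he₀ hα hβ hg₀ (hk2 z hz) hB hB']

end

end

section

variable {d m : ℕ} {α β : Matrix (Fin d) (Fin d) ℝ}
  {ρ : (Fin m → ℝ) → (Fin m → ℝ) → (Fin m → ℝ) → (Fin m → ℝ) → ℝ}

theorem exists_dRm_ne_zero {n : ℕ} {g : MetricMat n} {U : Set (Fin n → ℝ)} {x : Fin n → ℝ}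
    (hg : IsMetricOn g U) (hx : x ∈ U) {idx : Fin 5 → Fin n}
    (h : covDeriv g (riemann g) x idx ≠ 0) : ∃ e a b c, dRm g x e a b c ≠ 0 := by
  by_contra! h0
  refine h ?_
  have hN := Nie_eq hg hx (Pi.single (idx 0) 1) (Pi.single (idx 1) 1) (Pi.single (idx 2) 1)
    (Pi.single (idx 3) 1) (Pi.single (idx 4) 1)
  rw [h0, map_zero] at hN
  rw [← ev_single (covDeriv g (riemann g) x) idx, ← hN, Nie]
  congr 1
  ext i; fin_cases i <;> rfl

/-- The local product structure of a manifold whose algebraic curvature data is in normal form at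
every point. -/
theorem exists_factor (X : PRManifold (d + 2 + m)) (hconn : X.Conn) (h2 : X.RthSymmetric 2)
    (hα : α.IsSymm) (hβ : β.IsSymm) {p q : X.M} (hp : p ∈ (X.chartAt q).dom)
    (hst : StdAt α β ρ X q p) (hρ : 0 < m → ∃ w c a b, ρ w c a b ≠ 0) :
    ∃ Y : PRManifold m, Y.IsRiemannian ∧ Y.RthSymmetric 1 ∧ (m = 0 ∨ ¬ Y.Flat) ∧
      LocallyIsometricToCWProd X (cwMetric d fun u => u • α + β) Y := by
  have hall := forall_stdAt hconn h2 hp hst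
  obtain ⟨F, s, h⟩ := hst
  have hg := isMetricOn_chart (X.chartAt q)
  obtain ⟨_, ex, P, he⟩ := exists_isExpMap hg (covDeriv_covDeriv_chart h2 q)
    ((X.chartAt q).maps_to p hp) h.bijective
  obtain ⟨r, he, hb⟩ := he.exists_immersion h.bijective
  have h0 : (0 : Fin m → ℝ) ∈ Metric.ball (0 : Fin m → ℝ) r := Metric.mem_ball_self he.pos
  have hY := h.isMetricOn_sliceMat he hα hβ hg hb
  refine ⟨openManifold hY ⟨0, h0⟩, fun _ y hy => h.sliceMat_posDef he hα hβ hg hb hy,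
    fun _ y hy idx => h.covDeriv_sliceMat he hα hβ hg hb hy idx, ?_, fun x => ?_⟩
  · refine m.eq_zero_or_pos.imp_right fun hm hflat => ?_
    obtain ⟨w, c, a, b, hne⟩ := hρ hm
    refine hne ?_
    have hR : ev (riemann (sliceMat (X.chartAt q).g ex) 0) = 0 :=
      ev_eq_zero_iff.mpr (hflat (⟨0, h0⟩ : Metric.ball (0 : Fin m → ℝ) r) 0 h0)
    rw [← h.Rie_sliceMat he hα hβ hg hb, Rie, hR]
    rfl
  · obtain ⟨F', s', h'⟩ := hall x
    obtain ⟨S, hS, hxS, hSU, τ, hτ, hi⟩ := h'.exists_isometry (isMetricOn_chart (X.chartAt x))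
      ((X.chartAt x).maps_to x (X.mem_chart x)) (covDeriv_covDeriv_chart h2 x) hα hβ h hg he
    exact ⟨(⟨0, h0⟩ : Metric.ball (0 : Fin m → ℝ) r), S, hS, hxS, hSU, τ, hτ, hi⟩

/-- The normal form of the algebraic curvature data is a frame of the model type. -/
theorem isStd_of_normal_form {g : MetricMat (d + 2 + m)} {x : Fin (d + 2 + m) → ℝ}
    {U : Set (Fin (d + 2 + m) → ℝ)} (hg : IsMetricOn g U) (hx : x ∈ U)
    {K : CurvAlg (Fin (d + 2 + m) → ℝ)} (hG : K.G = gB g x)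
    (hR : ∀ a b c, K.R a b c = Rm g x a b c) (hT : ∀ e a b c, K.T e a b c = dRm g x e a b c)
    {F : (Fin (d + 2 + m) → ℝ) →ₗ[ℝ] (Fin (d + 2 + m) → ℝ)} (hF : Function.Bijective F)
    (h1 : ∀ y z, K.G (F y) (F z) = cwDot (split1 y) (split1 z) + ∑ j, split2 y j * split2 z j)
    (h2 : ∀ w c a b, K.G (K.R (F a) (F b) (F c)) (F w) =
      cwQ β (split1 w) (split1 c) (split1 a) (split1 b) +
        ρ (split2 w) (split2 c) (split2 a) (split2 b))
    (h3 : ∀ e w c a b, K.G (K.T (F e) (F a) (F b) (F c)) (F w) =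
      split1 e 0 * cwQ α (split1 w) (split1 c) (split1 a) (split1 b)) :
    IsStd α β ρ g x (LinearMap.toContinuousLinearMap F) 0 := by
  have hs := gB_symm (hg.symm x hx)
  refine ⟨hF, fun y z => ?_, fun w c a b => ?_, fun e w c a b => ?_⟩
  · rw [← hG]; exact h1 y z
  · rw [Rie_eq hg hx, hs, ← hR, ← hG, zero_smul, zero_add]; exact h2 w c a b
  · rw [Nie_eq hg hx, hs, ← hT, ← hG]; exact h3 e w c a b

theorem sum_sq_ne_zero (h : α ≠ 0) : ∑ i, ∑ j, α i j ^ 2 ≠ 0 := by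
  intro h0
  refine h (Matrix.ext fun i j => ?_)
  have h1 := (Finset.sum_eq_zero_iff_of_nonneg fun i _ =>
    Finset.sum_nonneg fun j _ => sq_nonneg (α i j)).mp h0 i (Finset.mem_univ i)
  have h2 := (Finset.sum_eq_zero_iff_of_nonneg fun j _ => sq_nonneg (α i j)).mp h1 j
    (Finset.mem_univ j)
  exact pow_eq_zero_iff two_ne_zero |>.mp h2

end

end SecondOrderSymmetric

/-!
## STATEMENT 0
A proper second-order symmetric spacetime (connected Lorentzian manifold with
`∇∇R = 0`, `∇R ≠ 0`) is locally isometric to a product `M₁ × M₂` of a generalized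
Cahen–Wallach space of order 2 (a plane wave on `ℝ^{d+2}` with affine profile
`p_{ij}(u) = α_{ij} u + β_{ij}`, `Σ α_{ij}² ≠ 0`) and a non-flat locally symmetric
Riemannian manifold (possibly of dimension 0, in which case the non-flatness
requirement is void).
-/
theorem proper_second_order_symmetric_local_structure
    {n : ℕ} (X : PRManifold n)
    (hconn : X.Conn) (hlor : X.IsLorentzian)
    (hsym2 : X.RthSymmetric 2) (hnotsym1 : ¬ X.RthSymmetric 1) :
    ∃ d m : ℕ, 1 ≤ d ∧ n = (d + 2) + m ∧
      ∃ α β : Matrix (Fin d) (Fin d) ℝ, α.IsSymm ∧ β.IsSymm ∧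
        (∑ i, ∑ j, (α i j) ^ 2) ≠ 0 ∧
        ∃ Y : PRManifold m, Y.IsRiemannian ∧ Y.RthSymmetric 1 ∧ (m = 0 ∨ ¬ Y.Flat) ∧
          LocallyIsometricToCWProd X (cwMetric d fun u => u • α + β) Y := by
  have hne : ∃ q, ∃ x ∈ (X.chartAt q).ran, ∃ idx : Fin 5 → Fin n,
      covDeriv (X.chartAt q).g (riemann (X.chartAt q).g) x idx ≠ 0 := by
    by_contra! h
    exact hnotsym1 fun q x hx idx => h q x hx idx
  obtain ⟨q, x, hx, idx, hidx⟩ := hne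
  have hg := SecondOrderSymmetric.isMetricOn_chart (X.chartAt q)
  obtain ⟨K, hG, hR, hT⟩ := SecondOrderSymmetric.exists_curvAlg hg
    (fun y hy idx => hsym2 q y hy idx) hx (idx 0).pos (hlor q x hx)
  have hK : K.T ≠ 0 := by
    obtain ⟨e, a, b, c, h⟩ := SecondOrderSymmetric.exists_dRm_ne_zero hg hx hidx
    exact fun h0 => h (by rw [← hT, h0]; rfl)
  obtain ⟨d, m, F, α, β, ρ, hF, hα, hβ, hα0, h1, h2, h3, hρ⟩ := K.exists_normal_form hK
  have hn : d + 2 + m = n := by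
    simpa using (LinearEquiv.ofBijective F hF).finrank_eq
  subst hn
  refine ⟨d, m, Nat.one_le_iff_ne_zero.mpr ?_, rfl, α, β, hα, hβ,
    SecondOrderSymmetric.sum_sq_ne_zero hα0, ?_⟩
  · rintro rfl
    exact hα0 (Subsingleton.elim _ _)
  · have hr := (X.chartAt q).right_inv x hx
    exact SecondOrderSymmetric.exists_factor X hconn hsym2 hα hβ ((X.chartAt q).maps_from x hx)
      ⟨_, 0, hr.symm ▸ SecondOrderSymmetric.isStd_of_normal_form hg hx hG hR hT hF h1 h2 h3⟩ hρ
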